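/- arXiv:1110.5894 — 5 statements merged into one kernel-verified Lean document; each statement's English description precedes it below -/
import Mathlib

section
/- Assume Ψ : (0,∞) → [0,∞) is strictly increasing, twice continuously differentiable with Ψ'(ζ) > 0 for all ζ > 0, ∫₀^∞ 1/(1+Ψ(ζ)) dζ < ∞, Ψ(ζ) → 0 as ζ → 0⁺, and Ψ(ζ) → ∞ as ζ → ∞. For ξ₁, ξ₂ > 0 and t ≥ 0, let Φ(ξ₁,ξ₂,t) = ∫₀^∞ (K_λ L_λ(ξ₁) − K_λ(ξ₁)) · (K_λ L_λ(ξ₂) − K_λ(ξ₂)) / (1 + K_λ²) · e^{−tΨ(λ)} dλ. Then for every real z > 0: (1/π) ∫₀^∞ Φ(ξ₁,ξ₂,t) e^{−zt} dt = φ(ξ₁,ξ₂,z) − φ(ξ₁,z)·φ(ξ₂,z)/φ(z). -/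
open MeasureTheory Filter Topology Set

/-- `φ(z) = (1/π) ∫₀^∞ 1/(Ψ(ζ)+z) dζ`, for real `z`. -/
noncomputable def phiR (Ψ : ℝ → ℝ) (z : ℝ) : ℝ :=
  (Real.pi)⁻¹ * ∫ ζ in Ioi (0:ℝ), (Ψ ζ + z)⁻¹

/-- `φ(ξ,z) = (1/π) ∫₀^∞ (ξ²/(ξ²+ζ²)) / (Ψ(ζ)+z) dζ`, for real `z`. -/
noncomputable def phi1R (Ψ : ℝ → ℝ) (ξ : ℝ) (z : ℝ) : ℝ :=
  (Real.pi)⁻¹ * ∫ ζ in Ioi (0:ℝ), (ξ^2 / (ξ^2 + ζ^2)) * (Ψ ζ + z)⁻¹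

/-- `φ(ξ₁,ξ₂,z) = (1/π) ∫₀^∞ (ξ₁²/(ξ₁²+ζ²))(ξ₂²/(ξ₂²+ζ²)) / (Ψ(ζ)+z) dζ`, for real `z`. -/
noncomputable def phi2R (Ψ : ℝ → ℝ) (ξ₁ ξ₂ : ℝ) (z : ℝ) : ℝ :=
  (Real.pi)⁻¹ * ∫ ζ in Ioi (0:ℝ),
    (ξ₁^2 / (ξ₁^2 + ζ^2)) * (ξ₂^2 / (ξ₂^2 + ζ^2)) * (Ψ ζ + z)⁻¹

/-- The point on the circle which the Cayley transform sends to `i y`. -/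
lemma cayley_circleMap_eq {k : ℝ} (hk : 0 < k) (y : ℝ) :
    (k : ℂ) * ((1 + circleMap 0 1 (Real.pi - 2 * Real.arctan (y / k))) /
      (1 - circleMap 0 1 (Real.pi - 2 * Real.arctan (y / k)))) = y * Complex.I := by
  set x := y / k with hx
  have hy : y = k * x := by rw [hx]; field_simp
  have hs : 0 < Real.sqrt (1 + x ^ 2) := Real.sqrt_pos.2 (by positivity)
  have hsq : ((Real.sqrt (1 + x ^ 2) : ℝ) : ℂ) ^ 2 = 1 + (x : ℂ) ^ 2 := by
    rw [← Complex.ofReal_pow, Real.sq_sqrt (by positivity)]; push_cast; rfl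
  have he : Complex.exp (-(Real.arctan x : ℂ) * Complex.I)
      = (1 - x * Complex.I) / (Real.sqrt (1 + x ^ 2) : ℝ) := by
    rw [Complex.exp_mul_I, Complex.cos_neg, Complex.sin_neg, ← Complex.ofReal_cos,
      ← Complex.ofReal_sin, Real.cos_arctan, Real.sin_arctan]
    push_cast
    ring
  have hq : circleMap 0 1 (Real.pi - 2 * Real.arctan x)
      = -((1 - x * Complex.I) ^ 2 / (1 + (x : ℂ) ^ 2)) := by
    rw [circleMap_zero, ← hsq, ← div_pow, ← he, ← Complex.exp_nat_mul]
    rw [show (((Real.pi - 2 * Real.arctan x : ℝ) : ℂ) * Complex.I)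
      = Real.pi * Complex.I + ((2 : ℕ) : ℂ) * (-(Real.arctan x : ℂ) * Complex.I) by
        push_cast; ring, Complex.exp_add, Complex.exp_pi_mul_I]
    simp
  have h1 : (1 + (x : ℂ) ^ 2) = (1 - x * Complex.I) * (1 + x * Complex.I) := by
    linear_combination ((x : ℂ) ^ 2) * Complex.I_sq
  have ha : (1 - x * Complex.I) ≠ 0 := by
    intro h; simpa using congrArg Complex.re h
  have hb : (1 + x * Complex.I) ≠ 0 := by
    intro h; simpa using congrArg Complex.re h
  have hq' : circleMap 0 1 (Real.pi - 2 * Real.arctan x)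
      = -((1 - x * Complex.I) / (1 + x * Complex.I)) := by
    rw [hq, h1]; field_simp
  rw [hq', hy]
  have h2 : 1 - -((1 - x * Complex.I) / (1 + x * Complex.I)) = 2 / (1 + x * Complex.I) := by
    field_simp; ring
  have h3 : 1 + -((1 - x * Complex.I) / (1 + x * Complex.I))
      = 2 * x * Complex.I / (1 + x * Complex.I) := by
    field_simp; ring
  rw [h2, h3]
  push_cast
  field_simp

lemma re_cayley {k : ℝ} {q : ℂ} :
    ((k : ℂ) * ((1 + q) / (1 - q))).re = k * ((1 - ‖q‖ ^ 2) / ‖1 - q‖ ^ 2) := by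
  rw [Complex.re_ofReal_mul]
  congr 1
  rw [Complex.div_re, ← Complex.normSq_eq_norm_sq, ← Complex.normSq_eq_norm_sq, ← add_div]
  congr 1
  simp [Complex.normSq_apply]
  ring

/-- The Poisson formula for the right half-plane, evaluated at a positive real point. -/
lemma halfPlane_poisson {G : ℂ → ℂ} {B k : ℝ} (hk : 0 < k)
    (hd : DifferentiableOn ℂ G {u | 0 < u.re}) (hc : ContinuousOn G {u | 0 ≤ u.re})
    (hB : ∀ u : ℂ, 0 ≤ u.re → ‖G u‖ ≤ B) :
    G k = (Real.pi : ℂ)⁻¹ * ∫ y : ℝ, ((k / (y ^ 2 + k ^ 2) : ℝ) : ℂ) * G (y * Complex.I) := by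
  set T : ℂ → ℂ := fun q => (k : ℂ) * ((1 + q) / (1 - q)) with hT
  have hTre : ∀ q : ℂ, ‖q‖ ≤ 1 → 0 ≤ (T q).re := fun q hq => by
    rw [hT, re_cayley]
    have : ‖q‖ ^ 2 ≤ 1 := by nlinarith [norm_nonneg q]
    exact mul_nonneg hk.le (div_nonneg (by linarith) (by positivity))
  have hTre' : ∀ q : ℂ, ‖q‖ < 1 → 0 < (T q).re := fun q hq => by
    rw [hT, re_cayley]
    have : ‖q‖ ^ 2 < 1 := by nlinarith [norm_nonneg q]
    have h1 : 1 - q ≠ 0 := by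
      intro h; have : q = 1 := by linear_combination -h
      simp [this] at hq
    have := norm_pos_iff.2 h1
    exact mul_pos hk (div_pos (by linarith) (by positivity))
  have hTd : ∀ q : ℂ, q ≠ 1 → DifferentiableAt ℂ T q := fun q hq => by
    have : 1 - q ≠ 0 := sub_ne_zero.2 (Ne.symm hq)
    fun_prop (disch := exact this)
  have hmean : ∀ r : ℝ, 0 < r → r < 1 → ∫ θ in (0:ℝ)..2 * Real.pi, G (T (circleMap 0 r θ))
      = 2 * Real.pi * G k := by
    intro r hr hr1
    have hdiff : DifferentiableOn ℂ (G ∘ T) (Metric.ball 0 1) := by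
      intro q hq
      have hq1 : ‖q‖ < 1 := by simpa using hq
      have : DifferentiableAt ℂ G (T q) :=
        (hd _ (hTre' q hq1)).differentiableAt
          ((isOpen_lt continuous_const Complex.continuous_re).mem_nhds (hTre' q hq1))
      exact (this.comp q (hTd q (by rintro rfl; simp at hq1))).differentiableWithinAt
    have h1 : DiffContOnCl ℂ (G ∘ T) (Metric.ball 0 |r|) := by
      apply DifferentiableOn.diffContOnCl
      apply hdiff.mono
      rw [closure_ball _ (by positivity), abs_of_pos hr]
      exact Metric.closedBall_subset_ball hr1
    have h2 := h1.circleAverage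
    rw [Real.circleAverage_def] at h2
    have hpi : (Real.pi : ℂ) ≠ 0 := by exact_mod_cast Real.pi_ne_zero
    have h3 : T 0 = k := by simp [hT]
    simp only [Function.comp, h3, Complex.real_smul] at h2
    rw [← h2]; push_cast; field_simp
  have hne : ∀ θ ∈ Ioo 0 (2 * Real.pi), circleMap 0 1 θ ≠ 1 := by
    intro θ hθ h
    rw [circleMap_zero] at h
    have h' : Complex.exp (θ * Complex.I) = 1 := by simpa using h
    obtain ⟨n, hn⟩ := Complex.exp_eq_one_iff.1 h'
    have h2 : θ = n * (2 * Real.pi) := by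
      have := congrArg Complex.im hn
      simpa using this
    have hpi := Real.pi_pos
    have h3 : (0:ℝ) < n := by
      by_contra hcon; push Not at hcon
      have := mul_nonpos_of_nonpos_of_nonneg hcon (by positivity : 0 ≤ 2 * Real.pi)
      linarith [hθ.1]
    have h4 : (1:ℝ) ≤ n := by exact_mod_cast (by exact_mod_cast h3 : (0:ℤ) < n)
    nlinarith [hθ.2]
  have hae : ∀ᵐ θ : ℝ, θ ∈ uIoc (0:ℝ) (2 * Real.pi) → θ ∈ Ioo 0 (2 * Real.pi) := by
    have : ∀ᵐ θ : ℝ, θ ≠ 2 * Real.pi := by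
      simp [ae_iff, measure_singleton]
    filter_upwards [this] with θ h1 h2
    rw [uIoc_of_le (by positivity)] at h2
    exact ⟨h2.1, lt_of_le_of_ne h2.2 h1⟩
  have hlim : Tendsto (fun r : ℝ => ∫ θ in (0:ℝ)..2 * Real.pi, G (T (circleMap 0 r θ)))
      (𝓝[<] 1) (𝓝 (∫ θ in (0:ℝ)..2 * Real.pi, G (T (circleMap 0 1 θ)))) := by
    have hr01 : ∀ᶠ r : ℝ in 𝓝[<] 1, 0 < r ∧ r < 1 := by
      have h1 : ∀ᶠ r : ℝ in 𝓝[<] 1, 0 < r :=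
        nhdsWithin_le_nhds (eventually_gt_nhds (by norm_num))
      filter_upwards [h1, self_mem_nhdsWithin] with r h1 h2 using ⟨h1, h2⟩
    apply intervalIntegral.tendsto_integral_filter_of_dominated_convergence (fun _ => B)
    · filter_upwards [hr01] with r hr
      have : Continuous fun θ => G (T (circleMap 0 r θ)) := by
        apply continuous_iff_continuousAt.2
        intro θ
        have hn : ‖circleMap 0 r θ‖ < 1 := by simp [abs_of_pos hr.1, hr.2]
        have h1 : ContinuousAt G (T (circleMap 0 r θ)) :=
          ((hd _ (hTre' _ hn)).differentiableAt
          ((isOpen_lt continuous_const Complex.continuous_re).mem_nhds (hTre' _ hn))).continuousAt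
        have h2 : ContinuousAt T (circleMap 0 r θ) :=
          (hTd _ (by intro h; rw [h] at hn; simp at hn)).continuousAt
        exact ContinuousAt.comp (f := fun θ => T (circleMap 0 r θ)) h1
          (ContinuousAt.comp (f := fun θ => circleMap 0 r θ) h2 (by fun_prop))
      exact this.aestronglyMeasurable
    · filter_upwards [hr01] with r hr
      refine Eventually.of_forall fun θ _ => hB _ (hTre _ ?_)
      simp [abs_of_pos hr.1, hr.2.le]
    · exact intervalIntegrable_const
    · filter_upwards [hae] with θ hθ hθ'
      have h1 := hne θ (hθ hθ')
      have h2 : Tendsto (fun r : ℝ => T (circleMap 0 r θ)) (𝓝[<] 1)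
          (𝓝 (T (circleMap 0 1 θ))) := by
        have : Tendsto (fun r : ℝ => circleMap 0 r θ) (𝓝[<] 1) (𝓝 (circleMap 0 1 θ)) := by
          have : Continuous fun r : ℝ => circleMap 0 r θ := by
            simp only [circleMap]; fun_prop
          exact this.continuousAt.tendsto.mono_left nhdsWithin_le_nhds
        exact ((hTd _ h1).continuousAt.tendsto).comp this
      have h3 : ContinuousWithinAt G {u | 0 ≤ u.re} (T (circleMap 0 1 θ)) :=
        hc _ (hTre _ (by simp))
      apply h3.tendsto.comp
      apply tendsto_nhdsWithin_iff.2 ⟨h2, ?_⟩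
      filter_upwards [hr01] with r hr
      exact hTre _ (by simp [abs_of_pos hr.1, hr.2.le])
  have hval : ∫ θ in (0:ℝ)..2 * Real.pi, G (T (circleMap 0 1 θ)) = 2 * Real.pi * G k := by
    refine tendsto_nhds_unique hlim (tendsto_const_nhds.congr' ?_)
    have h1 : ∀ᶠ r : ℝ in 𝓝[<] 1, 0 < r :=
      nhdsWithin_le_nhds (eventually_gt_nhds (by norm_num))
    filter_upwards [h1, self_mem_nhdsWithin] with r h1 h2 using (hmean r h1 h2).symm
  set p : ℝ → ℝ := fun y => Real.pi - 2 * Real.arctan (y / k) with hp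
  have hpim : p '' univ = Ioo 0 (2 * Real.pi) := by
    ext θ
    constructor
    · rintro ⟨y, -, rfl⟩
      have h1 := Real.arctan_lt_pi_div_two (y / k)
      have h2 := Real.neg_pi_div_two_lt_arctan (y / k)
      exact ⟨by simp only [hp]; linarith, by simp only [hp]; linarith⟩
    · rintro ⟨h1, h2⟩
      refine ⟨k * Real.tan ((Real.pi - θ) / 2), trivial, ?_⟩
      simp only [hp]
      rw [mul_div_cancel_left₀ _ hk.ne', Real.arctan_tan (by linarith) (by linarith)]
      ring
  have hpd : ∀ y ∈ (univ : Set ℝ),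
      HasDerivWithinAt p (-(2 * (k / (y ^ 2 + k ^ 2)))) univ y := by
    intro y _
    have := (((hasDerivAt_id y).div_const k).arctan.const_mul 2).const_sub Real.pi
    refine (this.congr_deriv ?_).hasDerivWithinAt
    simp only [id]
    field_simp
    ring
  have hpinj : InjOn p univ := by
    intro a _ b _ h
    have : Real.arctan (a / k) = Real.arctan (b / k) := by
      simp only [hp] at h; linarith
    have := Real.arctan_injective this
    field_simp at this
    exact this
  have hcv := integral_image_eq_integral_abs_deriv_smul MeasurableSet.univ hpd hpinj
    (fun θ => G (T (circleMap 0 1 θ)))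
  rw [hpim, ← integral_Ioc_eq_integral_Ioo, ← intervalIntegral.integral_of_le (by positivity),
    hval, setIntegral_univ] at hcv
  have hpi : (Real.pi : ℂ) ≠ 0 := by exact_mod_cast Real.pi_ne_zero
  have hfin : ∫ y : ℝ, |(-(2 * (k / (y ^ 2 + k ^ 2))))| • G (T (circleMap 0 1 (p y)))
      = 2 * ∫ y : ℝ, ((k / (y ^ 2 + k ^ 2) : ℝ) : ℂ) * G (y * Complex.I) := by
    rw [← integral_const_mul]
    congr 1
    ext y
    simp only [hT, hp]
    rw [cayley_circleMap_eq hk, abs_neg, abs_of_pos (by positivity), Complex.real_smul]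
    push_cast
    ring
  rw [hfin] at hcv
  field_simp
  linear_combination hcv / 2

lemma integrable_poisson {k : ℝ} (hk : 0 < k) :
    Integrable fun y : ℝ => k / (y ^ 2 + k ^ 2) := by
  have := (integrable_inv_one_add_sq.comp_div hk.ne').const_mul k⁻¹
  refine this.congr (Eventually.of_forall fun y => ?_)
  simp only
  field_simp
  ring

section HalfPlane

variable {H : ℂ → ℂ} {C : ℝ}

lemma halfPlane_shift_re (hd : DifferentiableOn ℂ H {u | 0 < u.re})
    (hC : ∀ u : ℂ, 0 < u.re → ‖H u‖ ≤ C / u.re) (hC0 : 0 ≤ C)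
    (hsymm : ∀ u : ℂ, 0 < u.re → (H (starRingEnd ℂ u)).re = (H u).re)
    {ε k : ℝ} (hε : 0 < ε) (hk : 0 < k) :
    IntegrableOn (fun y : ℝ => k / (y ^ 2 + k ^ 2) * (H (ε + y * Complex.I)).re) (Ioi 0) ∧
    ∫ y in Ioi (0:ℝ), k / (y ^ 2 + k ^ 2) * (H (ε + y * Complex.I)).re
      = Real.pi / 2 * (H (k + ε : ℝ)).re := by
  have hcont : ContinuousOn (fun u : ℂ => H (ε + u)) {u | 0 ≤ u.re} := by
    apply hd.continuousOn.comp (by fun_prop)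
    intro u hu
    simp only [mem_ofPred_eq, Complex.add_re, Complex.ofReal_re] at hu ⊢
    linarith
  have hdiff : DifferentiableOn ℂ (fun u : ℂ => H (ε + u)) {u | 0 < u.re} := by
    apply hd.comp (by fun_prop)
    intro u hu
    simp only [mem_ofPred_eq, Complex.add_re, Complex.ofReal_re] at hu ⊢
    linarith
  have hB : ∀ u : ℂ, 0 ≤ u.re → ‖H (ε + u)‖ ≤ C / ε := by
    intro u hu
    refine (hC _ (by simp; linarith)).trans ?_
    apply div_le_div_of_nonneg_left hC0 hε
    simp; linarith
  have hp := halfPlane_poisson hk hdiff hcont hB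
  have hcontI : Continuous fun y : ℝ => H (ε + y * Complex.I) := by
    have : ContinuousOn (fun y : ℝ => H (ε + y * Complex.I)) univ :=
      hcont.comp (by fun_prop : ContinuousOn (fun y : ℝ => (y : ℂ) * Complex.I) univ)
        (by intro y _; simp)
    exact continuousOn_univ.1 this
  have hint : Integrable fun y : ℝ =>
      ((k / (y ^ 2 + k ^ 2) : ℝ) : ℂ) * H (ε + y * Complex.I) := by
    refine (integrable_poisson hk).ofReal.mul_bdd (c := C / ε) hcontI.aestronglyMeasurable ?_
    exact Eventually.of_forall fun y => hB _ (by simp)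
  have hintre : Integrable fun y : ℝ =>
      k / (y ^ 2 + k ^ 2) * (H (ε + y * Complex.I)).re := by
    refine hint.re.congr (Eventually.of_forall fun y => ?_)
    simp only [RCLike.re_to_complex, Complex.re_ofReal_mul]
  refine ⟨hintre.integrableOn, ?_⟩
  have habs := integral_comp_abs
    (f := fun y : ℝ => k / (y ^ 2 + k ^ 2) * (H (ε + y * Complex.I)).re)
  have habs' : ∫ y : ℝ, k / (|y| ^ 2 + k ^ 2) * (H (ε + (|y| : ℝ) * Complex.I)).re
      = ∫ y : ℝ, k / (y ^ 2 + k ^ 2) * (H (ε + y * Complex.I)).re := by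
    congr 1
    ext y
    rw [sq_abs]
    congr 1
    rcases abs_choice y with h | h
    · rw [h]
    · rw [h, ← hsymm _ (by simp [hε])]
      simp
  rw [habs'] at habs
  have hre : ∫ y : ℝ, k / (y ^ 2 + k ^ 2) * (H (ε + y * Complex.I)).re
      = Real.pi * (H (k + ε : ℝ)).re := by
    have h1 : ∫ y : ℝ, k / (y ^ 2 + k ^ 2) * (H (ε + y * Complex.I)).re
        = (∫ y : ℝ, ((k / (y ^ 2 + k ^ 2) : ℝ) : ℂ) * H (ε + y * Complex.I)).re := by
      rw [← RCLike.re_to_complex, ← integral_re hint]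
      simp only [RCLike.re_to_complex, Complex.re_ofReal_mul]
    have hpi : (Real.pi : ℂ) ≠ 0 := by exact_mod_cast Real.pi_ne_zero
    have h2 : ∫ y : ℝ, ((k / (y ^ 2 + k ^ 2) : ℝ) : ℂ) * H (ε + y * Complex.I)
        = Real.pi * H (ε + k) := by
      rw [hp, ← mul_assoc, mul_inv_cancel₀ hpi, one_mul]
    rw [h1, h2, Complex.re_ofReal_mul, add_comm (ε : ℂ)]
    push_cast
    rfl
  linarith

/-- A holomorphic function with nonnegative real part on the right half-plane, with no mass
at the origin and at infinity, is the Poisson integral of its boundary values. -/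
lemma halfPlane_poisson_boundary (hd : DifferentiableOn ℂ H {u | 0 < u.re})
    (hC : ∀ u : ℂ, 0 < u.re → ‖H u‖ ≤ C / u.re) (hC0 : 0 ≤ C)
    (hsymm : ∀ u : ℂ, 0 < u.re → (H (starRingEnd ℂ u)).re = (H u).re)
    (hpos : ∀ u : ℂ, 0 < u.re → 0 ≤ (H u).re)
    {f : ℝ → ℝ}
    (hlim : ∀ y : ℝ, 0 < y →
      Tendsto (fun ε : ℝ => (H (ε + y * Complex.I)).re) (𝓝[>] 0) (𝓝 (f y)))
    (hbd : ∀ a b : ℝ, 0 < a → a ≤ b → ∃ B : ℝ, ∀ᶠ ε : ℝ in 𝓝[>] 0, ∀ y ∈ Icc a b,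
      (H (ε + y * Complex.I)).re ≤ B)
    (h0 : Tendsto (fun k : ℝ => k * (H k).re) (𝓝[>] 0) (𝓝 0)) {k : ℝ} (hk : 0 < k) :
    IntegrableOn (fun y : ℝ => k / (y ^ 2 + k ^ 2) * f y) (Ioi 0) ∧
    ∫ y in Ioi (0:ℝ), k / (y ^ 2 + k ^ 2) * f y = Real.pi / 2 * (H k).re := by
  have hshift := fun (ε k : ℝ) (hε : 0 < ε) (hk : 0 < k) =>
    halfPlane_shift_re hd hC hC0 hsymm hε hk
  have hcontε : ∀ ε : ℝ, 0 < ε → Continuous fun y : ℝ => (H (ε + y * Complex.I)).re := by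
    intro ε hε
    have : ContinuousOn (fun y : ℝ => H (ε + y * Complex.I)) univ :=
      hd.continuousOn.comp (by fun_prop) (by intro y _; simp [hε])
    exact Complex.continuous_re.comp (continuousOn_univ.1 this)
  have hfpos : ∀ y : ℝ, 0 < y → 0 ≤ f y := by
    intro y hy
    refine ge_of_tendsto (hlim y hy) ?_
    filter_upwards [self_mem_nhdsWithin] with ε (hε : 0 < ε)
    exact hpos _ (by simp [hε])
  have hreal : ∀ k : ℝ, 0 < k → Tendsto (fun ε : ℝ => (H (k + ε : ℝ)).re) (𝓝[>] 0)
      (𝓝 (H k).re) := by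
    intro k hk
    have h1 : ContinuousAt H (k : ℂ) := (hd.differentiableAt
      ((isOpen_lt continuous_const Complex.continuous_re).mem_nhds
        (by simpa using hk))).continuousAt
    have h2 : Tendsto (fun ε : ℝ => ((k + ε : ℝ) : ℂ)) (𝓝[>] 0) (𝓝 (k : ℂ)) := by
      have : Continuous (fun ε : ℝ => ((k + ε : ℝ) : ℂ)) := by fun_prop
      have := this.tendsto 0
      simp only [add_zero] at this
      exact this.mono_left nhdsWithin_le_nhds
    exact (Complex.continuous_re.tendsto _).comp (h1.tendsto.comp h2)
  have hE : ∀ n : ℝ, 1 ≤ n →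
      IntegrableOn (fun y : ℝ => k / (y ^ 2 + k ^ 2) * f y) (Icc n⁻¹ n) ∧
      Tendsto (fun ε : ℝ => ∫ y in Icc n⁻¹ n, k / (y ^ 2 + k ^ 2) * (H (ε + y * Complex.I)).re)
        (𝓝[>] 0) (𝓝 (∫ y in Icc n⁻¹ n, k / (y ^ 2 + k ^ 2) * f y)) := by
    intro n hn
    have hn0 : 0 < n := by linarith
    have hnn : n⁻¹ ≤ n := (inv_le_one_of_one_le₀ hn).trans hn
    obtain ⟨B, hB⟩ := hbd n⁻¹ n (by positivity) hnn
    have hi : IntegrableOn (fun y : ℝ => k / (y ^ 2 + k ^ 2) * B) (Icc n⁻¹ n) :=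
      ((integrable_poisson hk).mul_const B).integrableOn
    have hmeas : ∀ᶠ ε : ℝ in 𝓝[>] 0, AEStronglyMeasurable
        (fun y : ℝ => k / (y ^ 2 + k ^ 2) * (H (ε + y * Complex.I)).re)
        (volume.restrict (Icc n⁻¹ n)) := by
      filter_upwards [self_mem_nhdsWithin] with ε hε
      exact ((integrable_poisson hk).aestronglyMeasurable.mul
        (hcontε ε hε).aestronglyMeasurable).mono_measure Measure.restrict_le_self
    have hdom : ∀ᶠ ε : ℝ in 𝓝[>] 0, ∀ᵐ y : ℝ ∂(volume.restrict (Icc n⁻¹ n)),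
        ‖k / (y ^ 2 + k ^ 2) * (H (ε + y * Complex.I)).re‖ ≤ k / (y ^ 2 + k ^ 2) * B := by
      filter_upwards [self_mem_nhdsWithin, hB] with ε (hε : 0 < ε) hBε
      refine (ae_restrict_iff' measurableSet_Icc).2 (Eventually.of_forall fun y hy => ?_)
      have := hpos (ε + y * Complex.I) (by simp [hε])
      rw [Real.norm_of_nonneg (by positivity)]
      gcongr
      exact hBε y hy
    have hptw : ∀ᵐ y : ℝ ∂(volume.restrict (Icc n⁻¹ n)), Tendsto
        (fun ε : ℝ => k / (y ^ 2 + k ^ 2) * (H (ε + y * Complex.I)).re) (𝓝[>] 0)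
        (𝓝 (k / (y ^ 2 + k ^ 2) * f y)) := by
      refine (ae_restrict_iff' measurableSet_Icc).2 (Eventually.of_forall fun y hy => ?_)
      exact (hlim y (lt_of_lt_of_le (by positivity) hy.1)).const_mul _
    refine ⟨?_, tendsto_integral_filter_of_dominated_convergence _ hmeas hdom hi hptw⟩
    refine hi.mono' (aestronglyMeasurable_of_tendsto_ae (𝓝[>] (0:ℝ))
      (f := fun (ε : ℝ) (y : ℝ) => k / (y ^ 2 + k ^ 2) *
        (H ((if 0 < ε then ε else 1 : ℝ) + y * Complex.I)).re) (fun ε => ?_) ?_) ?_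
    · refine ((integrable_poisson hk).aestronglyMeasurable.mul
        (hcontε _ ?_).aestronglyMeasurable).mono_measure Measure.restrict_le_self
      split_ifs with h
      · exact h
      · norm_num
    · filter_upwards [hptw] with y hy
      refine hy.congr' ?_
      filter_upwards [self_mem_nhdsWithin] with ε (hε : 0 < ε)
      simp [hε]
    · refine (ae_restrict_iff' measurableSet_Icc).2 (Eventually.of_forall fun y hy => ?_)
      have hy0 : 0 < y := lt_of_lt_of_le (by positivity) hy.1
      have := hfpos y hy0
      rw [Real.norm_of_nonneg (by positivity)]
      gcongr
      refine le_of_tendsto (hlim y hy0) ?_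
      filter_upwards [hB] with ε hBε using hBε y hy
  have hupper : ∀ n : ℝ, 1 ≤ n → ∫ y in Icc n⁻¹ n, k / (y ^ 2 + k ^ 2) * f y
      ≤ Real.pi / 2 * (H k).re := by
    intro n hn
    have hn0 : 0 < n := by linarith
    refine le_of_tendsto_of_tendsto (hE n hn).2 ((hreal k hk).const_mul _) ?_
    filter_upwards [self_mem_nhdsWithin] with ε (hε : 0 < ε)
    rw [← (hshift ε k hε hk).2]
    refine setIntegral_mono_set (hshift ε k hε hk).1 ?_ (Eventually.of_forall ?_)
    · refine Eventually.of_forall fun y => ?_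
      have := hpos (ε + y * Complex.I) (by simp [hε])
      simp only [Pi.zero_apply]
      positivity
    · intro y hy
      exact lt_of_lt_of_le (by positivity : 0 < n⁻¹) hy.1
  have hlower : ∀ n : ℝ, 1 ≤ n → Real.pi / 2 * (H k).re
      - (2 / (k * n) * (Real.pi / 2 * (H (n⁻¹ : ℝ)).re) + 2 * k / n * (Real.pi / 2 * (H n).re))
      ≤ ∫ y in Icc n⁻¹ n, k / (y ^ 2 + k ^ 2) * f y := by
    intro n hn
    have hn0 : 0 < n := by linarith
    have hni : 0 < n⁻¹ := by positivity
    refine le_of_tendsto_of_tendsto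
      (((hreal k hk).const_mul _).sub ((((hreal n⁻¹ hni).const_mul _).const_mul _).add
        (((hreal n hn0).const_mul _).const_mul _))) (hE n hn).2 ?_
    filter_upwards [self_mem_nhdsWithin] with ε (hε : 0 < ε)
    obtain ⟨i1, e1⟩ := hshift ε k hε hk
    obtain ⟨i2, e2⟩ := hshift ε n⁻¹ hε hni
    obtain ⟨i3, e3⟩ := hshift ε n hε hn0
    have hind : ∫ y in Icc n⁻¹ n, k / (y ^ 2 + k ^ 2) * (H (ε + y * Complex.I)).re
        = ∫ y in Ioi 0, (Icc n⁻¹ n).indicator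
          (fun y : ℝ => k / (y ^ 2 + k ^ 2) * (H (ε + y * Complex.I)).re) y := by
      rw [setIntegral_indicator measurableSet_Icc, inter_eq_right.2]
      intro y hy
      exact lt_of_lt_of_le hni hy.1
    have i23 : IntegrableOn (fun y : ℝ =>
        2 / (k * n) * (n⁻¹ / (y ^ 2 + n⁻¹ ^ 2) * (H (ε + y * Complex.I)).re)
          + 2 * k / n * (n / (y ^ 2 + n ^ 2) * (H (ε + y * Complex.I)).re)) (Ioi 0) :=
      (i2.const_mul _).add (i3.const_mul _)
    rw [hind, ← e1, ← e2, ← e3, sub_le_iff_le_add, ← integral_const_mul, ← integral_const_mul,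
      ← integral_add (i2.const_mul _) (i3.const_mul _),
      ← integral_add (i1.indicator measurableSet_Icc) i23]
    refine setIntegral_mono_on i1 ((i1.indicator measurableSet_Icc).add i23) measurableSet_Ioi ?_
    intro y (hy : 0 < y)
    have hh := hpos (ε + y * Complex.I) (by simp [hε])
    set r := (H (ε + y * Complex.I)).re
    have ha : 0 ≤ 2 / (k * n) * (n⁻¹ / (y ^ 2 + n⁻¹ ^ 2) * r) := by positivity
    have hb : 0 ≤ 2 * k / n * (n / (y ^ 2 + n ^ 2) * r) := by positivity
    by_cases hyE : y ∈ Icc n⁻¹ n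
    · rw [indicator_of_mem hyE]
      linarith
    · rw [indicator_of_notMem hyE, zero_add]
      rcases lt_or_ge y n⁻¹ with h | h
      · have h2 : k / (y ^ 2 + k ^ 2) ≤ 2 / (k * n) * (n⁻¹ / (y ^ 2 + n⁻¹ ^ 2)) := by
          have h3 : k / (y ^ 2 + k ^ 2) ≤ 1 / k := by
            rw [div_le_div_iff₀ (by positivity) hk]; nlinarith
          have h4 : 1 / k ≤ 2 / (k * n) * (n⁻¹ / (y ^ 2 + n⁻¹ ^ 2)) := by
            rw [show 2 / (k * n) * (n⁻¹ / (y ^ 2 + n⁻¹ ^ 2))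
              = 1 / k * (2 * n⁻¹ ^ 2 / (y ^ 2 + n⁻¹ ^ 2)) by field_simp]
            refine le_mul_of_one_le_right (by positivity) ?_
            rw [one_le_div (by positivity)]
            nlinarith
          exact h3.trans h4
        nlinarith [mul_le_mul_of_nonneg_right h2 hh]
      · have hyn : n < y := by
          by_contra hcon
          exact hyE ⟨h, not_lt.1 hcon⟩
        have h2 : k / (y ^ 2 + k ^ 2) ≤ 2 * k / n * (n / (y ^ 2 + n ^ 2)) := by
          rw [show 2 * k / n * (n / (y ^ 2 + n ^ 2)) = 2 * k / (y ^ 2 + n ^ 2) by field_simp]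
          rw [div_le_div_iff₀ (by positivity) (by positivity)]
          have : y ^ 2 + n ^ 2 ≤ 2 * (y ^ 2 + k ^ 2) := by nlinarith [sq_nonneg k]
          nlinarith
        nlinarith [mul_le_mul_of_nonneg_right h2 hh]
  have herr : Tendsto (fun n : ℝ => Real.pi / 2 * (H k).re
      - (2 / (k * n) * (Real.pi / 2 * (H (n⁻¹ : ℝ)).re) + 2 * k / n * (Real.pi / 2 * (H n).re)))
      atTop (𝓝 (Real.pi / 2 * (H k).re)) := by
    have t1 : Tendsto (fun n : ℝ => 2 / (k * n) * (Real.pi / 2 * (H (n⁻¹ : ℝ)).re)) atTop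
        (𝓝 0) := by
      have := (h0.comp tendsto_inv_atTop_nhdsGT_zero).const_mul (Real.pi / k)
      rw [mul_zero] at this
      refine this.congr' ?_
      filter_upwards [eventually_gt_atTop 0] with n hn
      simp only [Function.comp]
      field_simp
    have t2 : Tendsto (fun n : ℝ => 2 * k / n * (Real.pi / 2 * (H n).re)) atTop (𝓝 0) := by
      have hz : Tendsto (fun n : ℝ => k * Real.pi * C * (n⁻¹ * n⁻¹)) atTop (𝓝 0) := by
        simpa using ((tendsto_inv_atTop_zero (𝕜 := ℝ)).mul
          (tendsto_inv_atTop_zero (𝕜 := ℝ))).const_mul (k * Real.pi * C)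
      refine squeeze_zero' ?_ ?_ hz
      · filter_upwards [eventually_gt_atTop 0] with n hn
        have := hpos n (by simpa using hn)
        positivity
      · filter_upwards [eventually_gt_atTop 0] with n hn
        have h1 : (H n).re ≤ C / n := by
          refine (Complex.re_le_norm _).trans ?_
          simpa using hC n (by simpa using hn)
        calc 2 * k / n * (Real.pi / 2 * (H n).re) ≤ 2 * k / n * (Real.pi / 2 * (C / n)) := by
              gcongr
          _ = _ := by field_simp
    simpa using (t1.add t2).const_sub (Real.pi / 2 * (H k).re)
  have htend : Tendsto (fun n : ℝ => ∫ y in Icc n⁻¹ n, k / (y ^ 2 + k ^ 2) * f y) atTop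
      (𝓝 (Real.pi / 2 * (H k).re)) := by
    refine tendsto_of_tendsto_of_tendsto_of_le_of_le' herr tendsto_const_nhds ?_ ?_
    · filter_upwards [eventually_ge_atTop 1] with n hn using hlower n hn
    · filter_upwards [eventually_ge_atTop 1] with n hn using hupper n hn
  have hcover : AECover (volume.restrict (Ioi (0:ℝ))) atTop fun n : ℝ => Icc n⁻¹ n := by
    refine ⟨?_, fun n => measurableSet_Icc⟩
    refine (ae_restrict_iff' measurableSet_Ioi).2 (Eventually.of_forall fun y (hy : 0 < y) => ?_)
    filter_upwards [eventually_ge_atTop y, eventually_ge_atTop y⁻¹] with n h1 h2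
    exact ⟨inv_le_of_inv_le₀ hy h2, h1⟩
  have hrestr : ∀ᶠ n : ℝ in atTop, (volume.restrict (Ioi (0:ℝ))).restrict (Icc n⁻¹ n)
      = volume.restrict (Icc n⁻¹ n) := by
    filter_upwards [eventually_ge_atTop 1] with n hn
    rw [Measure.restrict_restrict measurableSet_Icc, inter_eq_left.2]
    intro y hy
    exact lt_of_lt_of_le (inv_pos.2 (by linarith)) hy.1
  have hnonneg : ∀ᵐ y : ℝ ∂(volume.restrict (Ioi (0:ℝ))), 0 ≤ k / (y ^ 2 + k ^ 2) * f y := by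
    refine (ae_restrict_iff' measurableSet_Ioi).2 (Eventually.of_forall fun y (hy : 0 < y) => ?_)
    have := hfpos y hy
    positivity
  have htend' : Tendsto (fun n : ℝ => ∫ y in Icc n⁻¹ n, k / (y ^ 2 + k ^ 2) * f y
      ∂(volume.restrict (Ioi 0))) atTop (𝓝 (Real.pi / 2 * (H k).re)) := by
    refine htend.congr' ?_
    filter_upwards [hrestr] with n hn
    rw [hn]
  have hI : Integrable (fun y : ℝ => k / (y ^ 2 + k ^ 2) * f y) (volume.restrict (Ioi 0)) := by
    have hsub : Tendsto (fun n : ℕ => ((n : ℝ) + 1)) atTop atTop :=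
      tendsto_atTop_add_const_right _ _ tendsto_natCast_atTop_atTop
    refine (hcover.comp_tendsto hsub).integrable_of_integral_tendsto_of_nonneg_ae
      (Real.pi / 2 * (H k).re) (fun n => ?_) hnonneg (htend'.comp hsub)
    have := (hE (n + 1 : ℝ) (by linarith [Nat.cast_nonneg (α := ℝ) n])).1
    exact IntegrableOn.mono_measure this Measure.restrict_le_self
  exact ⟨hI, hcover.integral_eq_of_tendsto _ hI htend'⟩

end HalfPlane

lemma integral_sub_mul_add_mul {α : Type*} [MeasurableSpace α] {μ : Measure α} {f g k : α → ℂ}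
    (hf : Integrable f μ) (hg : Integrable g μ) (hk : Integrable k μ) (b c : ℂ) :
    ∫ x, (f x - b * g x + c * k x) ∂μ
      = ∫ x, f x ∂μ - b * ∫ x, g x ∂μ + c * ∫ x, k x ∂μ := by
  have : Integrable (fun x => f x - b * g x) μ := hf.sub (hg.const_mul b)
  rw [integral_add this (hk.const_mul c), integral_sub hf (hg.const_mul b), integral_const_mul,
    integral_const_mul]

/-- The kernel `u / (s + u²)`. -/
noncomputable def stieltjesKernel (s : ℝ) (u : ℂ) : ℂ := u / (s + u ^ 2)

lemma norm_add_sq_ge (s : ℝ) (u : ℂ) :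
    u.re * (s + ‖u‖ ^ 2) ≤ ‖u‖ * ‖(s : ℂ) + u ^ 2‖ := by
  have h : (starRingEnd ℂ u * (s + u ^ 2)).re = u.re * (s + ‖u‖ ^ 2) := by
    rw [← Complex.normSq_eq_norm_sq, Complex.normSq_apply]
    simp [pow_two]
    ring
  rw [← h, ← Complex.norm_conj u, ← norm_mul]
  exact Complex.re_le_norm _

lemma norm_pos_of_re_pos {u : ℂ} (hu : 0 < u.re) : 0 < ‖u‖ :=
  hu.trans_le (Complex.re_le_norm u)

lemma norm_add_sq_pos {s : ℝ} {u : ℂ} (hs : 0 ≤ s) (hu : 0 < u.re) :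
    0 < ‖(s : ℂ) + u ^ 2‖ := by
  have h1 := norm_add_sq_ge s u
  have h2 := norm_pos_of_re_pos hu
  have h3 : 0 < u.re * (s + ‖u‖ ^ 2) := by positivity
  by_contra hcon
  nlinarith [norm_nonneg ((s : ℂ) + u ^ 2)]

lemma add_sq_ne_zero {s : ℝ} {u : ℂ} (hs : 0 ≤ s) (hu : 0 < u.re) : (s : ℂ) + u ^ 2 ≠ 0 :=
  norm_pos_iff.1 (norm_add_sq_pos hs hu)

lemma re_stieltjesKernel {s : ℝ} {u : ℂ} :
    (stieltjesKernel s u).re = u.re * (s + ‖u‖ ^ 2) / ‖(s : ℂ) + u ^ 2‖ ^ 2 := by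
  rw [stieltjesKernel, Complex.div_re, ← add_div, ← Complex.normSq_eq_norm_sq,
    ← Complex.normSq_eq_norm_sq]
  congr 1
  simp [pow_two, Complex.normSq_apply u]
  ring

lemma norm_stieltjesKernel_le {s : ℝ} {u : ℂ} (hs : 0 ≤ s) (hu : 0 < u.re) :
    ‖stieltjesKernel s u‖ ≤ ‖u‖ ^ 2 / (u.re * (s + ‖u‖ ^ 2)) := by
  have h1 := norm_add_sq_ge s u
  have h2 := norm_pos_of_re_pos hu
  rw [stieltjesKernel, norm_div, div_le_div_iff₀ (norm_add_sq_pos hs hu) (by positivity)]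
  nlinarith

lemma re_stieltjesKernel_eq_mul_norm_sq {s : ℝ} {u : ℂ} (hu : 0 < u.re) :
    (stieltjesKernel s u).re =
      u.re * (s + ‖u‖ ^ 2) / ‖u‖ ^ 2 * ‖stieltjesKernel s u‖ ^ 2 := by
  have h2 := norm_pos_of_re_pos hu
  rw [re_stieltjesKernel, stieltjesKernel, norm_div]
  field_simp

lemma hasDerivAt_stieltjesKernel {s : ℝ} {u : ℂ} (hs : 0 ≤ s) (hu : 0 < u.re) :
    HasDerivAt (stieltjesKernel s) ((s - u ^ 2) / (s + u ^ 2) ^ 2) u := by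
  have := (hasDerivAt_id u).div (((hasDerivAt_id u).pow 2).const_add (s : ℂ))
    (add_sq_ne_zero hs hu)
  refine this.congr_deriv ?_
  simp only [id, Pi.pow_apply]
  ring

lemma norm_deriv_stieltjesKernel_le {s : ℝ} {u : ℂ} (hs : 0 ≤ s) (hu : 0 < u.re) :
    ‖((s : ℂ) - u ^ 2) / (s + u ^ 2) ^ 2‖ ≤ ‖u‖ ^ 2 / (u.re ^ 2 * (s + ‖u‖ ^ 2)) := by
  have h1 := norm_add_sq_ge s u
  have h2 := norm_pos_of_re_pos hu
  have h3 := norm_add_sq_pos hs hu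
  have h4 : ‖(s : ℂ) - u ^ 2‖ ≤ s + ‖u‖ ^ 2 := by
    refine (norm_sub_le _ _).trans ?_
    rw [norm_pow, Complex.norm_real, Real.norm_of_nonneg hs]
  rw [norm_div, norm_pow, div_le_div_iff₀ (by positivity) (by positivity)]
  have h5 : (u.re * (s + ‖u‖ ^ 2)) ^ 2 ≤ (‖u‖ * ‖(s : ℂ) + u ^ 2‖) ^ 2 := by gcongr
  calc ‖(s : ℂ) - u ^ 2‖ * (u.re ^ 2 * (s + ‖u‖ ^ 2))
      ≤ (s + ‖u‖ ^ 2) * (u.re ^ 2 * (s + ‖u‖ ^ 2)) := by gcongr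
    _ = (u.re * (s + ‖u‖ ^ 2)) ^ 2 := by ring
    _ ≤ _ := h5
    _ = _ := by ring

lemma stieltjesKernel_conj (s : ℝ) (u : ℂ) :
    stieltjesKernel s (starRingEnd ℂ u) = starRingEnd ℂ (stieltjesKernel s u) := by
  simp [stieltjesKernel]

/-- The regularity assumptions on `Ψ`, with its first two derivatives. -/
structure IsSymbol (Ψ Ψ' Ψ'' : ℝ → ℝ) : Prop where
  strictMono : StrictMonoOn Ψ (Ioi 0)
  pos : ∀ ζ ∈ Ioi (0:ℝ), 0 < Ψ ζ
  deriv : ∀ ζ ∈ Ioi (0:ℝ), HasDerivAt Ψ (Ψ' ζ) ζ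
  deriv2 : ∀ ζ ∈ Ioi (0:ℝ), HasDerivAt Ψ' (Ψ'' ζ) ζ
  cont2 : ContinuousOn Ψ'' (Ioi 0)
  deriv_pos : ∀ ζ ∈ Ioi (0:ℝ), 0 < Ψ' ζ
  int : IntegrableOn (fun ζ => 1 / (1 + Ψ ζ)) (Ioi 0)
  tendsto_zero : Tendsto Ψ (𝓝[>] 0) (𝓝 0)
  tendsto_top : Tendsto Ψ atTop atTop

/-- `u φ_M(u²)`, without the factor `1/π`, where `φ_M` is the transform weighted by `M`. -/
noncomputable def symbolTransform (Ψ M : ℝ → ℝ) (u : ℂ) : ℂ :=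
  ∫ ζ in Ioi (0:ℝ), (M ζ : ℂ) * stieltjesKernel (Ψ ζ) u

/-- `u` times the Schur complement `φ_{L²}(u²) - φ_L(u²)² / φ(u²)`. -/
noncomputable def schurTransform (Ψ L : ℝ → ℝ) (u : ℂ) : ℂ :=
  symbolTransform Ψ (fun ζ => L ζ ^ 2) u
    - symbolTransform Ψ L u ^ 2 / symbolTransform Ψ (fun _ => 1) u

/-- A bounded measurable function on the half-line. -/
structure IsBddWeight (M : ℝ → ℝ) : Prop where
  meas : AEStronglyMeasurable M (volume.restrict (Ioi 0))
  bdd : ∃ B : ℝ, ∀ ζ ∈ Ioi (0:ℝ), |M ζ| ≤ B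

namespace IsBddWeight

lemma const (c : ℝ) : IsBddWeight fun _ => c :=
  ⟨aestronglyMeasurable_const, |c|, fun _ _ => le_rfl⟩

lemma add {M N : ℝ → ℝ} (hM : IsBddWeight M) (hN : IsBddWeight N) :
    IsBddWeight fun ζ => M ζ + N ζ := by
  obtain ⟨A, hA⟩ := hM.bdd
  obtain ⟨B, hB⟩ := hN.bdd
  exact ⟨hM.meas.add hN.meas, A + B, fun ζ hζ =>
    (abs_add_le _ _).trans (add_le_add (hA ζ hζ) (hB ζ hζ))⟩

lemma mul {M N : ℝ → ℝ} (hM : IsBddWeight M) (hN : IsBddWeight N) :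
    IsBddWeight fun ζ => M ζ * N ζ := by
  obtain ⟨A, hA⟩ := hM.bdd
  obtain ⟨B, hB⟩ := hN.bdd
  refine ⟨hM.meas.mul hN.meas, A * B, fun ζ hζ => ?_⟩
  rw [abs_mul]
  exact mul_le_mul (hA ζ hζ) (hB ζ hζ) (abs_nonneg _) ((abs_nonneg _).trans (hA ζ hζ))

lemma sub {M N : ℝ → ℝ} (hM : IsBddWeight M) (hN : IsBddWeight N) :
    IsBddWeight fun ζ => M ζ - N ζ := by
  simpa only [neg_one_mul, ← sub_eq_add_neg] using hM.add ((const (-1)).mul hN)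

lemma sq {M : ℝ → ℝ} (hM : IsBddWeight M) : IsBddWeight fun ζ => M ζ ^ 2 := by
  simpa only [pow_two] using hM.mul hM

end IsBddWeight

namespace IsSymbol

variable {Ψ Ψ' Ψ'' : ℝ → ℝ}

lemma aestronglyMeasurable (h : IsSymbol Ψ Ψ' Ψ'') :
    AEStronglyMeasurable Ψ (volume.restrict (Ioi 0)) :=
  ContinuousOn.aestronglyMeasurable
    (fun ζ hζ => (h.deriv ζ hζ).continuousAt.continuousWithinAt) measurableSet_Ioi

lemma integrable_inv_add (h : IsSymbol Ψ Ψ' Ψ'') {c : ℝ} (hc : 0 < c) :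
    IntegrableOn (fun ζ => (Ψ ζ + c)⁻¹) (Ioi 0) := by
  refine (h.int.const_mul (1 + 1 / c)).mono' ?_ ?_
  · exact (h.aestronglyMeasurable.aemeasurable.add_const c).inv.aestronglyMeasurable
  · refine (ae_restrict_iff' measurableSet_Ioi).2 (Eventually.of_forall fun ζ hζ => ?_)
    have := h.pos ζ hζ
    rw [Real.norm_of_nonneg (by positivity), ← div_eq_mul_one_div, inv_eq_one_div,
      div_le_div_iff₀ (by positivity) (by positivity)]
    have : (1 + 1 / c) * (Ψ ζ + c) = Ψ ζ + c + Ψ ζ / c + 1 := by field_simp; ring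
    have : 0 ≤ Ψ ζ / c := by positivity
    linarith

lemma kernel_aestronglyMeasurable (h : IsSymbol Ψ Ψ' Ψ'') (u : ℂ) :
    AEStronglyMeasurable (fun ζ => stieltjesKernel (Ψ ζ) u) (volume.restrict (Ioi 0)) := by
  have : Measurable fun s : ℝ => stieltjesKernel s u := by
    unfold stieltjesKernel; fun_prop
  exact (this.comp_aemeasurable h.aestronglyMeasurable.aemeasurable).aestronglyMeasurable

lemma mul_kernel_aestronglyMeasurable (h : IsSymbol Ψ Ψ' Ψ'') {M : ℝ → ℝ}
    (hM : AEStronglyMeasurable M (volume.restrict (Ioi 0))) (u : ℂ) :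
    AEStronglyMeasurable (fun ζ => (M ζ : ℂ) * stieltjesKernel (Ψ ζ) u)
      (volume.restrict (Ioi 0)) :=
  (Complex.continuous_ofReal.comp_aestronglyMeasurable hM).mul (h.kernel_aestronglyMeasurable u)

lemma integrable_mul_kernel (h : IsSymbol Ψ Ψ' Ψ'') {M : ℝ → ℝ} (hM : IsBddWeight M) {u : ℂ}
    (hu : 0 < u.re) :
    IntegrableOn (fun ζ => (M ζ : ℂ) * stieltjesKernel (Ψ ζ) u) (Ioi 0) := by
  obtain ⟨B, hB⟩ := hM.bdd
  have hn := norm_pos_of_re_pos hu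
  refine ((h.integrable_inv_add (by positivity : 0 < ‖u‖ ^ 2)).const_mul
    (B * (‖u‖ ^ 2 / u.re))).mono' (h.mul_kernel_aestronglyMeasurable hM.meas u) ?_
  refine (ae_restrict_iff' measurableSet_Ioi).2 (Eventually.of_forall fun ζ hζ => ?_)
  have hp := h.pos ζ hζ
  rw [norm_mul, Complex.norm_real, Real.norm_eq_abs]
  refine (mul_le_mul (hB ζ hζ) (norm_stieltjesKernel_le hp.le hu) (norm_nonneg _)
    ((abs_nonneg _).trans (hB ζ hζ))).trans_eq ?_
  field_simp

lemma differentiableOn_symbolTransform (h : IsSymbol Ψ Ψ' Ψ'') {M : ℝ → ℝ} (hM : IsBddWeight M) :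
    DifferentiableOn ℂ (symbolTransform Ψ M) {u | 0 < u.re} := by
  intro u₀ hu₀
  replace hu₀ : 0 < u₀.re := hu₀
  obtain ⟨B, hB⟩ := hM.bdd
  set r := u₀.re / 2 with hr
  have hr0 : 0 < r := by positivity
  have hball : ∀ u ∈ Metric.ball u₀ r, r < u.re ∧ ‖u‖ < ‖u₀‖ + r := by
    intro u hu
    have h1 : ‖u - u₀‖ < r := by simpa [dist_eq_norm] using hu
    have h2 := (Complex.abs_re_le_norm (u - u₀)).trans_lt h1
    rw [Complex.sub_re, abs_lt] at h2
    have h3 := norm_le_norm_add_norm_sub' u u₀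
    exact ⟨by linarith, by linarith⟩
  have key := hasDerivAt_integral_of_dominated_loc_of_deriv_le
    (μ := volume.restrict (Ioi (0:ℝ)))
    (F := fun u ζ => (M ζ : ℂ) * stieltjesKernel (Ψ ζ) u)
    (F' := fun u ζ => (M ζ : ℂ) * (((Ψ ζ : ℂ) - u ^ 2) / ((Ψ ζ : ℂ) + u ^ 2) ^ 2))
    (x₀ := u₀) (s := Metric.ball u₀ r)
    (bound := fun ζ => B * ((‖u₀‖ + r) ^ 2 / r ^ 2) * (Ψ ζ + r ^ 2)⁻¹)
    (Metric.ball_mem_nhds _ hr0)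
    (Eventually.of_forall fun u => h.mul_kernel_aestronglyMeasurable hM.meas u)
    (h.integrable_mul_kernel hM hu₀) ?_ ?_ ((h.integrable_inv_add (by positivity)).const_mul _) ?_
  · exact key.2.differentiableAt.differentiableWithinAt
  · have : Measurable fun s : ℝ => (((s : ℂ) - u₀ ^ 2) / ((s : ℂ) + u₀ ^ 2) ^ 2) := by fun_prop
    exact (Complex.continuous_ofReal.comp_aestronglyMeasurable hM.meas).mul
      (this.comp_aemeasurable h.aestronglyMeasurable.aemeasurable).aestronglyMeasurable
  · refine (ae_restrict_iff' measurableSet_Ioi).2 (Eventually.of_forall fun ζ hζ u hu => ?_)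
    obtain ⟨h1, h2⟩ := hball u hu
    have hp := h.pos ζ hζ
    have hre : 0 < u.re := hr0.trans h1
    have hBn : 0 ≤ B := (abs_nonneg _).trans (hB ζ hζ)
    have hru : r ≤ ‖u‖ := h1.le.trans (Complex.re_le_norm u)
    rw [norm_mul, Complex.norm_real, Real.norm_eq_abs, mul_assoc]
    refine mul_le_mul (hB ζ hζ) ((norm_deriv_stieltjesKernel_le hp.le hre).trans ?_)
      (norm_nonneg _) hBn
    calc ‖u‖ ^ 2 / (u.re ^ 2 * (Ψ ζ + ‖u‖ ^ 2))
        ≤ (‖u₀‖ + r) ^ 2 / (r ^ 2 * (Ψ ζ + r ^ 2)) := by gcongr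
      _ = _ := by field_simp
  · refine (ae_restrict_iff' measurableSet_Ioi).2 (Eventually.of_forall fun ζ hζ u hu => ?_)
    exact (hasDerivAt_stieltjesKernel (h.pos ζ hζ).le (hr0.trans (hball u hu).1)).const_mul _

lemma symbolTransform_conj (M : ℝ → ℝ) (u : ℂ) :
    symbolTransform Ψ M (starRingEnd ℂ u) = starRingEnd ℂ (symbolTransform Ψ M u) := by
  rw [symbolTransform, symbolTransform, ← integral_conj]
  congr 1
  ext ζ
  simp [stieltjesKernel_conj]

lemma re_symbolTransform (h : IsSymbol Ψ Ψ' Ψ'') {M : ℝ → ℝ} (hM : IsBddWeight M) {u : ℂ}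
    (hu : 0 < u.re) :
    (symbolTransform Ψ M u).re
      = ∫ ζ in Ioi (0:ℝ), M ζ * (stieltjesKernel (Ψ ζ) u).re := by
  rw [symbolTransform, ← RCLike.re_to_complex, ← integral_re (h.integrable_mul_kernel hM hu)]
  simp only [RCLike.re_to_complex, Complex.re_ofReal_mul]

lemma re_kernel_pos (h : IsSymbol Ψ Ψ' Ψ'') {ζ : ℝ} (hζ : ζ ∈ Ioi (0:ℝ)) {u : ℂ} (hu : 0 < u.re) :
    0 < (stieltjesKernel (Ψ ζ) u).re := by
  have h1 := h.pos ζ hζ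
  have h2 := norm_add_sq_pos h1.le hu
  rw [re_stieltjesKernel]
  positivity

lemma integrable_re_kernel (h : IsSymbol Ψ Ψ' Ψ'') {u : ℂ} (hu : 0 < u.re) :
    IntegrableOn (fun ζ => (stieltjesKernel (Ψ ζ) u).re) (Ioi 0) := by
  have : Integrable (fun ζ => (stieltjesKernel (Ψ ζ) u).re) (volume.restrict (Ioi 0)) := by
    simpa using (h.integrable_mul_kernel (IsBddWeight.const 1) hu).re
  exact this

lemma re_symbolTransform_one_pos (h : IsSymbol Ψ Ψ' Ψ'') {u : ℂ} (hu : 0 < u.re) :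
    0 < (symbolTransform Ψ (fun _ => 1) u).re := by
  rw [h.re_symbolTransform (IsBddWeight.const 1) hu]
  simp only [one_mul]
  rw [setIntegral_pos_iff_support_of_nonneg_ae _ (h.integrable_re_kernel hu)]
  · have : Function.support (fun ζ => (stieltjesKernel (Ψ ζ) u).re) ∩ Ioi 0 = Ioi 0 :=
      inter_eq_right.2 fun ζ hζ => (h.re_kernel_pos hζ hu).ne'
    rw [this, Real.volume_Ioi]
    simp
  · exact (ae_restrict_iff' measurableSet_Ioi).2
      (Eventually.of_forall fun ζ hζ => (h.re_kernel_pos hζ hu).le)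

lemma symbolTransform_one_ne_zero (h : IsSymbol Ψ Ψ' Ψ'') {u : ℂ} (hu : 0 < u.re) :
    symbolTransform Ψ (fun _ => 1) u ≠ 0 := by
  intro h0
  have := h.re_symbolTransform_one_pos hu
  rw [h0] at this
  simp at this

lemma differentiableOn_schurTransform (h : IsSymbol Ψ Ψ' Ψ'') {L : ℝ → ℝ} (hL : IsBddWeight L) :
    DifferentiableOn ℂ (schurTransform Ψ L) {u | 0 < u.re} := by
  refine (h.differentiableOn_symbolTransform hL.sq).sub
    (((h.differentiableOn_symbolTransform hL).pow 2).div
      (h.differentiableOn_symbolTransform (IsBddWeight.const 1)) ?_)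
  intro u hu
  exact h.symbolTransform_one_ne_zero hu

lemma schurTransform_conj (L : ℝ → ℝ) (u : ℂ) :
    schurTransform Ψ L (starRingEnd ℂ u) = starRingEnd ℂ (schurTransform Ψ L u) := by
  simp [schurTransform, symbolTransform_conj]

/-- The Schur complement does not change when a constant is subtracted from the weight. -/
lemma schurTransform_sub_const (h : IsSymbol Ψ Ψ' Ψ'') {L : ℝ → ℝ} (hL : IsBddWeight L) (a : ℝ)
    {u : ℂ}
    (hu : 0 < u.re) : schurTransform Ψ (fun ζ => L ζ - a) u = schurTransform Ψ L u := by
  have i0 := h.integrable_mul_kernel (IsBddWeight.const 1) hu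
  have i1 := h.integrable_mul_kernel hL hu
  have i2 := h.integrable_mul_kernel hL.sq hu
  have e1 : symbolTransform Ψ (fun ζ => L ζ - a) u
      = symbolTransform Ψ L u - a * symbolTransform Ψ (fun _ => 1) u := by
    simp only [symbolTransform]
    rw [← integral_const_mul, ← integral_sub i1 (i0.const_mul _)]
    congr 1; ext ζ; push_cast; ring
  have e2 : symbolTransform Ψ (fun ζ => (L ζ - a) ^ 2) u
      = symbolTransform Ψ (fun ζ => L ζ ^ 2) u - 2 * a * symbolTransform Ψ L u
        + a ^ 2 * symbolTransform Ψ (fun _ => 1) u := by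
    simp only [symbolTransform]
    rw [← integral_sub_mul_add_mul i2 i1 i0]
    congr 1; ext ζ; push_cast; ring
  have hne := h.symbolTransform_one_ne_zero hu
  rw [schurTransform, schurTransform, e1, e2]
  field_simp
  ring

/-- Variational form of the Schur complement. -/
lemma schurTransform_eq (h : IsSymbol Ψ Ψ' Ψ'') {L : ℝ → ℝ} (hL : IsBddWeight L) {u : ℂ}
    (hu : 0 < u.re) :
    ∃ c : ℂ,
      IntegrableOn (fun ζ => ((‖(L ζ : ℂ) - c‖ ^ 2 : ℝ) : ℂ) * stieltjesKernel (Ψ ζ) u) (Ioi 0) ∧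
      schurTransform Ψ L u
        = ∫ ζ in Ioi (0:ℝ), ((‖(L ζ : ℂ) - c‖ ^ 2 : ℝ) : ℂ) * stieltjesKernel (Ψ ζ) u ∧
      schurTransform Ψ L u
        = ∫ ζ in Ioi (0:ℝ), (L ζ : ℂ) * (((L ζ : ℂ) - c) * stieltjesKernel (Ψ ζ) u) := by
  have i0 := h.integrable_mul_kernel (IsBddWeight.const 1) hu
  have i1 := h.integrable_mul_kernel hL hu
  have i2 := h.integrable_mul_kernel hL.sq hu
  have hne := h.symbolTransform_one_ne_zero hu
  set c := symbolTransform Ψ L u / symbolTransform Ψ (fun _ => 1) u with hc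
  have hexp : ∀ ζ, ((‖(L ζ : ℂ) - c‖ ^ 2 : ℝ) : ℂ) * stieltjesKernel (Ψ ζ) u
      = ((L ζ ^ 2 : ℝ) : ℂ) * stieltjesKernel (Ψ ζ) u
        - (c + starRingEnd ℂ c) * ((L ζ : ℂ) * stieltjesKernel (Ψ ζ) u)
        + c * starRingEnd ℂ c * (((1 : ℝ) : ℂ) * stieltjesKernel (Ψ ζ) u) := by
    intro ζ
    rw [← Complex.normSq_eq_norm_sq, ← Complex.mul_conj]
    simp only [map_sub, Complex.conj_ofReal]
    push_cast
    ring
  have hexp' : ∀ ζ, (L ζ : ℂ) * (((L ζ : ℂ) - c) * stieltjesKernel (Ψ ζ) u)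
      = ((L ζ ^ 2 : ℝ) : ℂ) * stieltjesKernel (Ψ ζ) u
        - c * ((L ζ : ℂ) * stieltjesKernel (Ψ ζ) u) := by
    intro ζ
    push_cast
    ring
  refine ⟨c, ?_, ?_, ?_⟩
  · simp only [hexp]
    exact (i2.sub (i1.const_mul _)).add (i0.const_mul _)
  · simp only [hexp]
    rw [integral_sub_mul_add_mul i2 i1 i0]
    simp only [schurTransform, symbolTransform] at hc hne ⊢
    rw [hc]
    field_simp
    ring
  · simp only [hexp']
    rw [integral_sub i2 (i1.const_mul _), integral_const_mul]
    simp only [schurTransform, symbolTransform] at hc hne ⊢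
    rw [hc]
    field_simp

lemma re_schurTransform_nonneg (h : IsSymbol Ψ Ψ' Ψ'') {L : ℝ → ℝ} (hL : IsBddWeight L) {u : ℂ}
    (hu : 0 < u.re) :
    0 ≤ (schurTransform Ψ L u).re := by
  obtain ⟨c, hi, e, -⟩ := h.schurTransform_eq hL hu
  rw [e, ← RCLike.re_to_complex, ← integral_re hi]
  refine setIntegral_nonneg measurableSet_Ioi fun ζ hζ => ?_
  rw [RCLike.re_to_complex, Complex.re_ofReal_mul]
  exact mul_nonneg (by positivity) (h.re_kernel_pos hζ hu).le

lemma norm_schurTransform_le (h : IsSymbol Ψ Ψ' Ψ'') {L : ℝ → ℝ} (hL : IsBddWeight L) {u : ℂ}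
    (hu : 0 < u.re) :
    ‖schurTransform Ψ L u‖
      ≤ ‖u‖ ^ 2 / u.re * ∫ ζ in Ioi (0:ℝ), L ζ ^ 2 * (Ψ ζ + ‖u‖ ^ 2)⁻¹ := by
  obtain ⟨c, hi, e, e'⟩ := h.schurTransform_eq hL hu
  have hn := norm_pos_of_re_pos hu
  obtain ⟨B, hB⟩ := hL.sq.bdd
  have hiL : IntegrableOn (fun ζ => L ζ ^ 2 * (Ψ ζ + ‖u‖ ^ 2)⁻¹) (Ioi 0) := by
    refine (h.integrable_inv_add (by positivity : 0 < ‖u‖ ^ 2)).bdd_mul (c := B) hL.sq.meas ?_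
    exact (ae_restrict_iff' measurableSet_Ioi).2 (Eventually.of_forall fun ζ hζ => hB ζ hζ)
  have hre : (schurTransform Ψ L u).re
      = ∫ ζ in Ioi (0:ℝ), ‖(L ζ : ℂ) - c‖ ^ 2 * (stieltjesKernel (Ψ ζ) u).re := by
    rw [e, ← RCLike.re_to_complex, ← integral_re hi]
    simp only [RCLike.re_to_complex, Complex.re_ofReal_mul]
  have hire : Integrable (fun ζ => ‖(L ζ : ℂ) - c‖ ^ 2 * (stieltjesKernel (Ψ ζ) u).re)
      (volume.restrict (Ioi 0)) := by
    have := hi.re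
    simpa only [RCLike.re_to_complex, Complex.re_ofReal_mul] using this
  have hle : ‖schurTransform Ψ L u‖ ≤ ∫ ζ in Ioi (0:ℝ),
      (1 / 2 * (‖(L ζ : ℂ) - c‖ ^ 2 * (stieltjesKernel (Ψ ζ) u).re)
        + 1 / 2 * (‖u‖ ^ 2 / u.re * (L ζ ^ 2 * (Ψ ζ + ‖u‖ ^ 2)⁻¹))) := by
    rw [e']
    refine norm_integral_le_of_norm_le
      ((hire.const_mul _).add ((hiL.const_mul _).const_mul _)) ?_
    refine (ae_restrict_iff' measurableSet_Ioi).2 (Eventually.of_forall fun ζ hζ => ?_)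
    have hp := h.pos ζ hζ
    rw [re_stieltjesKernel_eq_mul_norm_sq hu, norm_mul, norm_mul, Complex.norm_real,
      Real.norm_eq_abs, ← sq_abs (L ζ)]
    set a := |L ζ|
    set b := ‖(L ζ : ℂ) - c‖ * ‖stieltjesKernel (Ψ ζ) u‖ with hb
    set p := u.re * (Ψ ζ + ‖u‖ ^ 2) / ‖u‖ ^ 2 with hp'
    have hp0 : 0 < p := by positivity
    have e1 : ‖u‖ ^ 2 / u.re * (a ^ 2 * (Ψ ζ + ‖u‖ ^ 2)⁻¹) = a ^ 2 / p := by
      rw [hp']; field_simp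
    have e2 : ‖(L ζ : ℂ) - c‖ ^ 2 * (p * ‖stieltjesKernel (Ψ ζ) u‖ ^ 2) = p * b ^ 2 := by
      rw [hb]; ring
    rw [e1, e2]
    have : 0 ≤ (a - p * b) ^ 2 / p := by positivity
    have e3 : (a - p * b) ^ 2 / p = a ^ 2 / p - 2 * (a * b) + p * b ^ 2 := by
      field_simp; ring
    linarith
  rw [integral_add (hire.const_mul _) ((hiL.const_mul _).const_mul _), integral_const_mul,
    integral_const_mul, ← hre, integral_const_mul] at hle
  have := Complex.re_le_norm (schurTransform Ψ L u)
  linarith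

end IsSymbol

lemma tendsto_setIntegral_diff_Icc {f : ℝ → ℝ} {s : Set ℝ}
    (hf : IntegrableOn f s) (x : ℝ) :
    Tendsto (fun ε : ℝ => ∫ ζ in s \ Icc (x - ε) (x + ε), f ζ) (𝓝[>] 0)
      (𝓝 (∫ ζ in s, f ζ)) := by
  have e : ∀ ε : ℝ, ∫ ζ in s \ Icc (x - ε) (x + ε), f ζ
      = ∫ ζ in s, (Icc (x - ε) (x + ε))ᶜ.indicator f ζ := by
    intro ε
    rw [setIntegral_indicator measurableSet_Icc.compl]
    rfl
  simp only [e]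
  refine tendsto_integral_filter_of_dominated_convergence (fun ζ => ‖f ζ‖)
    (Eventually.of_forall fun ε => hf.aestronglyMeasurable.indicator measurableSet_Icc.compl)
    (Eventually.of_forall fun ε => Eventually.of_forall fun ζ => norm_indicator_le_norm_self _ _)
    hf.norm ?_
  have : ∀ᵐ ζ ∂(volume.restrict s), ζ ≠ x :=
    ae_restrict_of_ae (Measure.ae_ne volume x)
  filter_upwards [this] with ζ hζ
  refine tendsto_const_nhds.congr' ?_
  have hpos : 0 < |ζ - x| := abs_pos.2 (sub_ne_zero.2 hζ)
  filter_upwards [nhdsWithin_le_nhds (Iio_mem_nhds hpos)] with ε hε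
  rw [indicator_of_mem]
  rintro ⟨h1, h2⟩
  have : |ζ - x| ≤ ε := abs_le.2 ⟨by linarith, by linarith⟩
  exact absurd hε (not_lt.2 this)

lemma abs_sub_sq_le_norm {s : ℝ} (hs : 0 ≤ s) (ε y : ℝ) :
    |s - y ^ 2| ≤ ‖(s : ℂ) + (ε + y * Complex.I) ^ 2‖ := by
  have e : (s : ℂ) + (ε + y * Complex.I) ^ 2
      = ((s - y ^ 2 + ε ^ 2 : ℝ) : ℂ) + ((2 * ε * y : ℝ) : ℂ) * Complex.I := by
    push_cast
    linear_combination (y : ℂ) ^ 2 * Complex.I_sq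
  rw [e, Complex.norm_add_mul_I]
  refine Real.le_sqrt_of_sq_le ?_
  rw [sq_abs]
  nlinarith [mul_nonneg hs (sq_nonneg ε), sq_nonneg (ε ^ 2), sq_nonneg (ε * y)]

namespace IsSymbol

variable {Ψ Ψ' Ψ'' : ℝ → ℝ}

lemma continuousOn (h : IsSymbol Ψ Ψ' Ψ'') : ContinuousOn Ψ (Ioi 0) := fun ζ hζ =>
  (h.deriv ζ hζ).continuousAt.continuousWithinAt

lemma continuousOn_deriv (h : IsSymbol Ψ Ψ' Ψ'') : ContinuousOn Ψ' (Ioi 0) := fun ζ hζ =>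
  (h.deriv2 ζ hζ).continuousAt.continuousWithinAt

lemma _root_.Icc_subset_Ioi_zero {a b : ℝ} (ha : 0 < a) : Icc a b ⊆ Ioi (0:ℝ) :=
  fun _ hx => ha.trans_le hx.1

lemma exists_mul_abs_sub_le (h : IsSymbol Ψ Ψ' Ψ'') {a b : ℝ} (ha : 0 < a) (hab : a ≤ b) :
    ∃ m > 0, ∀ x ∈ Icc a b, ∀ y ∈ Icc a b, m * |x - y| ≤ |Ψ x - Ψ y| := by
  have hsub : Icc a b ⊆ Ioi (0:ℝ) := Icc_subset_Ioi_zero ha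
  obtain ⟨x₀, hx₀, hmin⟩ := isCompact_Icc.exists_isMinOn (nonempty_Icc.2 hab)
    (h.continuousOn_deriv.mono hsub)
  refine ⟨Ψ' x₀, h.deriv_pos _ (hsub hx₀), ?_⟩
  have key : ∀ x ∈ Icc a b, ∀ y ∈ Icc a b, x ≤ y → Ψ' x₀ * (y - x) ≤ Ψ y - Ψ x := by
    intro x hx y hy hxy
    refine (convex_Icc a b).mul_sub_le_image_sub_of_le_deriv (h.continuousOn.mono hsub)
      (fun ζ hζ => ?_) (fun ζ hζ => ?_) x hx y hy hxy
    · exact (h.deriv ζ (hsub (interior_subset hζ))).differentiableAt.differentiableWithinAt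
    · rw [(h.deriv ζ (hsub (interior_subset hζ))).deriv]
      exact hmin (interior_subset hζ)
  intro x hx y hy
  rcases le_total x y with hxy | hxy
  · have := key x hx y hy hxy
    rw [abs_sub_comm, abs_of_nonneg (sub_nonneg.2 hxy), abs_sub_comm]
    exact this.trans (le_abs_self _)
  · have := key y hy x hx hxy
    rw [abs_of_nonneg (sub_nonneg.2 hxy)]
    exact this.trans (le_abs_self _)

lemma exists_far_bound (h : IsSymbol Ψ Ψ' Ψ'') {a b : ℝ} (ha : 0 < a) (hab : a ≤ b) :
    ∃ D ≥ 0, ∀ l ∈ Icc a b, ∀ ζ ∈ Ioi (0:ℝ), ζ ∉ Icc (a / 2) (2 * b) →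
      1 + Ψ ζ ≤ D * |Ψ ζ - Ψ l| := by
  have hb : 0 < b := ha.trans_le hab
  have ha2 : 0 < a / 2 := by positivity
  have hb2 : 0 < 2 * b := by positivity
  have d1 : 0 < Ψ a - Ψ (a / 2) := sub_pos.2 (h.strictMono ha2 ha (by linarith))
  have d2 : 0 < Ψ (2 * b) - Ψ b := sub_pos.2 (h.strictMono hb hb2 (by linarith))
  have p1 := h.pos _ ha2
  have p2 := h.pos _ hb
  refine ⟨(1 + Ψ (a / 2)) / (Ψ a - Ψ (a / 2)) + (1 + (1 + Ψ b) / (Ψ (2 * b) - Ψ b)),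
    by positivity, fun l hl ζ hζ hn => ?_⟩
  have hl0 : 0 < l := ha.trans_le hl.1
  rw [mem_Icc, not_and_or, not_le, not_le] at hn
  rw [add_mul]
  rcases hn with hn | hn
  · have h1 : Ψ ζ ≤ Ψ (a / 2) := (h.strictMono hζ ha2 hn).le
    have h2 : Ψ a ≤ Ψ l := h.strictMono.monotoneOn ha hl0 hl.1
    have h3 : Ψ a - Ψ (a / 2) ≤ |Ψ ζ - Ψ l| := by
      rw [abs_sub_comm]
      exact le_trans (by linarith) (le_abs_self _)
    have h4 : 1 + Ψ (a / 2) ≤ (1 + Ψ (a / 2)) / (Ψ a - Ψ (a / 2)) * |Ψ ζ - Ψ l| := by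
      rw [div_mul_eq_mul_div, le_div_iff₀ d1]
      gcongr
    have h5 : 0 ≤ (1 + (1 + Ψ b) / (Ψ (2 * b) - Ψ b)) * |Ψ ζ - Ψ l| := by positivity
    linarith
  · have h1 : Ψ (2 * b) ≤ Ψ ζ := (h.strictMono hb2 hζ hn).le
    have h2 : Ψ l ≤ Ψ b := h.strictMono.monotoneOn hl0 hb hl.2
    have h3 : Ψ ζ - Ψ b ≤ |Ψ ζ - Ψ l| := le_trans (by linarith) (le_abs_self _)
    have h4 : 1 + Ψ b ≤ (1 + Ψ b) / (Ψ (2 * b) - Ψ b) * |Ψ ζ - Ψ l| := by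
      rw [div_mul_eq_mul_div, le_div_iff₀ d2]
      gcongr
      linarith
    have h5 : 0 ≤ (1 + Ψ (a / 2)) / (Ψ a - Ψ (a / 2)) * |Ψ ζ - Ψ l| := by positivity
    rw [add_mul]
    linarith

/-- A bounded quantity that is Lipschitz on the diagonal is controlled by the difference of the
values of the symbol. -/
lemma exists_quot_bound (h : IsSymbol Ψ Ψ' Ψ'') {a b : ℝ} (ha : 0 < a) (hab : a ≤ b) {B C : ℝ}
    (hB : 0 ≤ B)
    (hC : 0 ≤ C) :
    ∃ D ≥ 0, ∀ l ∈ Icc a b, ∀ ζ ∈ Ioi (0:ℝ), ∀ x : ℝ, |x| ≤ B →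
      (ζ ∈ Icc (a / 2) (2 * b) → |x| ≤ C * |ζ - l|) → |x| * (1 + Ψ ζ) ≤ D * |Ψ ζ - Ψ l| := by
  have hb : 0 < b := ha.trans_le hab
  have hb2 : 0 < 2 * b := by positivity
  obtain ⟨D, hD0, hD⟩ := h.exists_far_bound ha hab
  obtain ⟨m, hm, hmb⟩ := h.exists_mul_abs_sub_le (half_pos ha) (by linarith : a / 2 ≤ 2 * b)
  have p := h.pos _ hb2
  refine ⟨B * D + C * (1 + Ψ (2 * b)) / m, by positivity, fun l hl ζ hζ x hx hn => ?_⟩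
  have pζ := h.pos _ hζ
  rw [add_mul]
  by_cases hmem : ζ ∈ Icc (a / 2) (2 * b)
  · have h1 := hmb ζ hmem l ⟨by linarith [hl.1], by linarith [hl.2]⟩
    have h2 : Ψ ζ ≤ Ψ (2 * b) := h.strictMono.monotoneOn hζ hb2 hmem.2
    have h3 : |x| * (1 + Ψ ζ) ≤ C * (1 + Ψ (2 * b)) / m * |Ψ ζ - Ψ l| := by
      rw [div_mul_eq_mul_div, le_div_iff₀ hm]
      calc |x| * (1 + Ψ ζ) * m ≤ C * |ζ - l| * (1 + Ψ (2 * b)) * m := by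
            gcongr
            exact hn hmem
        _ = C * (1 + Ψ (2 * b)) * (m * |ζ - l|) := by ring
        _ ≤ _ := by gcongr
    have : 0 ≤ B * D * |Ψ ζ - Ψ l| := by positivity
    linarith
  · have h1 := hD l hl ζ hζ hmem
    have h3 : |x| * (1 + Ψ ζ) ≤ B * D * |Ψ ζ - Ψ l| := by
      rw [mul_assoc]
      gcongr
    have : 0 ≤ C * (1 + Ψ (2 * b)) / m * |Ψ ζ - Ψ l| := by positivity
    linarith

lemma norm_mul_kernel_le (h : IsSymbol Ψ Ψ' Ψ'') {D x ζ s : ℝ} (hζ : ζ ∈ Ioi (0:ℝ)) (hD0 : 0 ≤ D)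
    (hD : |x| * (1 + Ψ ζ) ≤ D * |Ψ ζ - s|) {ε y : ℝ} (hε : 0 < ε) (hy : y ^ 2 = s) :
    ‖(x : ℂ) * stieltjesKernel (Ψ ζ) (ε + y * Complex.I)‖
      ≤ ‖(ε : ℂ) + y * Complex.I‖ * D * (1 / (1 + Ψ ζ)) := by
  have hp := h.pos ζ hζ
  have hu : 0 < ((ε : ℂ) + y * Complex.I).re := by simpa using hε
  rw [norm_mul, stieltjesKernel, norm_div, Complex.norm_real, Real.norm_eq_abs,
    ← mul_div_assoc, mul_one_div, div_le_div_iff₀ (norm_add_sq_pos hp.le hu) (by positivity)]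
  have h1 := abs_sub_sq_le_norm hp.le ε y
  rw [hy] at h1
  calc |x| * ‖(ε : ℂ) + y * Complex.I‖ * (1 + Ψ ζ)
      = ‖(ε : ℂ) + y * Complex.I‖ * (|x| * (1 + Ψ ζ)) := by ring
    _ ≤ ‖(ε : ℂ) + y * Complex.I‖ * (D * ‖(Ψ ζ : ℂ) + (ε + y * Complex.I) ^ 2‖) :=
      mul_le_mul_of_nonneg_left (hD.trans (mul_le_mul_of_nonneg_left h1 hD0)) (norm_nonneg _)
    _ = _ := by ring

lemma norm_symbolTransform_le (h : IsSymbol Ψ Ψ' Ψ'') {M : ℝ → ℝ} {D s : ℝ} (hD0 : 0 ≤ D)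
    (hD : ∀ ζ ∈ Ioi (0:ℝ), |M ζ| * (1 + Ψ ζ) ≤ D * |Ψ ζ - s|) {ε y : ℝ} (hε : 0 < ε)
    (hy : y ^ 2 = s) :
    ‖symbolTransform Ψ M (ε + y * Complex.I)‖
      ≤ ‖(ε : ℂ) + y * Complex.I‖ * D * ∫ ζ in Ioi (0:ℝ), 1 / (1 + Ψ ζ) := by
  rw [← integral_const_mul]
  refine norm_integral_le_of_norm_le (h.int.const_mul _) ?_
  exact (ae_restrict_iff' measurableSet_Ioi).2 (Eventually.of_forall fun ζ hζ =>
    h.norm_mul_kernel_le hζ hD0 (hD ζ hζ) hε hy)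

lemma integrableOn_quot (h : IsSymbol Ψ Ψ' Ψ'') {M : ℝ → ℝ} {S : Set ℝ} (hS : S ⊆ Ioi 0)
    (hSm : MeasurableSet S)
    (hM : AEStronglyMeasurable M (volume.restrict (Ioi 0)))
    {D s : ℝ} (hD : ∀ ζ ∈ S, |M ζ| * (1 + Ψ ζ) ≤ D * |Ψ ζ - s|) (hD0 : 0 ≤ D) :
    IntegrableOn (fun ζ => M ζ / (Ψ ζ - s)) S := by
  refine ((h.int.mono_set hS).const_mul D).mono' ?_ ?_
  · exact ((hM.aemeasurable.div
      (h.aestronglyMeasurable.aemeasurable.sub_const s)).aestronglyMeasurable).mono_measure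
      (Measure.restrict_mono hS le_rfl)
  · refine (ae_restrict_iff' hSm).2 (Eventually.of_forall fun ζ hζ => ?_)
    have hp := h.pos ζ (hS hζ)
    rw [norm_div, Real.norm_eq_abs, Real.norm_eq_abs, mul_one_div]
    rcases (abs_nonneg (Ψ ζ - s)).eq_or_lt with h0 | h0
    · rw [← h0, div_zero]
      positivity
    · rw [div_le_div_iff₀ h0 (by positivity)]
      exact hD ζ hζ

/-- Boundary value of the transform when the weight cancels the singularity. -/
lemma tendsto_symbolTransform (h : IsSymbol Ψ Ψ' Ψ'') {M : ℝ → ℝ}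
    (hM : AEStronglyMeasurable M (volume.restrict (Ioi 0)))
    {D s : ℝ} (hD0 : 0 ≤ D) (hD : ∀ ζ ∈ Ioi (0:ℝ), |M ζ| * (1 + Ψ ζ) ≤ D * |Ψ ζ - s|) {y : ℝ}
    (hy : y ^ 2 = s) :
    Tendsto (fun ε : ℝ => symbolTransform Ψ M (ε + y * Complex.I)) (𝓝[>] 0)
      (𝓝 (((∫ ζ in Ioi (0:ℝ), M ζ / (Ψ ζ - s) : ℝ) : ℂ) * (y * Complex.I))) := by
  have e : ((∫ ζ in Ioi (0:ℝ), M ζ / (Ψ ζ - s) : ℝ) : ℂ) * (y * Complex.I)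
      = ∫ ζ in Ioi (0:ℝ), ((M ζ / (Ψ ζ - s) : ℝ) : ℂ) * (y * Complex.I) := by
    rw [integral_mul_const, integral_complex_ofReal]
  rw [e]
  refine tendsto_integral_filter_of_dominated_convergence
    (fun ζ => (1 + |y|) * D * (1 / (1 + Ψ ζ)))
    (Eventually.of_forall fun ε => h.mul_kernel_aestronglyMeasurable hM _) ?_
    (h.int.const_mul _) ?_
  · filter_upwards [Ioo_mem_nhdsGT (zero_lt_one' ℝ)] with ε hε
    refine (ae_restrict_iff' measurableSet_Ioi).2 (Eventually.of_forall fun ζ hζ => ?_)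
    refine (h.norm_mul_kernel_le hζ hD0 (hD ζ hζ) hε.1 hy).trans ?_
    have hp := h.pos ζ hζ
    gcongr
    refine (norm_add_le _ _).trans ?_
    rw [Complex.norm_real, norm_mul, Complex.norm_I, mul_one, Complex.norm_real,
      Real.norm_of_nonneg hε.1.le, Real.norm_eq_abs]
    gcongr
    exact hε.2.le
  · refine (ae_restrict_iff' measurableSet_Ioi).2 (Eventually.of_forall fun ζ hζ => ?_)
    have hp := h.pos ζ hζ
    by_cases h0 : Ψ ζ - s = 0
    · have hM0 : M ζ = 0 := by
        have := hD ζ hζ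
        rw [h0, abs_zero, mul_zero] at this
        have h1 : |M ζ| ≤ 0 := by
          by_contra! hcon
          have : 0 < |M ζ| * (1 + Ψ ζ) := by positivity
          linarith
        exact abs_nonpos_iff.1 h1
      simp [hM0]
    · have hc : ContinuousAt (fun ε : ℝ =>
          (M ζ : ℂ) * stieltjesKernel (Ψ ζ) (ε + y * Complex.I)) 0 := by
        unfold stieltjesKernel
        refine continuousAt_const.mul (ContinuousAt.div (by fun_prop) (by fun_prop) ?_)
        intro hcon
        have h1 := abs_sub_sq_le_norm hp.le 0 y
        rw [hcon, norm_zero, hy] at h1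
        exact h0 (abs_nonpos_iff.1 h1)
      have := hc.tendsto.mono_left (nhdsWithin_le_nhds (s := Ioi 0))
      convert this using 2
      have hs : (Ψ ζ : ℂ) + (y * Complex.I) ^ 2 = ((Ψ ζ - s : ℝ) : ℂ) := by
        push_cast
        rw [← hy]
        push_cast
        linear_combination (y : ℂ) ^ 2 * Complex.I_sq
      rw [stieltjesKernel, Complex.ofReal_zero, zero_add, hs]
      push_cast
      ring

/-- A weight equal to `1` at `l`, whose transform is an explicit logarithm. -/
noncomputable def logWeight (Ψ' : ℝ → ℝ) (l ζ : ℝ) : ℝ :=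
  (Icc (l / 2) (2 * l)).indicator Ψ' ζ / Ψ' l

lemma exists_abs_logWeight_le (h : IsSymbol Ψ Ψ' Ψ'') {l : ℝ} (hl : 0 < l) :
    ∃ B ≥ 0, ∀ ζ, |logWeight Ψ' l ζ| ≤ B := by
  have hsub : Icc (l / 2) (2 * l) ⊆ Ioi (0:ℝ) := Icc_subset_Ioi_zero (by positivity)
  obtain ⟨C, hC⟩ := isCompact_Icc.exists_bound_of_continuousOn (h.continuousOn_deriv.mono hsub)
  have hp := h.deriv_pos l hl
  have hC0 : 0 ≤ C := (norm_nonneg _).trans (hC l ⟨by linarith, by linarith⟩)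
  refine ⟨C / Ψ' l, by positivity, fun ζ => ?_⟩
  rw [logWeight, abs_div, abs_of_pos hp]
  gcongr
  by_cases hζ : ζ ∈ Icc (l / 2) (2 * l)
  · rw [indicator_of_mem hζ]
    exact hC ζ hζ
  · rw [indicator_of_notMem hζ, abs_zero]
    exact hC0

lemma isBddWeight_logWeight (h : IsSymbol Ψ Ψ' Ψ'') {l : ℝ} (hl : 0 < l) :
    IsBddWeight (logWeight Ψ' l) := by
  obtain ⟨B, -, hB⟩ := h.exists_abs_logWeight_le hl
  refine ⟨?_, B, fun ζ _ => hB ζ⟩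
  have : AEStronglyMeasurable Ψ' (volume.restrict (Ioi 0)) :=
    h.continuousOn_deriv.aestronglyMeasurable measurableSet_Ioi
  exact ((this.indicator measurableSet_Icc).aemeasurable.div_const _).aestronglyMeasurable

lemma exists_one_sub_logWeight_bound (h : IsSymbol Ψ Ψ' Ψ'') {l : ℝ} (hl : 0 < l) :
    ∃ D ≥ 0, ∀ ζ ∈ Ioi (0:ℝ), |1 - logWeight Ψ' l ζ| * (1 + Ψ ζ) ≤ D * |Ψ ζ - Ψ l| := by
  have hsub : Icc (l / 2) (2 * l) ⊆ Ioi (0:ℝ) := Icc_subset_Ioi_zero (by positivity)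
  obtain ⟨C, hC⟩ := isCompact_Icc.exists_bound_of_continuousOn (h.cont2.mono hsub)
  have hp := h.deriv_pos l hl
  have hlm : l ∈ Icc (l / 2) (2 * l) := ⟨by linarith, by linarith⟩
  have hC0 : 0 ≤ C := (norm_nonneg _).trans (hC l hlm)
  obtain ⟨B, hB0, hB⟩ := h.exists_abs_logWeight_le hl
  obtain ⟨D, hD0, hD⟩ := h.exists_quot_bound hl le_rfl (by positivity : 0 ≤ 1 + B)
    (by positivity : 0 ≤ C / Ψ' l)
  refine ⟨D, hD0, fun ζ hζ => hD l ⟨le_rfl, le_rfl⟩ ζ hζ _ ?_ fun hmem => ?_⟩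
  · exact (abs_sub _ _).trans (by rw [abs_one]; gcongr; exact hB ζ)
  · have e : 1 - logWeight Ψ' l ζ = -((Ψ' ζ - Ψ' l) / Ψ' l) := by
      rw [logWeight, indicator_of_mem hmem]
      field_simp
      ring
    rw [e, abs_neg, abs_div, abs_of_pos hp, div_mul_eq_mul_div]
    gcongr
    have := (convex_Icc (l / 2) (2 * l)).norm_image_sub_le_of_norm_hasDerivWithin_le
      (fun x hx => (h.deriv2 x (hsub hx)).hasDerivWithinAt) hC hlm hmem
    simpa only [Real.norm_eq_abs] using this

lemma symbolTransform_logWeight (h : IsSymbol Ψ Ψ' Ψ'') {l : ℝ} (hl : 0 < l) {u : ℂ}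
    (hu : 0 < u.re) (hi : 0 < u.im) :
    symbolTransform Ψ (logWeight Ψ' l) u
      = u / Ψ' l * (Complex.log (Ψ (2 * l) + u ^ 2) - Complex.log (Ψ (l / 2) + u ^ 2)) := by
  have hsub : Icc (l / 2) (2 * l) ⊆ Ioi (0:ℝ) := Icc_subset_Ioi_zero (by positivity)
  have hle : l / 2 ≤ 2 * l := by linarith
  have hcont : ContinuousOn (fun ζ => (Ψ' ζ : ℂ) / (Ψ ζ + u ^ 2)) (Icc (l / 2) (2 * l)) := by
    refine ContinuousOn.div
      (Complex.continuous_ofReal.comp_continuousOn (h.continuousOn_deriv.mono hsub))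
      ((Complex.continuous_ofReal.comp_continuousOn (h.continuousOn.mono hsub)).add
        continuousOn_const) fun ζ hζ => add_sq_ne_zero (h.pos ζ (hsub hζ)).le hu
  have e : ∀ ζ, (logWeight Ψ' l ζ : ℂ) * stieltjesKernel (Ψ ζ) u
      = u / Ψ' l * (Icc (l / 2) (2 * l)).indicator
          (fun ζ => (Ψ' ζ : ℂ) / (Ψ ζ + u ^ 2)) ζ := by
    intro ζ
    rw [logWeight, stieltjesKernel]
    by_cases hζ : ζ ∈ Icc (l / 2) (2 * l)
    · rw [indicator_of_mem hζ, indicator_of_mem hζ]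
      push_cast
      ring
    · rw [indicator_of_notMem hζ, indicator_of_notMem hζ]
      simp
  simp only [symbolTransform, e]
  rw [integral_const_mul, setIntegral_indicator measurableSet_Icc, inter_eq_right.2 hsub,
    integral_Icc_eq_integral_Ioc, ← intervalIntegral.integral_of_le hle,
    intervalIntegral.integral_eq_sub_of_hasDerivAt
      (f := fun ζ => Complex.log (Ψ ζ + u ^ 2))]
  · intro ζ hζ
    rw [uIcc_of_le hle] at hζ
    refine HasDerivAt.clog_real (((h.deriv ζ (hsub hζ)).ofReal_comp).add_const _) ?_
    refine Complex.mem_slitPlane_iff.2 (Or.inr ?_)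
    have : ((Ψ ζ : ℂ) + u ^ 2).im = 2 * u.re * u.im := by
      simp [pow_two]; ring
    rw [this]
    positivity
  · exact hcont.intervalIntegrable_of_Icc hle

lemma tendsto_symbolTransform_logWeight (h : IsSymbol Ψ Ψ' Ψ'') {l : ℝ} (hl : 0 < l) {y : ℝ}
    (hy0 : 0 < y)
    (hy : y ^ 2 = Ψ l) :
    Tendsto (fun ε : ℝ => symbolTransform Ψ (logWeight Ψ' l) (ε + y * Complex.I)) (𝓝[>] 0)
      (𝓝 (y * Complex.I / Ψ' l * (Real.log (Ψ (2 * l) - Ψ l)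
        - (Real.log (Ψ (l / 2) - Ψ l) + Real.pi * Complex.I)))) := by
  have hl2 : 0 < l / 2 := by positivity
  have d1 : 0 < Ψ l - Ψ (l / 2) := sub_pos.2 (h.strictMono hl2 hl (by linarith))
  have d2 : 0 < Ψ (2 * l) - Ψ l :=
    sub_pos.2 (h.strictMono hl (by positivity : 0 < 2 * l) (by linarith))
  have hsq : ∀ s : ℝ, ((s : ℂ) + (((0:ℝ):ℂ) + y * Complex.I) ^ 2) = ((s - Ψ l : ℝ) : ℂ) := by
    intro s
    rw [← hy]
    push_cast
    linear_combination (y : ℂ) ^ 2 * Complex.I_sq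
  have hc : ∀ s : ℝ, Tendsto (fun ε : ℝ => (s : ℂ) + (ε + y * Complex.I) ^ 2) (𝓝[>] 0)
      (𝓝 ((s - Ψ l : ℝ) : ℂ)) := by
    intro s
    rw [← hsq s]
    have : ContinuousAt (fun ε : ℝ => (s : ℂ) + (ε + y * Complex.I) ^ 2) 0 := by fun_prop
    exact this.tendsto.mono_left nhdsWithin_le_nhds
  have hu : Tendsto (fun ε : ℝ => (ε : ℂ) + y * Complex.I) (𝓝[>] 0) (𝓝 (y * Complex.I)) := by
    have : ContinuousAt (fun ε : ℝ => (ε : ℂ) + y * Complex.I) 0 := by fun_prop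
    simpa using this.tendsto.mono_left (nhdsWithin_le_nhds (s := Ioi 0))
  have l2 : Tendsto (fun ε : ℝ => Complex.log ((Ψ (2 * l) : ℂ) + (ε + y * Complex.I) ^ 2))
      (𝓝[>] 0) (𝓝 (Real.log (Ψ (2 * l) - Ψ l) : ℂ)) := by
    rw [Complex.ofReal_log d2.le]
    exact (hc _).clog (Complex.ofReal_mem_slitPlane.2 d2)
  have l1 : Tendsto (fun ε : ℝ => Complex.log ((Ψ (l / 2) : ℂ) + (ε + y * Complex.I) ^ 2))
      (𝓝[>] 0) (𝓝 (Real.log (Ψ (l / 2) - Ψ l) + Real.pi * Complex.I)) := by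
    have h1 := Complex.tendsto_log_nhdsWithin_im_nonneg_of_re_neg_of_im_zero
      (z := ((Ψ (l / 2) - Ψ l : ℝ) : ℂ)) (by rw [Complex.ofReal_re]; linarith)
      (Complex.ofReal_im _)
    rw [Complex.norm_real, Real.norm_eq_abs, Real.log_abs] at h1
    refine h1.comp (tendsto_nhdsWithin_iff.2 ⟨hc _, ?_⟩)
    filter_upwards [self_mem_nhdsWithin] with ε hε
    have hε : 0 < ε := hε
    have : ((Ψ (l / 2) : ℂ) + (ε + y * Complex.I) ^ 2).im = 2 * ε * y := by
      simp [pow_two]; ring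
    rw [this]
    positivity
  refine ((hu.div_const _).mul (l2.sub l1)).congr' ?_
  filter_upwards [self_mem_nhdsWithin] with ε hε
  rw [h.symbolTransform_logWeight hl (by simpa using hε) (by simpa using hy0)]

lemma exists_offdiag_bound (h : IsSymbol Ψ Ψ' Ψ'') {l ε B : ℝ} (hl : 0 < l) (hε : 0 < ε)
    (hB : 0 ≤ B) :
    ∃ D ≥ 0, ∀ ζ ∈ Ioi (0:ℝ) \ Icc (l - ε) (l + ε), ∀ x : ℝ, |x| ≤ B →
      |x| * (1 + Ψ ζ) ≤ D * |Ψ ζ - Ψ l| := by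
  obtain ⟨D, hD0, hD⟩ := h.exists_quot_bound hl le_rfl hB (by positivity : 0 ≤ B / ε)
  refine ⟨D, hD0, fun ζ hζ x hx => hD l ⟨le_rfl, le_rfl⟩ ζ hζ.1 x hx fun _ => ?_⟩
  have : ε ≤ |ζ - l| := by
    by_contra! hcon
    rw [abs_lt] at hcon
    exact hζ.2 ⟨by linarith, by linarith⟩
  rw [div_mul_eq_mul_div, le_div_iff₀ hε]
  gcongr

lemma integrableOn_offdiag (h : IsSymbol Ψ Ψ' Ψ'') {M : ℝ → ℝ} (hM : IsBddWeight M) {l ε : ℝ}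
    (hl : 0 < l)
    (hε : 0 < ε) :
    IntegrableOn (fun ζ => M ζ / (Ψ ζ - Ψ l)) (Ioi (0:ℝ) \ Icc (l - ε) (l + ε)) := by
  obtain ⟨B, hB⟩ := hM.bdd
  obtain ⟨D, hD0, hD⟩ := h.exists_offdiag_bound hl hε ((abs_nonneg _).trans (hB l hl))
  exact h.integrableOn_quot sdiff_subset (measurableSet_Ioi.diff measurableSet_Icc) hM.meas
    (fun ζ hζ => hD ζ hζ _ (hB ζ hζ.1)) hD0

lemma integral_deriv_div (h : IsSymbol Ψ Ψ' Ψ'') {p q s : ℝ} (hp : 0 < p) (hpq : p ≤ q)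
    (hs : ∀ ζ ∈ Icc p q, Ψ ζ - s ≠ 0) :
    ∫ ζ in p..q, Ψ' ζ / (Ψ ζ - s) = Real.log (Ψ q - s) - Real.log (Ψ p - s) := by
  have hsub : Icc p q ⊆ Ioi (0:ℝ) := Icc_subset_Ioi_zero hp
  rw [intervalIntegral.integral_eq_sub_of_hasDerivAt (f := fun ζ => Real.log (Ψ ζ - s))]
  · intro ζ hζ
    rw [uIcc_of_le hpq] at hζ
    exact ((h.deriv ζ (hsub hζ)).sub_const s).log (hs ζ hζ)
  · refine ContinuousOn.intervalIntegrable_of_Icc hpq ?_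
    exact (h.continuousOn_deriv.mono hsub).div
      ((h.continuousOn.mono hsub).sub continuousOn_const) hs

lemma tendsto_log_sub_log (h : IsSymbol Ψ Ψ' Ψ'') {l : ℝ} (hl : 0 < l) :
    Tendsto (fun ε : ℝ => Real.log (Ψ (l - ε) - Ψ l) - Real.log (Ψ (l + ε) - Ψ l)) (𝓝[>] 0)
      (𝓝 0) := by
  have hp := h.deriv_pos l hl
  have h1 : Tendsto (fun ε : ℝ => ε⁻¹ * (Ψ (l + ε) - Ψ l)) (𝓝[>] 0) (𝓝 (Ψ' l)) := by
    have := (hasDerivAt_iff_tendsto_slope_zero.1 (h.deriv l hl)).mono_left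
      (nhdsWithin_mono 0 (s := Ioi (0:ℝ)) fun x hx => (mem_Ioi.1 hx).ne')
    simpa only [smul_eq_mul] using this
  have h2 : Tendsto (fun ε : ℝ => ε⁻¹ * (Ψ (l - ε) - Ψ l)) (𝓝[>] 0) (𝓝 (-Ψ' l)) := by
    have hd : HasDerivAt (fun ε => Ψ (l - ε)) (-Ψ' l) 0 := by
      have := h.deriv l hl
      rw [← sub_zero l] at this
      simpa using this.comp_const_sub l 0
    have := (hasDerivAt_iff_tendsto_slope_zero.1 hd).mono_left
      (nhdsWithin_mono 0 (s := Ioi (0:ℝ)) fun x hx => (mem_Ioi.1 hx).ne')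
    simpa only [smul_eq_mul, zero_add, sub_zero] using this
  have h3 := (h2.div h1 hp.ne').log (by rw [neg_div, div_self hp.ne']; norm_num)
  rw [neg_div, div_self hp.ne', Real.log_neg_eq_log, Real.log_one] at h3
  refine h3.congr' ?_
  filter_upwards [Ioo_mem_nhdsGT hl] with ε hε
  have hε0 := hε.1
  have m1 : Ψ l < Ψ (l + ε) := h.strictMono hl (by linarith : 0 < l + ε) (by linarith)
  have m2 : Ψ (l - ε) < Ψ l := h.strictMono (by linarith [hε.2] : 0 < l - ε) hl (by linarith)
  rw [Pi.div_apply, mul_div_mul_left _ _ (inv_ne_zero hε0.ne'),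
    Real.log_div (by linarith) (by linarith)]

lemma integral_logWeight_offdiag (h : IsSymbol Ψ Ψ' Ψ'') {l ε : ℝ} (hl : 0 < l) (hε : 0 < ε)
    (hε2 : ε < l / 2) :
    ∫ ζ in Ioi (0:ℝ) \ Icc (l - ε) (l + ε), Ψ' l * (logWeight Ψ' l ζ / (Ψ ζ - Ψ l))
      = (Real.log (Ψ (2 * l) - Ψ l) - Real.log (Ψ (l / 2) - Ψ l))
        + (Real.log (Ψ (l - ε) - Ψ l) - Real.log (Ψ (l + ε) - Ψ l)) := by
  have hp := h.deriv_pos l hl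
  have e : ∀ ζ, Ψ' l * (logWeight Ψ' l ζ / (Ψ ζ - Ψ l))
      = (Icc (l / 2) (2 * l)).indicator (fun ζ => Ψ' ζ / (Ψ ζ - Ψ l)) ζ := by
    intro ζ
    rw [logWeight]
    by_cases hζ : ζ ∈ Icc (l / 2) (2 * l)
    · rw [indicator_of_mem hζ, indicator_of_mem hζ]
      field_simp
    · rw [indicator_of_notMem hζ, indicator_of_notMem hζ]
      simp
  have hset : (Ioi (0:ℝ) \ Icc (l - ε) (l + ε)) ∩ Icc (l / 2) (2 * l)
      = Ico (l / 2) (l - ε) ∪ Ioc (l + ε) (2 * l) := by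
    ext ζ
    simp only [mem_inter_iff, Set.mem_sdiff, mem_Ioi, mem_Icc, mem_union, mem_Ico, mem_Ioc,
      not_and_or,
      not_le]
    constructor
    · rintro ⟨⟨h0, h1 | h1⟩, h2, h3⟩
      · exact Or.inl ⟨h2, h1⟩
      · exact Or.inr ⟨h1, h3⟩
    · rintro (⟨h1, h2⟩ | ⟨h1, h2⟩)
      · exact ⟨⟨by linarith, Or.inl h2⟩, h1, by linarith⟩
      · exact ⟨⟨by linarith, Or.inr h1⟩, by linarith, h2⟩
  have n1 : ∀ ζ ∈ Icc (l / 2) (l - ε), Ψ ζ - Ψ l ≠ 0 := fun ζ hζ =>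
    (sub_neg.2 (h.strictMono (by linarith [hζ.1] : 0 < ζ) hl (by linarith [hζ.2]))).ne
  have n2 : ∀ ζ ∈ Icc (l + ε) (2 * l), Ψ ζ - Ψ l ≠ 0 := fun ζ hζ =>
    (sub_pos.2 (h.strictMono hl (by linarith [hζ.1] : 0 < ζ) (by linarith [hζ.1]))).ne'
  have hcont : ∀ p q : ℝ, 0 < p → (∀ ζ ∈ Icc p q, Ψ ζ - Ψ l ≠ 0) →
      IntegrableOn (fun ζ => Ψ' ζ / (Ψ ζ - Ψ l)) (Icc p q) := by
    intro p q hp0 hn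
    have hsub : Icc p q ⊆ Ioi (0:ℝ) := Icc_subset_Ioi_zero hp0
    exact ContinuousOn.integrableOn_Icc ((h.continuousOn_deriv.mono hsub).div
      ((h.continuousOn.mono hsub).sub continuousOn_const) hn)
  simp only [e]
  rw [setIntegral_indicator measurableSet_Icc, hset, setIntegral_union _ measurableSet_Ioc
      ((hcont _ _ (by positivity) n1).mono_set Ico_subset_Icc_self)
      ((hcont _ _ (by positivity) n2).mono_set Ioc_subset_Icc_self),
    integral_Ico_eq_integral_Ioc, ← intervalIntegral.integral_of_le (by linarith),
    ← intervalIntegral.integral_of_le (by linarith),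
    h.integral_deriv_div (by positivity) (by linarith) n1,
    h.integral_deriv_div (by positivity) (by linarith) n2]
  · ring
  · refine disjoint_left.2 fun ζ h1 h2 => ?_
    linarith [h1.2, h2.1]

lemma integrableOn_one_sub_logWeight (h : IsSymbol Ψ Ψ' Ψ'') {l : ℝ} (hl : 0 < l) :
    IntegrableOn (fun ζ => (1 - logWeight Ψ' l ζ) / (Ψ ζ - Ψ l)) (Ioi 0) := by
  obtain ⟨D, hD0, hD⟩ := h.exists_one_sub_logWeight_bound hl
  exact h.integrableOn_quot subset_rfl measurableSet_Ioi
    ((IsBddWeight.const 1).sub (h.isBddWeight_logWeight hl)).meas hD hD0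

/-- The principal value of `Ψ'(l) / (Ψ(l) - Ψ)`. -/
lemma tendsto_principalValue (h : IsSymbol Ψ Ψ' Ψ'') {l : ℝ} (hl : 0 < l) :
    Tendsto (fun ε : ℝ => ∫ ζ in Ioi (0:ℝ) \ Icc (l - ε) (l + ε), Ψ' l / (Ψ l - Ψ ζ))
      (𝓝[>] 0) (𝓝 (-(Ψ' l * ∫ ζ in Ioi (0:ℝ), (1 - logWeight Ψ' l ζ) / (Ψ ζ - Ψ l))
        - (Real.log (Ψ (2 * l) - Ψ l) - Real.log (Ψ (l / 2) - Ψ l)))) := by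
  have hi := h.integrableOn_one_sub_logWeight hl
  have h1 := ((tendsto_setIntegral_diff_Icc hi l).const_mul (Ψ' l)).neg
  have h2 := ((h.tendsto_log_sub_log hl).const_add
    (Real.log (Ψ (2 * l) - Ψ l) - Real.log (Ψ (l / 2) - Ψ l)))
  rw [add_zero] at h2
  refine (h1.sub h2).congr' ?_
  filter_upwards [Ioo_mem_nhdsGT (half_pos hl)] with ε hε
  rw [← h.integral_logWeight_offdiag hl hε.1 hε.2, ← integral_const_mul, ← integral_neg,
    ← integral_sub]
  · congr 1
    ext ζ
    rw [← neg_sub (Ψ ζ) (Ψ l), div_neg]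
    ring
  · exact ((hi.mono_set sdiff_subset).const_mul _).neg
  · exact (h.integrableOn_offdiag (h.isBddWeight_logWeight hl) hl hε.1).const_mul _

/-- Boundary value of the transform with weight `1`. -/
lemma tendsto_symbolTransform_one (h : IsSymbol Ψ Ψ' Ψ'') {l k : ℝ} (hl : 0 < l)
    (hk : Tendsto (fun ε : ℝ => -(Real.pi)⁻¹ *
      ∫ ζ in Ioi (0:ℝ) \ Icc (l - ε) (l + ε), Ψ' l / (Ψ l - Ψ ζ)) (𝓝[>] 0) (𝓝 k))
    {y : ℝ} (hy0 : 0 < y) (hy : y ^ 2 = Ψ l) :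
    Tendsto (fun ε : ℝ => symbolTransform Ψ (fun _ => 1) (ε + y * Complex.I)) (𝓝[>] 0)
      (𝓝 (Real.pi * y / Ψ' l * (1 + k * Complex.I))) := by
  have hp := h.deriv_pos l hl
  obtain ⟨D, hD0, hD⟩ := h.exists_one_sub_logWeight_bound hl
  have hw := h.isBddWeight_logWeight hl
  have t1 := h.tendsto_symbolTransform ((IsBddWeight.const 1).sub hw).meas hD0 hD hy
  have t2 := h.tendsto_symbolTransform_logWeight hl hy0 hy
  have hkeq := tendsto_nhds_unique hk ((h.tendsto_principalValue hl).const_mul _)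
  set P := ∫ ζ in Ioi (0:ℝ), (1 - logWeight Ψ' l ζ) / (Ψ ζ - Ψ l)
  set A := Real.log (Ψ (2 * l) - Ψ l)
  set B := Real.log (Ψ (l / 2) - Ψ l)
  have hlim : (Real.pi * y / Ψ' l * (1 + k * Complex.I) : ℂ)
      = P * (y * Complex.I) + y * Complex.I / Ψ' l * (A - (B + Real.pi * Complex.I)) := by
    have hpc : (Ψ' l : ℂ) ≠ 0 := Complex.ofReal_ne_zero.2 hp.ne'
    have hπ : (Real.pi : ℂ) ≠ 0 := Complex.ofReal_ne_zero.2 Real.pi_ne_zero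
    rw [hkeq]
    push_cast
    field_simp
    linear_combination (y : ℂ) * (Real.pi : ℂ) * Complex.I_sq
  rw [hlim]
  refine (t1.add t2).congr' ?_
  filter_upwards [self_mem_nhdsWithin] with ε hε
  have hu : 0 < ((ε : ℂ) + y * Complex.I).re := by simpa using hε
  simp only [symbolTransform]
  rw [← integral_add (h.integrable_mul_kernel ((IsBddWeight.const 1).sub hw) hu)
    (h.integrable_mul_kernel hw hu)]
  congr 1
  ext ζ
  push_cast
  ring

end IsSymbol

/-- A bounded, Lipschitz, square integrable function on the half-line. -/
structure IsLipWeight (L : ℝ → ℝ) : Prop extends IsBddWeight L where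
  lip : ∃ C ≥ 0, ∀ ζ ∈ Ioi (0:ℝ), ∀ l ∈ Ioi (0:ℝ), |L ζ - L l| ≤ C * |ζ - l|
  sq_int : IntegrableOn (fun ζ => L ζ ^ 2) (Ioi 0)

/-- The transform of the divided difference of `L` with respect to `Ψ`. -/
noncomputable def diffTransform (Ψ L : ℝ → ℝ) (l : ℝ) : ℝ :=
  ∫ ζ in Ioi (0:ℝ), (L ζ - L l) / (Ψ ζ - Ψ l)

namespace IsSymbol

variable {Ψ Ψ' Ψ'' : ℝ → ℝ}

lemma exists_lip_bound (h : IsSymbol Ψ Ψ' Ψ'') {L : ℝ → ℝ} (hL : IsLipWeight L) {a b : ℝ}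
    (ha : 0 < a) (hab : a ≤ b) :
    ∃ D ≥ 0, ∀ l ∈ Icc a b, ∀ ζ ∈ Ioi (0:ℝ),
      |L ζ - L l| * (1 + Ψ ζ) ≤ D * |Ψ ζ - Ψ l| ∧
      |(L ζ - L l) ^ 2| * (1 + Ψ ζ) ≤ D * |Ψ ζ - Ψ l| := by
  obtain ⟨B, hB⟩ := hL.bdd
  obtain ⟨C, hC0, hC⟩ := hL.lip
  have hB0 : 0 ≤ B := (abs_nonneg _).trans (hB a ha)
  obtain ⟨D, hD0, hD⟩ := h.exists_quot_bound ha hab (by positivity : 0 ≤ B + B) hC0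
  refine ⟨(1 + (B + B)) * D, by positivity, fun l hl ζ hζ => ?_⟩
  have hl0 : l ∈ Ioi (0:ℝ) := ha.trans_le hl.1
  have hp := h.pos ζ hζ
  have h0 : |L ζ - L l| ≤ B + B := (abs_sub _ _).trans (add_le_add (hB ζ hζ) (hB l hl0))
  have h1 := hD l hl ζ hζ (L ζ - L l) h0 fun _ => hC ζ hζ l hl0
  have h2 : 0 ≤ (B + B) * (D * |Ψ ζ - Ψ l|) := by positivity
  have h3 : 0 ≤ D * |Ψ ζ - Ψ l| := by positivity
  refine ⟨by linarith, ?_⟩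
  rw [pow_two, abs_mul]
  have h4 : |L ζ - L l| * (|L ζ - L l| * (1 + Ψ ζ)) ≤ (B + B) * (D * |Ψ ζ - Ψ l|) := by gcongr
  linarith

lemma _root_.IsLipWeight.sub_const {L : ℝ → ℝ} (hL : IsLipWeight L) (a : ℝ) :
    IsBddWeight fun ζ => L ζ - a :=
  hL.toIsBddWeight.sub (IsBddWeight.const a)

lemma integrableOn_diffTransform (h : IsSymbol Ψ Ψ' Ψ'') {L : ℝ → ℝ} (hL : IsLipWeight L) {l : ℝ}
    (hl : 0 < l) :
    IntegrableOn (fun ζ => (L ζ - L l) / (Ψ ζ - Ψ l)) (Ioi 0) := by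
  obtain ⟨D, hD0, hD⟩ := h.exists_lip_bound hL hl le_rfl
  exact h.integrableOn_quot subset_rfl measurableSet_Ioi (hL.sub_const _).meas
    (fun ζ hζ => (hD l ⟨le_rfl, le_rfl⟩ ζ hζ).1) hD0

lemma diffTransform_add (h : IsSymbol Ψ Ψ' Ψ'') {L N : ℝ → ℝ} (hL : IsLipWeight L)
    (hN : IsLipWeight N) {l : ℝ}
    (hl : 0 < l) : diffTransform Ψ (fun ζ => L ζ + N ζ) l
      = diffTransform Ψ L l + diffTransform Ψ N l := by
  rw [diffTransform, diffTransform, diffTransform,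
    ← integral_add (h.integrableOn_diffTransform hL hl) (h.integrableOn_diffTransform hN hl)]
  congr 1
  ext ζ
  ring

lemma diffTransform_sub (h : IsSymbol Ψ Ψ' Ψ'') {L N : ℝ → ℝ} (hL : IsLipWeight L)
    (hN : IsLipWeight N) {l : ℝ}
    (hl : 0 < l) : diffTransform Ψ (fun ζ => L ζ - N ζ) l
      = diffTransform Ψ L l - diffTransform Ψ N l := by
  rw [diffTransform, diffTransform, diffTransform,
    ← integral_sub (h.integrableOn_diffTransform hL hl) (h.integrableOn_diffTransform hN hl)]
  congr 1
  ext ζ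
  ring

lemma principalValue_sub_eq (h : IsSymbol Ψ Ψ' Ψ'') {L : ℝ → ℝ} (hL : IsLipWeight L) {l k kx : ℝ}
    (hl : 0 < l)
    (hk : Tendsto (fun ε : ℝ => -(Real.pi)⁻¹ *
      ∫ ζ in Ioi (0:ℝ) \ Icc (l - ε) (l + ε), Ψ' l / (Ψ l - Ψ ζ)) (𝓝[>] 0) (𝓝 k))
    (hkx : Tendsto (fun ε : ℝ => -(Real.pi)⁻¹ *
      ∫ ζ in Ioi (0:ℝ) \ Icc (l - ε) (l + ε), L ζ * (Ψ' l / (Ψ l - Ψ ζ))) (𝓝[>] 0) (𝓝 kx)) :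
    k * L l - kx = -(Ψ' l / Real.pi * diffTransform Ψ L l) := by
  have h1 := ((tendsto_setIntegral_diff_Icc (h.integrableOn_diffTransform hL hl) l).const_mul
    (Ψ' l / Real.pi)).neg
  refine tendsto_nhds_unique ((hk.mul_const (L l)).sub hkx) (h1.congr' ?_)
  filter_upwards [self_mem_nhdsWithin] with ε hε
  have i1 := h.integrableOn_offdiag hL.toIsBddWeight hl hε
  have i0 := h.integrableOn_offdiag (IsBddWeight.const 1) hl hε
  have e0 : ∀ ζ, Ψ' l / (Ψ l - Ψ ζ) = -Ψ' l * (1 / (Ψ ζ - Ψ l)) := by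
    intro ζ
    rw [← neg_sub (Ψ ζ) (Ψ l), div_neg]
    ring
  have e1 : ∀ ζ, L ζ * (-Ψ' l * (1 / (Ψ ζ - Ψ l))) = -Ψ' l * (L ζ / (Ψ ζ - Ψ l)) := by
    intro ζ
    ring
  have e2 : ∀ ζ, (L ζ - L l) / (Ψ ζ - Ψ l) = L ζ / (Ψ ζ - Ψ l) - L l * (1 / (Ψ ζ - Ψ l)) := by
    intro ζ
    ring
  simp only [e0, e1, e2]
  rw [integral_const_mul, integral_const_mul, integral_sub i1 (i0.const_mul _),
    integral_const_mul]
  field_simp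
  ring

/-- Boundary value of the real part of the Schur complement. -/
lemma tendsto_re_schurTransform (h : IsSymbol Ψ Ψ' Ψ'') {L : ℝ → ℝ} (hL : IsLipWeight L) {l k : ℝ}
    (hl : 0 < l)
    (hk : Tendsto (fun ε : ℝ => -(Real.pi)⁻¹ *
      ∫ ζ in Ioi (0:ℝ) \ Icc (l - ε) (l + ε), Ψ' l / (Ψ l - Ψ ζ)) (𝓝[>] 0) (𝓝 k))
    {y : ℝ} (hy0 : 0 < y) (hy : y ^ 2 = Ψ l) :
    Tendsto (fun ε : ℝ => (schurTransform Ψ L (ε + y * Complex.I)).re) (𝓝[>] 0)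
      (𝓝 (y * (Real.pi / Ψ' l) *
        ((Ψ' l / Real.pi * diffTransform Ψ L l) ^ 2 / (1 + k ^ 2)))) := by
  have hp := h.deriv_pos l hl
  obtain ⟨D, hD0, hD⟩ := h.exists_lip_bound hL hl le_rfl
  have hw := hL.sub_const (L l)
  have hll : l ∈ Icc l l := ⟨le_rfl, le_rfl⟩
  have t1 := h.tendsto_symbolTransform hw.meas hD0 (fun ζ hζ => (hD l hll ζ hζ).1) hy
  have t2 := h.tendsto_symbolTransform hw.sq.meas hD0 (fun ζ hζ => (hD l hll ζ hζ).2) hy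
  have t0 := h.tendsto_symbolTransform_one hl hk hy0 hy
  have hden : 0 < 1 + k ^ 2 := by positivity
  have hmul : (1 + k * Complex.I) * (1 - k * Complex.I) = ((1 + k ^ 2 : ℝ) : ℂ) := by
    push_cast
    linear_combination -(k : ℂ) ^ 2 * Complex.I_sq
  have hne1 : (1 + k * Complex.I : ℂ) ≠ 0 := by
    intro h0
    rw [h0, zero_mul] at hmul
    exact hden.ne' (Complex.ofReal_eq_zero.1 hmul.symm)
  have hpc : (Ψ' l : ℂ) ≠ 0 := Complex.ofReal_ne_zero.2 hp.ne'
  have hπ : (Real.pi : ℂ) ≠ 0 := Complex.ofReal_ne_zero.2 Real.pi_ne_zero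
  have hyc : (y : ℂ) ≠ 0 := Complex.ofReal_ne_zero.2 hy0.ne'
  have t := t2.sub ((t1.pow 2).div t0 (by
    exact mul_ne_zero (div_ne_zero (mul_ne_zero hπ hyc) hpc) hne1))
  have t' := (Complex.continuous_re.tendsto _).comp t
  set J := diffTransform Ψ L l with hJ
  rw [← diffTransform, ← hJ] at t'
  set Q := ∫ ζ in Ioi (0:ℝ), (L ζ - L l) ^ 2 / (Ψ ζ - Ψ l)
  have elim : (Q : ℂ) * (y * Complex.I)
      - ((J : ℂ) * (y * Complex.I)) ^ 2 / (Real.pi * y / Ψ' l * (1 + k * Complex.I))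
      = ((y * (Real.pi / Ψ' l) * ((Ψ' l / Real.pi * J) ^ 2 / (1 + k ^ 2)) : ℝ) : ℂ)
        + ((Q * y - y * (Real.pi / Ψ' l) * ((Ψ' l / Real.pi * J) ^ 2 / (1 + k ^ 2)) * k : ℝ) : ℂ)
          * Complex.I := by
    have hdc : (1 + (k : ℂ) ^ 2) ≠ 0 := by exact_mod_cast hden.ne'
    have hdiv : ((J : ℂ) * (y * Complex.I)) ^ 2 / (Real.pi * y / Ψ' l * (1 + k * Complex.I))
        = -(J ^ 2 * y * Ψ' l / Real.pi) * ((1 - k * Complex.I) / (1 + k ^ 2)) := by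
      rw [div_eq_iff (mul_ne_zero (div_ne_zero (mul_ne_zero hπ hyc) hpc) hne1)]
      push_cast at hmul
      have e1 : (1 - (k : ℂ) * Complex.I) / (1 + k ^ 2) * (1 + k * Complex.I) = 1 := by
        rw [div_mul_eq_mul_div, mul_comm, hmul, div_self hdc]
      calc ((J : ℂ) * (y * Complex.I)) ^ 2 = -((J : ℂ) ^ 2 * y ^ 2) * 1 := by
            linear_combination (J : ℂ) ^ 2 * y ^ 2 * Complex.I_sq
        _ = -((J : ℂ) ^ 2 * y ^ 2)
            * ((1 - (k : ℂ) * Complex.I) / (1 + k ^ 2) * (1 + k * Complex.I)) := by rw [e1]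
        _ = _ := by
            generalize (1 - (k : ℂ) * Complex.I) / (1 + k ^ 2) = w
            field_simp
    rw [hdiv]
    push_cast
    field_simp
    ring
  rw [elim, Complex.add_re, Complex.ofReal_re, Complex.re_ofReal_mul, Complex.I_re, mul_zero,
    add_zero] at t'
  refine t'.congr' ?_
  filter_upwards [self_mem_nhdsWithin] with ε hε
  have hu : 0 < ((ε : ℂ) + y * Complex.I).re := by simpa using hε
  rw [Function.comp_apply, ← h.schurTransform_sub_const hL.toIsBddWeight (L l) hu]
  rfl

lemma exists_re_symbolTransform_one_ge (h : IsSymbol Ψ Ψ' Ψ'') {a b : ℝ} (ha : 0 < a)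
    (hab : a ≤ b) (Y : ℝ) :
    ∃ c > 0, ∀ ε ∈ Ioo (0:ℝ) 1, ∀ l ∈ Icc a b, ∀ y ∈ Icc 0 Y, y ^ 2 = Ψ l →
      c ≤ (symbolTransform Ψ (fun _ => 1) (ε + y * Complex.I)).re := by
  have hsub : Icc a (b + 1) ⊆ Ioi (0:ℝ) := Icc_subset_Ioi_zero ha
  obtain ⟨M, hM⟩ := isCompact_Icc.exists_bound_of_continuousOn (h.continuousOn_deriv.mono hsub)
  have hM0 : 0 ≤ M := (norm_nonneg _).trans (hM a ⟨le_rfl, by linarith⟩)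
  have pa := h.pos a ha
  by_cases hY : 0 ≤ Y
  swap
  · exact ⟨1, one_pos, fun ε _ l _ y hy => absurd (hy.1.trans hy.2) hY⟩
  refine ⟨Ψ a / (M + 1 + 2 * Y) ^ 2, by positivity, fun ε hε l hl y hy hyl => ?_⟩
  have hε0 := hε.1
  have hu : 0 < ((ε : ℂ) + y * Complex.I).re := by simpa using hε.1
  have hl0 : 0 < l := ha.trans_le hl.1
  have hS : Icc l (l + ε) ⊆ Ioi (0:ℝ) := Icc_subset_Ioi_zero hl0
  have hS' : Icc l (l + ε) ⊆ Icc a (b + 1) :=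
    Icc_subset_Icc hl.1 (by linarith [hl.2, hε.2])
  rw [h.re_symbolTransform (IsBddWeight.const 1) hu]
  simp only [one_mul]
  have hi := h.integrable_re_kernel hu
  have h1 : ∫ ζ in Icc l (l + ε), (stieltjesKernel (Ψ ζ) (ε + y * Complex.I)).re
      ≤ ∫ ζ in Ioi (0:ℝ), (stieltjesKernel (Ψ ζ) (ε + y * Complex.I)).re := by
    refine setIntegral_mono_set hi ?_ hS.eventuallyLE
    exact (ae_restrict_iff' measurableSet_Ioi).2
      (Eventually.of_forall fun ζ hζ => (h.re_kernel_pos hζ hu).le)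
  refine le_trans ?_ h1
  have h2 : ∀ ζ ∈ Icc l (l + ε), Ψ a / (M + 1 + 2 * Y) ^ 2 / ε
      ≤ (stieltjesKernel (Ψ ζ) (ε + y * Complex.I)).re := by
    intro ζ hζ
    have hm : |Ψ ζ - Ψ l| ≤ M * |ζ - l| := by
      have := (convex_Icc a (b + 1)).norm_image_sub_le_of_norm_hasDerivWithin_le
        (fun x hx => (h.deriv x (hsub hx)).hasDerivWithinAt) hM
        (hS' ⟨le_rfl, by linarith⟩) (hS' hζ)
      simpa only [Real.norm_eq_abs] using this
    have hzl : |ζ - l| ≤ ε := by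
      rw [abs_of_nonneg (by linarith [hζ.1])]
      linarith [hζ.2]
    have hn : ‖(Ψ ζ : ℂ) + (ε + y * Complex.I) ^ 2‖ ≤ ε * (M + 1 + 2 * Y) := by
      have e : (Ψ ζ : ℂ) + (ε + y * Complex.I) ^ 2
          = ((Ψ ζ - Ψ l : ℝ) : ℂ) + ((ε ^ 2 : ℝ) : ℂ) + ((2 * ε * y : ℝ) : ℂ) * Complex.I := by
        rw [← hyl]
        push_cast
        linear_combination (y : ℂ) ^ 2 * Complex.I_sq
      rw [e]
      refine (norm_add₃_le).trans ?_
      rw [norm_mul, Complex.norm_I, mul_one, Complex.norm_real, Complex.norm_real,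
        Complex.norm_real, Real.norm_eq_abs, Real.norm_of_nonneg (by positivity),
        Real.norm_of_nonneg (by have := hy.1; positivity)]
      have e1 : M * |ζ - l| ≤ M * ε := by gcongr
      have e2 : ε * y ≤ ε * Y := by gcongr; exact hy.2
      nlinarith [hε.2]
    have hpz := h.pos ζ (hS hζ)
    have hnp := norm_add_sq_pos hpz.le hu
    have hpl : Ψ a ≤ Ψ ζ :=
      h.strictMono.monotoneOn ha (hS hζ) (hl.1.trans hζ.1)
    rw [re_stieltjesKernel, div_div, div_le_div_iff₀ (by positivity) (by positivity)]
    have hre : ((ε : ℂ) + y * Complex.I).re = ε := by simp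
    rw [hre]
    have h5 : Ψ a ≤ Ψ ζ + ‖(ε : ℂ) + y * Complex.I‖ ^ 2 := by
      have := sq_nonneg ‖(ε : ℂ) + y * Complex.I‖
      linarith
    calc Ψ a * ‖(Ψ ζ : ℂ) + (ε + y * Complex.I) ^ 2‖ ^ 2
        ≤ (Ψ ζ + ‖(ε : ℂ) + y * Complex.I‖ ^ 2) * (ε * (M + 1 + 2 * Y)) ^ 2 := by gcongr
      _ = _ := by ring
  have h3 := setIntegral_ge_of_const_le_real measurableSet_Icc (by simp) h2 (hi.mono_set hS)
  refine le_trans (le_of_eq ?_) h3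
  rw [Real.volume_real_Icc_of_le (by linarith)]
  field_simp
  ring

lemma exists_re_schurTransform_le (h : IsSymbol Ψ Ψ' Ψ'') {L : ℝ → ℝ} (hL : IsLipWeight L)
    {a b : ℝ} (ha : 0 < a)
    (hab : a ≤ b) (Y : ℝ) :
    ∃ B : ℝ, ∀ ε ∈ Ioo (0:ℝ) 1, ∀ l ∈ Icc a b, ∀ y ∈ Icc 0 Y, y ^ 2 = Ψ l →
      (schurTransform Ψ L (ε + y * Complex.I)).re ≤ B := by
  obtain ⟨c, hc0, hc⟩ := h.exists_re_symbolTransform_one_ge ha hab Y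
  obtain ⟨D, hD0, hD⟩ := h.exists_lip_bound hL ha hab
  set R := (1 + Y) * D * ∫ ζ in Ioi (0:ℝ), 1 / (1 + Ψ ζ) with hR
  refine ⟨R + R ^ 2 / c, fun ε hε l hl y hy hyl => ?_⟩
  have hε0 := hε.1
  have hu : 0 < ((ε : ℂ) + y * Complex.I).re := by simpa using hε.1
  have hI : 0 ≤ ∫ ζ in Ioi (0:ℝ), 1 / (1 + Ψ ζ) :=
    setIntegral_nonneg measurableSet_Ioi fun ζ hζ => by
      have := h.pos ζ hζ
      positivity
  have hun : ‖(ε : ℂ) + y * Complex.I‖ ≤ 1 + Y := by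
    refine (norm_add_le _ _).trans ?_
    rw [Complex.norm_real, norm_mul, Complex.norm_I, mul_one, Complex.norm_real,
      Real.norm_of_nonneg hε0.le, Real.norm_of_nonneg hy.1]
    exact add_le_add hε.2.le hy.2
  have hle : ‖(ε : ℂ) + y * Complex.I‖ * D * ∫ ζ in Ioi (0:ℝ), 1 / (1 + Ψ ζ) ≤ R := by
    rw [hR]
    gcongr
  have n1 := (h.norm_symbolTransform_le hD0 (fun ζ hζ => (hD l hl ζ hζ).1) hε0 hyl).trans hle
  have n2 := (h.norm_symbolTransform_le hD0 (fun ζ hζ => (hD l hl ζ hζ).2) hε0 hyl).trans hle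
  have n0 := (hc ε hε l hl y hy hyl).trans (Complex.re_le_norm _)
  rw [← h.schurTransform_sub_const hL.toIsBddWeight (L l) hu]
  refine (Complex.re_le_norm _).trans ?_
  rw [schurTransform]
  refine (norm_sub_le _ _).trans (add_le_add n2 ?_)
  rw [norm_div, norm_pow]
  gcongr

lemma exists_eq (h : IsSymbol Ψ Ψ' Ψ'') {s : ℝ} (hs : 0 < s) : ∃ l ∈ Ioi (0:ℝ), Ψ l = s := by
  obtain ⟨p, hp, hp0⟩ := ((h.tendsto_zero.eventually (gt_mem_nhds hs)).and
    self_mem_nhdsWithin).exists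
  have hp0 : 0 < p := hp0
  obtain ⟨q, hq, hpq⟩ := ((h.tendsto_top.eventually_gt_atTop s).and
    (eventually_ge_atTop p)).exists
  have hsub : Icc p q ⊆ Ioi (0:ℝ) := Icc_subset_Ioi_zero hp0
  obtain ⟨l, hl, e⟩ := intermediate_value_Icc hpq (h.continuousOn.mono hsub) ⟨hp.le, hq.le⟩
  exact ⟨l, hsub hl, e⟩

lemma integrableOn_mul_inv_add (h : IsSymbol Ψ Ψ' Ψ'') {M : ℝ → ℝ} (hM : IsBddWeight M) {c : ℝ}
    (hc : 0 < c) :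
    IntegrableOn (fun ζ => M ζ * (Ψ ζ + c)⁻¹) (Ioi 0) := by
  obtain ⟨B, hB⟩ := hM.bdd
  refine (h.integrable_inv_add hc).bdd_mul (c := B) hM.meas ?_
  exact (ae_restrict_iff' measurableSet_Ioi).2 (Eventually.of_forall fun ζ hζ => hB ζ hζ)

lemma norm_schurTransform_le_div (h : IsSymbol Ψ Ψ' Ψ'') {L : ℝ → ℝ} (hL : IsLipWeight L) {u : ℂ}
    (hu : 0 < u.re) :
    ‖schurTransform Ψ L u‖ ≤ (∫ ζ in Ioi (0:ℝ), L ζ ^ 2) / u.re := by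
  have hn := norm_pos_of_re_pos hu
  refine (h.norm_schurTransform_le hL.toIsBddWeight hu).trans ?_
  rw [div_mul_eq_mul_div, ← integral_const_mul]
  refine div_le_div_of_nonneg_right ?_ hu.le
  refine setIntegral_mono_on ?_ hL.sq_int measurableSet_Ioi fun ζ hζ => ?_
  · exact (h.integrableOn_mul_inv_add hL.toIsBddWeight.sq (by positivity)).const_mul _
  · have hp := h.pos ζ hζ
    calc ‖u‖ ^ 2 * (L ζ ^ 2 * (Ψ ζ + ‖u‖ ^ 2)⁻¹)
        = L ζ ^ 2 * (‖u‖ ^ 2 / (Ψ ζ + ‖u‖ ^ 2)) := by ring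
      _ ≤ L ζ ^ 2 * 1 := by
        gcongr
        exact div_le_one_of_le₀ (by linarith) (by positivity)
      _ = _ := mul_one _

lemma tendsto_mul_re_schurTransform (h : IsSymbol Ψ Ψ' Ψ'') {L : ℝ → ℝ} (hL : IsLipWeight L) :
    Tendsto (fun k : ℝ => k * (schurTransform Ψ L k).re) (𝓝[>] 0) (𝓝 0) := by
  have key : Tendsto (fun k : ℝ => ∫ ζ in Ioi (0:ℝ), L ζ ^ 2 * (k ^ 2 / (Ψ ζ + k ^ 2)))
      (𝓝[>] 0) (𝓝 (∫ ζ in Ioi (0:ℝ), 0)) := by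
    refine tendsto_integral_filter_of_dominated_convergence (fun ζ => L ζ ^ 2) ?_ ?_
      hL.sq_int ?_
    · refine Eventually.of_forall fun k => ?_
      exact (hL.toIsBddWeight.sq.meas.aemeasurable.mul
        ((h.aestronglyMeasurable.aemeasurable.add_const _).const_div _)).aestronglyMeasurable
    · refine Eventually.of_forall fun k => ?_
      refine (ae_restrict_iff' measurableSet_Ioi).2 (Eventually.of_forall fun ζ hζ => ?_)
      have hp := h.pos ζ hζ
      rw [Real.norm_of_nonneg (by positivity)]
      refine mul_le_of_le_one_right (sq_nonneg _) ?_
      exact div_le_one_of_le₀ (by linarith) (by positivity)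
    · refine (ae_restrict_iff' measurableSet_Ioi).2 (Eventually.of_forall fun ζ hζ => ?_)
      have hp := h.pos ζ hζ
      have : ContinuousAt (fun k : ℝ => L ζ ^ 2 * (k ^ 2 / (Ψ ζ + k ^ 2))) 0 := by
        refine continuousAt_const.mul (ContinuousAt.div (by fun_prop) (by fun_prop) ?_)
        positivity
      simpa using this.tendsto.mono_left (nhdsWithin_le_nhds (s := Ioi 0))
  rw [integral_zero] at key
  refine squeeze_zero' ?_ ?_ key
  · filter_upwards [self_mem_nhdsWithin] with k hk
    have hk : 0 < k := hk
    exact mul_nonneg hk.le (h.re_schurTransform_nonneg hL.toIsBddWeight (by simpa using hk))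
  · filter_upwards [self_mem_nhdsWithin] with k hk
    have hk : 0 < k := hk
    have h1 := (Complex.re_le_norm _).trans
      (h.norm_schurTransform_le hL.toIsBddWeight (u := k) (by simpa using hk))
    rw [Complex.norm_real, Complex.ofReal_re, Real.norm_of_nonneg hk.le] at h1
    calc k * (schurTransform Ψ L k).re
        ≤ k * (k ^ 2 / k * ∫ ζ in Ioi (0:ℝ), L ζ ^ 2 * (Ψ ζ + k ^ 2)⁻¹) := by gcongr
      _ = k ^ 2 * ∫ ζ in Ioi (0:ℝ), L ζ ^ 2 * (Ψ ζ + k ^ 2)⁻¹ := by field_simp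
      _ = _ := by
        rw [← integral_const_mul]
        congr 1
        ext ζ
        ring

lemma symbolTransform_ofReal (M : ℝ → ℝ) (k : ℝ) :
    symbolTransform Ψ M k = ((k * ∫ ζ in Ioi (0:ℝ), M ζ * (Ψ ζ + k ^ 2)⁻¹ : ℝ) : ℂ) := by
  rw [symbolTransform, ← integral_const_mul, ← integral_complex_ofReal]
  congr 1
  ext ζ
  rw [stieltjesKernel]
  push_cast
  ring

lemma re_schurTransform_ofReal (L : ℝ → ℝ) {k : ℝ} (hk : 0 < k) :
    (schurTransform Ψ L k).re = k * ((∫ ζ in Ioi (0:ℝ), L ζ ^ 2 * (Ψ ζ + k ^ 2)⁻¹)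
      - (∫ ζ in Ioi (0:ℝ), L ζ * (Ψ ζ + k ^ 2)⁻¹) ^ 2
        / ∫ ζ in Ioi (0:ℝ), (Ψ ζ + k ^ 2)⁻¹) := by
  rw [schurTransform, symbolTransform_ofReal, symbolTransform_ofReal, symbolTransform_ofReal]
  simp only [one_mul]
  norm_cast
  field_simp

/-- The spectral representation of the Schur complement, for a single weight. -/
lemma integral_schur (h : IsSymbol Ψ Ψ' Ψ'') {L : ℝ → ℝ} (hL : IsLipWeight L) {K : ℝ → ℝ}
    (hK : ∀ l ∈ Ioi (0:ℝ), Tendsto (fun ε : ℝ => -(Real.pi)⁻¹ *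
      ∫ ζ in Ioi (0:ℝ) \ Icc (l - ε) (l + ε), Ψ' l / (Ψ l - Ψ ζ)) (𝓝[>] 0) (𝓝 (K l)))
    {z : ℝ} (hz : 0 < z) :
    IntegrableOn (fun l => (Ψ' l / Real.pi * diffTransform Ψ L l) ^ 2 / (1 + K l ^ 2)
      * (Ψ l + z)⁻¹) (Ioi 0) ∧
    ∫ l in Ioi (0:ℝ), (Ψ' l / Real.pi * diffTransform Ψ L l) ^ 2 / (1 + K l ^ 2) * (Ψ l + z)⁻¹
      = (∫ ζ in Ioi (0:ℝ), L ζ ^ 2 * (Ψ ζ + z)⁻¹)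
        - (∫ ζ in Ioi (0:ℝ), L ζ * (Ψ ζ + z)⁻¹) ^ 2 / ∫ ζ in Ioi (0:ℝ), (Ψ ζ + z)⁻¹ := by
  set σ : ℝ → ℝ := fun l => √(Ψ l) with hσ
  set g : ℝ → ℝ := fun l => (Ψ' l / Real.pi * diffTransform Ψ L l) ^ 2 / (1 + K l ^ 2) with hg
  have hσpos : ∀ l ∈ Ioi (0:ℝ), 0 < σ l := fun l hl => Real.sqrt_pos.2 (h.pos l hl)
  have hσsq : ∀ l ∈ Ioi (0:ℝ), σ l ^ 2 = Ψ l := fun l hl => Real.sq_sqrt (h.pos l hl).le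
  have hinj : InjOn σ (Ioi 0) := by
    intro x hx y hy hxy
    refine h.strictMono.injOn hx hy ?_
    rw [← hσsq x hx, ← hσsq y hy, hxy]
  have hsurj : ∀ y ∈ Ioi (0:ℝ), ∃ l ∈ Ioi (0:ℝ), σ l = y := by
    intro y hy
    have hy : 0 < y := hy
    obtain ⟨l, hl, e⟩ := h.exists_eq (by positivity : 0 < y ^ 2)
    exact ⟨l, hl, by rw [hσ]; simp only [e]; exact Real.sqrt_sq hy.le⟩
  have himage : σ '' Ioi 0 = Ioi 0 := by
    ext y
    constructor
    · rintro ⟨l, hl, rfl⟩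
      exact hσpos l hl
    · intro hy
      obtain ⟨l, hl, e⟩ := hsurj y hy
      exact ⟨l, hl, e⟩
  set τ : ℝ → ℝ := Function.invFunOn σ (Ioi 0) with hτ
  have hτmem : ∀ y ∈ Ioi (0:ℝ), τ y ∈ Ioi (0:ℝ) := fun y hy =>
    Function.invFunOn_mem (hsurj y hy)
  have hτeq : ∀ y ∈ Ioi (0:ℝ), σ (τ y) = y := fun y hy => Function.invFunOn_eq (hsurj y hy)
  have hτσ : ∀ l ∈ Ioi (0:ℝ), τ (σ l) = l := fun l hl =>
    hinj (hτmem _ (hσpos l hl)) hl (hτeq _ (hσpos l hl))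
  have hτsq : ∀ y ∈ Ioi (0:ℝ), y ^ 2 = Ψ (τ y) := fun y hy => by
    rw [← hσsq _ (hτmem y hy), hτeq y hy]
  set k := √z with hk
  have hk0 : 0 < k := Real.sqrt_pos.2 hz
  have hkz : k ^ 2 = z := Real.sq_sqrt hz.le
  have hmono : ∀ x ∈ Ioi (0:ℝ), ∀ y ∈ Ioi (0:ℝ), x ≤ y → τ x ≤ τ y := by
    intro x hx y hy hxy
    refine (h.strictMono.le_iff_le (hτmem x hx) (hτmem y hy)).1 ?_
    rw [← hτsq x hx, ← hτsq y hy]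
    have hx : 0 < x := hx
    gcongr
  obtain ⟨hint, heq⟩ := halfPlane_poisson_boundary (H := schurTransform Ψ L)
    (C := ∫ ζ in Ioi (0:ℝ), L ζ ^ 2)
    (f := fun y => y * (Real.pi / Ψ' (τ y)) * g (τ y))
    (h.differentiableOn_schurTransform hL.toIsBddWeight)
    (fun u hu => h.norm_schurTransform_le_div hL hu)
    (integral_nonneg fun ζ => sq_nonneg _)
    (fun u _ => by rw [schurTransform_conj, Complex.conj_re])
    (fun u hu => h.re_schurTransform_nonneg hL.toIsBddWeight hu)
    (fun y hy => h.tendsto_re_schurTransform hL (hτmem y hy) (hK _ (hτmem y hy)) hy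
      (hτsq y hy))
    (by
      intro a b ha hab
      have hb : 0 < b := ha.trans_le hab
      obtain ⟨B, hB⟩ := h.exists_re_schurTransform_le hL (hτmem a ha) (hmono a ha b hb hab) b
      refine ⟨B, ?_⟩
      filter_upwards [Ioo_mem_nhdsGT (zero_lt_one' ℝ)] with ε hε y hy
      have hy0 : 0 < y := ha.trans_le hy.1
      exact hB ε hε (τ y) ⟨hmono a ha y hy0 hy.1, hmono y hy0 b hb hy.2⟩ y ⟨hy0.le, hy.2⟩
        (hτsq y hy0))
    (h.tendsto_mul_re_schurTransform hL) hk0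
  have hσd : ∀ l ∈ Ioi (0:ℝ), HasDerivWithinAt σ (Ψ' l / (2 * √(Ψ l))) (Ioi 0) l := fun l hl =>
    ((h.deriv l hl).sqrt (h.pos l hl).ne').hasDerivWithinAt
  have hcongr : ∀ l ∈ Ioi (0:ℝ), |Ψ' l / (2 * √(Ψ l))| •
      (k / (σ l ^ 2 + k ^ 2) * (σ l * (Real.pi / Ψ' (τ (σ l))) * g (τ (σ l))))
      = Real.pi / 2 * k * (g l * (Ψ l + z)⁻¹) := by
    intro l hl
    have hp := h.deriv_pos l hl
    have hp0 := h.pos l hl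
    have hs : 0 < √(Ψ l) := hσpos l hl
    rw [hτσ l hl, hσsq l hl, hkz, abs_of_pos (by positivity), smul_eq_mul]
    simp only [hσ]
    field_simp
  rw [← himage] at hint heq
  rw [integrableOn_image_iff_integrableOn_abs_deriv_smul measurableSet_Ioi hσd hinj] at hint
  rw [integral_image_eq_integral_abs_deriv_smul measurableSet_Ioi hσd hinj,
    setIntegral_congr_fun measurableSet_Ioi hcongr, integral_const_mul,
    re_schurTransform_ofReal L hk0, hkz] at heq
  rw [integrableOn_congr_fun hcongr measurableSet_Ioi] at hint
  have hc : Real.pi / 2 * k ≠ 0 := by positivity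
  refine ⟨?_, ?_⟩
  · have := hint.const_mul (Real.pi / 2 * k)⁻¹
    simp only [inv_mul_cancel_left₀ hc] at this
    exact this
  · rw [← mul_assoc] at heq
    exact mul_left_cancel₀ hc heq

end IsSymbol

namespace IsLipWeight

lemma add {L N : ℝ → ℝ} (hL : IsLipWeight L) (hN : IsLipWeight N) :
    IsLipWeight fun ζ => L ζ + N ζ := by
  obtain ⟨A, hA0, hA⟩ := hL.lip
  obtain ⟨B, hB0, hB⟩ := hN.lip
  have hLN := hL.toIsBddWeight.add hN.toIsBddWeight
  refine ⟨hLN, ⟨A + B, by positivity, fun ζ hζ l hl => ?_⟩, ?_⟩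
  · rw [add_sub_add_comm, add_mul]
    exact (abs_add_le _ _).trans (add_le_add (hA ζ hζ l hl) (hB ζ hζ l hl))
  · refine ((hL.sq_int.const_mul 2).add (hN.sq_int.const_mul 2)).mono' hLN.sq.meas
      (Eventually.of_forall fun ζ => ?_)
    rw [Real.norm_of_nonneg (sq_nonneg _), Pi.add_apply]
    nlinarith [sq_nonneg (L ζ - N ζ)]

lemma neg {L : ℝ → ℝ} (hL : IsLipWeight L) : IsLipWeight fun ζ => -L ζ := by
  refine ⟨by simpa only [neg_one_mul] using (IsBddWeight.const (-1)).mul hL.toIsBddWeight, ?_, ?_⟩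
  · obtain ⟨A, hA0, hA⟩ := hL.lip
    refine ⟨A, hA0, fun ζ hζ l hl => ?_⟩
    rw [neg_sub_neg, abs_sub_comm]
    exact hA ζ hζ l hl
  · simpa only [neg_sq] using hL.sq_int

lemma sub {L N : ℝ → ℝ} (hL : IsLipWeight L) (hN : IsLipWeight N) :
    IsLipWeight fun ζ => L ζ - N ζ := by
  simpa only [sub_eq_add_neg] using hL.add hN.neg

end IsLipWeight

lemma isLipWeight_cauchy {ξ : ℝ} (hξ : 0 < ξ) : IsLipWeight fun ζ => ξ ^ 2 / (ξ ^ 2 + ζ ^ 2) := by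
  have hmeas : Measurable fun ζ : ℝ => ξ ^ 2 / (ξ ^ 2 + ζ ^ 2) := by fun_prop
  have hle : ∀ ζ : ℝ, ξ ^ 2 / (ξ ^ 2 + ζ ^ 2) ≤ 1 := fun ζ =>
    div_le_one_of_le₀ (by nlinarith [sq_nonneg ζ]) (by positivity)
  refine ⟨⟨hmeas.aestronglyMeasurable, 1, fun ζ _ => ?_⟩, ⟨2 / ξ, by positivity, ?_⟩, ?_⟩
  · rw [abs_of_nonneg (by positivity)]
    exact hle ζ
  · intro ζ hζ l hl
    have hζ : 0 < ζ := hζ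
    have hl : 0 < l := hl
    have e : ξ ^ 2 / (ξ ^ 2 + ζ ^ 2) - ξ ^ 2 / (ξ ^ 2 + l ^ 2)
        = ξ ^ 2 * (ζ + l) / ((ξ ^ 2 + ζ ^ 2) * (ξ ^ 2 + l ^ 2)) * (l - ζ) := by
      field_simp
      ring
    rw [e, abs_mul, abs_sub_comm l ζ, abs_of_pos (by positivity)]
    refine mul_le_mul_of_nonneg_right ?_ (abs_nonneg _)
    rw [div_le_div_iff₀ (by positivity) hξ]
    have h1 : ξ * ζ ≤ ξ ^ 2 + ζ ^ 2 := by nlinarith [sq_nonneg (ξ - ζ)]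
    have h2 : ξ * l ≤ ξ ^ 2 + l ^ 2 := by nlinarith [sq_nonneg (ξ - l)]
    have h3 : ξ * ζ * ξ ^ 2 ≤ (ξ ^ 2 + ζ ^ 2) * (ξ ^ 2 + l ^ 2) := by
      gcongr
      nlinarith [sq_nonneg l]
    have h4 : ξ ^ 2 * (ξ * l) ≤ (ξ ^ 2 + ζ ^ 2) * (ξ ^ 2 + l ^ 2) := by
      gcongr
      nlinarith [sq_nonneg ζ]
    nlinarith
  · have hb : Integrable fun ζ : ℝ => (1 + (ξ⁻¹ * ζ) ^ 2)⁻¹ :=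
      integrable_inv_one_add_sq.comp_mul_left' (inv_ne_zero hξ.ne')
    refine hb.integrableOn.mono' (hmeas.pow_const 2).aestronglyMeasurable
      (Eventually.of_forall fun ζ => ?_)
    have e : (1 + (ξ⁻¹ * ζ) ^ 2)⁻¹ = ξ ^ 2 / (ξ ^ 2 + ζ ^ 2) := by
      field_simp
    rw [Real.norm_of_nonneg (by positivity), e, pow_two (_ / _)]
    exact mul_le_of_le_one_right (by positivity) (hle ζ)

/-- The Laplace transform of a superposition of exponentials. -/
lemma integral_laplace {g P : ℝ → ℝ} {z : ℝ} (hz : 0 < z) (hP : ∀ l ∈ Ioi (0:ℝ), 0 < P l)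
    (hPm : AEStronglyMeasurable P (volume.restrict (Ioi 0)))
    (hg : IntegrableOn (fun l => g l * (P l + z)⁻¹) (Ioi 0)) :
    ∫ t in Ioi (0:ℝ), (∫ l in Ioi (0:ℝ), g l * Real.exp (-(t * P l))) * Real.exp (-(z * t))
      = ∫ l in Ioi (0:ℝ), g l * (P l + z)⁻¹ := by
  set μ := volume.restrict (Ioi (0:ℝ)) with hμ
  have hexp : ∀ c : ℝ, 0 < c → ∫ t in Ioi (0:ℝ), Real.exp (-c * t) = c⁻¹ := by
    intro c hc
    rw [integral_exp_mul_Ioi (neg_lt_zero.2 hc)]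
    simp
  have hgm : AEStronglyMeasurable g μ := by
    refine (hg.aestronglyMeasurable.mul (hPm.add aestronglyMeasurable_const)).congr
      (g := g) (f := fun l => g l * (P l + z)⁻¹ * (P l + z)) ?_
    refine (ae_restrict_iff' measurableSet_Ioi).2 (Eventually.of_forall fun l hl => ?_)
    have := hP l hl
    exact inv_mul_cancel_right₀ (by positivity) _
  have hF : Integrable (Function.uncurry fun t l => g l * Real.exp (-(P l + z) * t))
      (μ.prod μ) := by
    have hm : AEStronglyMeasurable (fun p : ℝ × ℝ => g p.1 * Real.exp (-(P p.1 + z) * p.2))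
        (μ.prod μ) := by
      refine hgm.comp_fst.mul (Real.continuous_exp.comp_aestronglyMeasurable ?_)
      exact ((hPm.comp_fst.add aestronglyMeasurable_const).neg).mul
        measurable_snd.aestronglyMeasurable
    refine Integrable.swap (f := fun p : ℝ × ℝ => g p.1 * Real.exp (-(P p.1 + z) * p.2)) ?_
    refine (integrable_prod_iff hm).2 ⟨?_, ?_⟩
    · refine (ae_restrict_iff' measurableSet_Ioi).2 (Eventually.of_forall fun l hl => ?_)
      have := hP l hl
      have hneg : -(P l + z) < 0 := by linarith
      exact (integrableOn_exp_mul_Ioi hneg 0).const_mul (g l)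
    · refine (hg.norm).congr ?_
      refine (ae_restrict_iff' measurableSet_Ioi).2 (Eventually.of_forall fun l hl => ?_)
      have := hP l hl
      simp only [norm_mul, Real.norm_eq_abs, Real.abs_exp]
      rw [integral_const_mul, hexp (P l + z) (by positivity),
        abs_of_pos (by positivity : 0 < (P l + z)⁻¹)]
  calc ∫ t in Ioi (0:ℝ), (∫ l in Ioi (0:ℝ), g l * Real.exp (-(t * P l))) * Real.exp (-(z * t))
      = ∫ t in Ioi (0:ℝ), ∫ l in Ioi (0:ℝ), g l * Real.exp (-(P l + z) * t) := by
        congr 1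
        ext t
        rw [← integral_mul_const]
        congr 1
        ext l
        rw [mul_assoc, ← Real.exp_add]
        ring_nf
    _ = ∫ l in Ioi (0:ℝ), ∫ t in Ioi (0:ℝ), g l * Real.exp (-(P l + z) * t) :=
        integral_integral_swap hF
    _ = _ := by
        refine setIntegral_congr_fun measurableSet_Ioi fun l hl => ?_
        have := hP l hl
        rw [integral_const_mul, hexp _ (by positivity)]

lemma IsSymbol.integral_schur_pair {Ψ Ψ' Ψ'' : ℝ → ℝ} (h : IsSymbol Ψ Ψ' Ψ'') {L N : ℝ → ℝ}
    (hL : IsLipWeight L) (hN : IsLipWeight N) {K : ℝ → ℝ}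
    (hK : ∀ l ∈ Ioi (0:ℝ), Tendsto (fun ε : ℝ => -(Real.pi)⁻¹ *
      ∫ ζ in Ioi (0:ℝ) \ Icc (l - ε) (l + ε), Ψ' l / (Ψ l - Ψ ζ)) (𝓝[>] 0) (𝓝 (K l)))
    {z : ℝ} (hz : 0 < z) :
    IntegrableOn (fun l => (Ψ' l / Real.pi * diffTransform Ψ L l)
      * (Ψ' l / Real.pi * diffTransform Ψ N l) / (1 + K l ^ 2) * (Ψ l + z)⁻¹) (Ioi 0) ∧
    ∫ l in Ioi (0:ℝ), (Ψ' l / Real.pi * diffTransform Ψ L l)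
      * (Ψ' l / Real.pi * diffTransform Ψ N l) / (1 + K l ^ 2) * (Ψ l + z)⁻¹
      = (∫ ζ in Ioi (0:ℝ), L ζ * N ζ * (Ψ ζ + z)⁻¹)
        - (∫ ζ in Ioi (0:ℝ), L ζ * (Ψ ζ + z)⁻¹) * (∫ ζ in Ioi (0:ℝ), N ζ * (Ψ ζ + z)⁻¹)
          / ∫ ζ in Ioi (0:ℝ), (Ψ ζ + z)⁻¹ := by
  obtain ⟨ip, ep⟩ := h.integral_schur (hL.add hN) hK hz
  obtain ⟨im, em⟩ := h.integral_schur (hL.sub hN) hK hz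
  have hcongr : ∀ l ∈ Ioi (0:ℝ), 1 / 4 *
      ((Ψ' l / Real.pi * diffTransform Ψ (fun ζ => L ζ + N ζ) l) ^ 2 / (1 + K l ^ 2)
          * (Ψ l + z)⁻¹
        - (Ψ' l / Real.pi * diffTransform Ψ (fun ζ => L ζ - N ζ) l) ^ 2 / (1 + K l ^ 2)
          * (Ψ l + z)⁻¹)
      = (Ψ' l / Real.pi * diffTransform Ψ L l) * (Ψ' l / Real.pi * diffTransform Ψ N l)
        / (1 + K l ^ 2) * (Ψ l + z)⁻¹ := by
    intro l hl
    rw [h.diffTransform_add hL hN hl, h.diffTransform_sub hL hN hl]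
    ring
  have iL := h.integrableOn_mul_inv_add hL.toIsBddWeight hz
  have iN := h.integrableOn_mul_inv_add hN.toIsBddWeight hz
  have ipp := h.integrableOn_mul_inv_add (hL.add hN).toIsBddWeight.sq hz
  have imm := h.integrableOn_mul_inv_add (hL.sub hN).toIsBddWeight.sq hz
  refine ⟨(integrableOn_congr_fun hcongr measurableSet_Ioi).1 ((ip.sub im).const_mul _), ?_⟩
  rw [← setIntegral_congr_fun measurableSet_Ioi hcongr, integral_const_mul, integral_sub ip im,
    ep, em]
  have e2 : ∫ ζ in Ioi (0:ℝ), L ζ * N ζ * (Ψ ζ + z)⁻¹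
      = 1 / 4 * ((∫ ζ in Ioi (0:ℝ), (L ζ + N ζ) ^ 2 * (Ψ ζ + z)⁻¹)
        - ∫ ζ in Ioi (0:ℝ), (L ζ - N ζ) ^ 2 * (Ψ ζ + z)⁻¹) := by
    rw [← integral_sub ipp imm, ← integral_const_mul]
    congr 1
    ext ζ
    ring
  simp only [add_mul, sub_mul] at e2 ⊢
  rw [e2, integral_add iL iN, integral_sub iL iN]
  ring

theorem laplace_transform_of_Phi (Ψ Ψ' Ψ'' : ℝ → ℝ)
    (hmono : StrictMonoOn Ψ (Ioi 0))
    (hnonneg : ∀ ζ ∈ Ioi (0:ℝ), 0 ≤ Ψ ζ)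
    (hΨd1 : ∀ ζ ∈ Ioi (0:ℝ), HasDerivAt Ψ (Ψ' ζ) ζ)
    (hΨd2 : ∀ ζ ∈ Ioi (0:ℝ), HasDerivAt Ψ' (Ψ'' ζ) ζ)
    (hΨ''cont : ContinuousOn Ψ'' (Ioi 0))
    (hΨ'pos : ∀ ζ ∈ Ioi (0:ℝ), 0 < Ψ' ζ)
    (hint : IntegrableOn (fun ζ => 1 / (1 + Ψ ζ)) (Ioi 0))
    (hΨ0 : Tendsto Ψ (𝓝[>] 0) (𝓝 0))
    (hΨtop : Tendsto Ψ atTop atTop)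
    (K : ℝ → ℝ) (Kx : ℝ → ℝ → ℝ)
    (hK : ∀ lam ∈ Ioi (0:ℝ), Tendsto (fun ε : ℝ =>
        -(Real.pi)⁻¹ * ∫ ζ in Ioi (0:ℝ) \ Icc (lam - ε) (lam + ε),
          Ψ' lam / (Ψ lam - Ψ ζ))
      (𝓝[>] 0) (𝓝 (K lam)))
    (hKx : ∀ lam ∈ Ioi (0:ℝ), ∀ ξ ∈ Ioi (0:ℝ), Tendsto (fun ε : ℝ =>
        -(Real.pi)⁻¹ * ∫ ζ in Ioi (0:ℝ) \ Icc (lam - ε) (lam + ε),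
          (ξ^2 / (ξ^2 + ζ^2)) * (Ψ' lam / (Ψ lam - Ψ ζ)))
      (𝓝[>] 0) (𝓝 (Kx lam ξ)))
    (ξ₁ ξ₂ : ℝ) (hξ₁ : 0 < ξ₁) (hξ₂ : 0 < ξ₂)
    (Φ : ℝ → ℝ)
    (hΦ : ∀ t : ℝ, Φ t = ∫ lam in Ioi (0:ℝ),
        (K lam * (ξ₁^2 / (ξ₁^2 + lam^2)) - Kx lam ξ₁) *
          (K lam * (ξ₂^2 / (ξ₂^2 + lam^2)) - Kx lam ξ₂) / (1 + (K lam)^2) *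
            Real.exp (-(t * Ψ lam)))
    (z : ℝ) (hz : 0 < z) :
    (Real.pi)⁻¹ * ∫ t in Ioi (0:ℝ), Φ t * Real.exp (-(z * t))
      = phi2R Ψ ξ₁ ξ₂ z - phi1R Ψ ξ₁ z * phi1R Ψ ξ₂ z / phiR Ψ z := by
  have h : IsSymbol Ψ Ψ' Ψ'' :=
    { strictMono := hmono
      pos := fun ζ hζ => by
        have hζ : 0 < ζ := hζ
        have h2 : ζ / 2 ∈ Ioi (0:ℝ) := half_pos hζ
        exact (hnonneg _ h2).trans_lt (hmono h2 hζ (half_lt_self hζ))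
      deriv := hΨd1
      deriv2 := hΨd2
      cont2 := hΨ''cont
      deriv_pos := hΨ'pos
      int := hint
      tendsto_zero := hΨ0
      tendsto_top := hΨtop }
  have w₁ := isLipWeight_cauchy hξ₁
  have w₂ := isLipWeight_cauchy hξ₂
  obtain ⟨hi, he⟩ := h.integral_schur_pair w₁ w₂ hK hz
  have hcongr : ∀ l ∈ Ioi (0:ℝ),
      (Ψ' l / Real.pi * diffTransform Ψ (fun ζ => ξ₁ ^ 2 / (ξ₁ ^ 2 + ζ ^ 2)) l)
        * (Ψ' l / Real.pi * diffTransform Ψ (fun ζ => ξ₂ ^ 2 / (ξ₂ ^ 2 + ζ ^ 2)) l)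
        / (1 + K l ^ 2) * (Ψ l + z)⁻¹
      = (K l * (ξ₁ ^ 2 / (ξ₁ ^ 2 + l ^ 2)) - Kx l ξ₁)
        * (K l * (ξ₂ ^ 2 / (ξ₂ ^ 2 + l ^ 2)) - Kx l ξ₂) / (1 + K l ^ 2) * (Ψ l + z)⁻¹ := by
    intro l hl
    rw [h.principalValue_sub_eq w₁ hl (hK l hl) (hKx l hl ξ₁ hξ₁),
      h.principalValue_sub_eq w₂ hl (hK l hl) (hKx l hl ξ₂ hξ₂), neg_mul_neg]
  rw [integrableOn_congr_fun hcongr measurableSet_Ioi] at hi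
  rw [setIntegral_congr_fun measurableSet_Ioi hcongr] at he
  simp only [hΦ]
  rw [integral_laplace hz h.pos h.aestronglyMeasurable hi, he, phi2R, phi1R, phi1R, phiR]
  field_simp
end

section
/- For all λ, ξ > 0: lim_{ε→0⁺} ∫_{(0,∞)∖[λ−ε,λ+ε]} (ξ/(ξ²+ζ²)) · (2λ/(λ²−ζ²)) dζ = πλ/(λ²+ξ²); that is, (1/π) pv∫₀^∞ (ξ/(ξ²+ζ²)) · (2λ/(λ²−ζ²)) dζ = λ/(λ²+ξ²). -/
open MeasureTheory Filter Topology Set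

/-- An antiderivative, away from `lam`, of the Poisson kernel times `2 * lam / (lam ^ 2 - ζ ^ 2)`. -/
noncomputable def pvAntideriv (lam ξ ζ : ℝ) : ℝ :=
  2 * lam / (lam ^ 2 + ξ ^ 2) * Real.arctan (ζ / ξ) +
    ξ / (lam ^ 2 + ξ ^ 2) * (Real.log (lam + ζ) - Real.log (lam - ζ))

theorem hasDerivAt_pvAntideriv {lam ξ ζ : ℝ} (hlam : 0 < lam) (hξ : 0 < ξ) (hζ : 0 ≤ ζ)
    (hne : ζ ≠ lam) :
    HasDerivAt (pvAntideriv lam ξ) ((ξ / (ξ ^ 2 + ζ ^ 2)) * (2 * lam / (lam ^ 2 - ζ ^ 2))) ζ := by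
  have h1 : lam + ζ ≠ 0 := by positivity
  have h2 : lam - ζ ≠ 0 := sub_ne_zero.2 hne.symm
  have h3 : lam ^ 2 - ζ ^ 2 ≠ 0 := by
    rw [sq_sub_sq]; exact mul_ne_zero h1 h2
  have ha := ((hasDerivAt_id ζ).div_const ξ).arctan.const_mul (2 * lam / (lam ^ 2 + ξ ^ 2))
  have hb := ((((hasDerivAt_id ζ).const_add lam).log h1).sub
    (((hasDerivAt_id ζ).const_sub lam).log h2)).const_mul (ξ / (lam ^ 2 + ξ ^ 2))
  refine (ha.add hb).congr_deriv ?_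
  have h4 : ξ ^ 2 + ζ ^ 2 ≠ 0 := by positivity
  have h5 : lam ^ 2 + ξ ^ 2 ≠ 0 := by positivity
  have e1 : 1 / (1 + (ζ / ξ) ^ 2) * (1 / ξ) = ξ / (ξ ^ 2 + ζ ^ 2) := by
    field_simp
  have e2 : 1 / (lam + ζ) - -1 / (lam - ζ) = 2 * lam / (lam ^ 2 - ζ ^ 2) := by
    rw [sq_sub_sq]; field_simp; ring
  simp only [id_eq]
  rw [e1, e2]
  field_simp
  ring

theorem tendsto_pvAntideriv_atTop {lam ξ : ℝ} (hξ : 0 < ξ) :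
    Tendsto (pvAntideriv lam ξ) atTop (𝓝 (Real.pi * lam / (lam ^ 2 + ξ ^ 2))) := by
  have ha : Tendsto (fun ζ : ℝ => Real.arctan (ζ / ξ)) atTop (𝓝 (Real.pi / 2)) :=
    (Real.tendsto_arctan_atTop.mono_right nhdsWithin_le_nhds).comp (tendsto_id.atTop_div_const hξ)
  have hb : Tendsto (fun ζ : ℝ => Real.log (lam + ζ) - Real.log (lam - ζ)) atTop (𝓝 0) := by
    have h := (Real.tendsto_log_comp_add_sub_log lam).sub (Real.tendsto_log_comp_add_sub_log (-lam))
    rw [sub_zero] at h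
    refine h.congr fun ζ => ?_
    rw [← Real.log_neg_eq_log (lam - ζ), add_comm lam, show -(lam - ζ) = ζ + -lam by ring]
    ring
  have h := (ha.const_mul (2 * lam / (lam ^ 2 + ξ ^ 2))).add
    (hb.const_mul (ξ / (lam ^ 2 + ξ ^ 2)))
  rwa [show 2 * lam / (lam ^ 2 + ξ ^ 2) * (Real.pi / 2) + ξ / (lam ^ 2 + ξ ^ 2) * 0 =
    Real.pi * lam / (lam ^ 2 + ξ ^ 2) by ring] at h

theorem pvAntideriv_zero (lam ξ : ℝ) : pvAntideriv lam ξ 0 = 0 := by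
  simp [pvAntideriv]

theorem tendsto_pvAntideriv_sub {lam ξ : ℝ} (hlam : 0 < lam) :
    Tendsto (fun ε : ℝ => pvAntideriv lam ξ (lam - ε) - pvAntideriv lam ξ (lam + ε))
      (𝓝 0) (𝓝 0) := by
  have heq : (fun ε : ℝ => pvAntideriv lam ξ (lam - ε) - pvAntideriv lam ξ (lam + ε)) =
      fun ε : ℝ => 2 * lam / (lam ^ 2 + ξ ^ 2) *
          (Real.arctan ((lam - ε) / ξ) - Real.arctan ((lam + ε) / ξ)) +
        ξ / (lam ^ 2 + ξ ^ 2) *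
          (Real.log (lam + (lam - ε)) - Real.log (lam + (lam + ε))) := by
    funext ε
    have h1 : lam - (lam - ε) = ε := by ring
    have h2 : lam - (lam + ε) = -ε := by ring
    simp only [pvAntideriv, h1, h2, Real.log_neg_eq_log]
    ring
  rw [heq]
  have hm : ContinuousAt (fun ε : ℝ => Real.log (lam + (lam - ε))) 0 :=
    ContinuousAt.log (by fun_prop) (by simp; positivity)
  have hp : ContinuousAt (fun ε : ℝ => Real.log (lam + (lam + ε))) 0 :=
    ContinuousAt.log (by fun_prop) (by simp; positivity)
  have ha : ContinuousAt (fun ε : ℝ =>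
      Real.arctan ((lam - ε) / ξ) - Real.arctan ((lam + ε) / ξ)) 0 :=
    Continuous.continuousAt (by fun_prop)
  have h := (ha.tendsto.const_mul (2 * lam / (lam ^ 2 + ξ ^ 2))).add
    ((hm.sub hp).tendsto.const_mul (ξ / (lam ^ 2 + ξ ^ 2)))
  simpa using h

theorem setIntegral_poisson_kernel_diff_Icc {lam ξ ε : ℝ} (hlam : 0 < lam) (hξ : 0 < ξ)
    (hε : 0 < ε) (hε' : ε < lam) :
    ∫ ζ in Ioi (0:ℝ) \ Icc (lam - ε) (lam + ε),
        (ξ / (ξ ^ 2 + ζ ^ 2)) * (2 * lam / (lam ^ 2 - ζ ^ 2)) =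
      Real.pi * lam / (lam ^ 2 + ξ ^ 2) +
        (pvAntideriv lam ξ (lam - ε) - pvAntideriv lam ξ (lam + ε)) := by
  have hset : Ioi (0:ℝ) \ Icc (lam - ε) (lam + ε) = Ioo 0 (lam - ε) ∪ Ioi (lam + ε) := by
    ext ζ
    simp only [Set.mem_sdiff, mem_Ioi, mem_Icc, mem_union, mem_Ioo, not_and_or, not_le]
    constructor
    · rintro ⟨h, h' | h'⟩
      · exact Or.inl ⟨h, h'⟩
      · exact Or.inr h'
    · rintro (⟨h, h'⟩ | h)
      · exact ⟨h, Or.inl h'⟩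
      · exact ⟨by linarith, Or.inr h⟩
  have hle : 0 ≤ lam - ε := by linarith
  have hcont : ContinuousOn
      (fun ζ : ℝ => (ξ / (ξ ^ 2 + ζ ^ 2)) * (2 * lam / (lam ^ 2 - ζ ^ 2)))
      (uIcc 0 (lam - ε)) := by
    rw [uIcc_of_le hle]
    refine ContinuousOn.mul (continuousOn_const.div (by fun_prop) fun ζ _ => by positivity)
      (continuousOn_const.div (by fun_prop) fun ζ hζ => ?_)
    have : ζ < lam := by linarith [hζ.2]
    have : 0 < lam ^ 2 - ζ ^ 2 := by
      rw [sq_sub_sq]; exact mul_pos (by linarith [hζ.1]) (by linarith)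
    exact this.ne'
  have hleft : ∫ ζ in Ioo 0 (lam - ε), (ξ / (ξ ^ 2 + ζ ^ 2)) * (2 * lam / (lam ^ 2 - ζ ^ 2)) =
      pvAntideriv lam ξ (lam - ε) := by
    rw [← integral_Ioc_eq_integral_Ioo, ← intervalIntegral.integral_of_le hle,
      intervalIntegral.integral_eq_sub_of_hasDerivAt (f := pvAntideriv lam ξ) (fun ζ hζ => ?_)
        hcont.intervalIntegrable,
      pvAntideriv_zero, sub_zero]
    rw [uIcc_of_le hle] at hζ
    exact hasDerivAt_pvAntideriv hlam hξ hζ.1 (by linarith [hζ.2] : ζ < lam).ne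
  have hderiv : ∀ ζ ∈ Ici (lam + ε), HasDerivAt (pvAntideriv lam ξ)
      ((ξ / (ξ ^ 2 + ζ ^ 2)) * (2 * lam / (lam ^ 2 - ζ ^ 2))) ζ := fun ζ hζ => by
    rw [mem_Ici] at hζ
    exact hasDerivAt_pvAntideriv hlam hξ (by linarith) (by linarith : lam < ζ).ne'
  have hnonpos : ∀ ζ ∈ Ioi (lam + ε),
      (ξ / (ξ ^ 2 + ζ ^ 2)) * (2 * lam / (lam ^ 2 - ζ ^ 2)) ≤ 0 := fun ζ hζ => by
    rw [mem_Ioi] at hζ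
    exact mul_nonpos_of_nonneg_of_nonpos (by positivity)
      (div_nonpos_of_nonneg_of_nonpos (by positivity) (by nlinarith))
  have hint := integrableOn_Ioi_deriv_of_nonpos' hderiv hnonpos (tendsto_pvAntideriv_atTop hξ)
  have hright := integral_Ioi_of_hasDerivAt_of_nonpos' hderiv hnonpos (tendsto_pvAntideriv_atTop hξ)
  have hdisj : Disjoint (Ioo 0 (lam - ε)) (Ioi (lam + ε)) :=
    Set.disjoint_left.2 fun ζ h h' => by
      rw [mem_Ioi] at h'
      linarith [h.2]
  have hintl := (hcont.integrableOn_compact isCompact_uIcc).mono_set (μ := volume)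
    ((Ioo_subset_Icc_self).trans (Icc_subset_uIcc))
  rw [hset, setIntegral_union hdisj measurableSet_Ioi hintl hint, hleft, hright]
  ring

theorem pv_integral_poisson_kernel (lam ξ : ℝ) (hlam : 0 < lam) (hξ : 0 < ξ) :
    Tendsto (fun ε : ℝ =>
        ∫ ζ in Ioi (0:ℝ) \ Icc (lam - ε) (lam + ε),
          (ξ / (ξ^2 + ζ^2)) * (2 * lam / (lam^2 - ζ^2)))
      (𝓝[>] 0) (𝓝 (Real.pi * lam / (lam^2 + ξ^2))) := by
  have h := ((tendsto_pvAntideriv_sub (ξ := ξ) hlam).mono_left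
    (nhdsWithin_le_nhds (s := Ioi 0))).const_add (Real.pi * lam / (lam ^ 2 + ξ ^ 2))
  rw [add_zero] at h
  refine h.congr' ?_
  filter_upwards [Ioo_mem_nhdsGT hlam] with ε hε
  exact (setIntegral_poisson_kernel_diff_Icc hlam hξ hε.1 hε.2).symm
end

section
/- Let α ∈ (1,2] and λ > 0. Then the principal value pv∫₀^∞ αλ^{α−1}/(λ^α − ξ^α) dξ exists and equals π·cot(π/α). Consequently, for Ψ(ξ) = ξ^α one has K_λ = −cot(π/α) and ϑ_λ := arctan K_λ = π/α − π/2 for every λ > 0. -/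
open MeasureTheory Filter Topology Set

lemma tendsto_sum_one_div_sub_cot {s : ℝ} (hs : s ∈ Ioo (0 : ℝ) 1) :
    Tendsto (fun N : ℕ => ∑ n ∈ Finset.range N, (1 / ((n : ℝ) + s) - 1 / ((n : ℝ) + 1 - s))) atTop
      (𝓝 (Real.pi * Real.cot (Real.pi * s))) := by
  have hmem : (s : ℂ) ∈ Complex.integerComplement := by
    rintro ⟨n, hn⟩
    have h : (n : ℝ) = s := by exact_mod_cast hn
    obtain ⟨h0, h1⟩ := hs
    rw [← h] at h0 h1
    have : 0 < n := by exact_mod_cast h0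
    have : n < 1 := by exact_mod_cast h1
    omega
  have h1 : Tendsto (fun N : ℕ => ∑ n ∈ Finset.range N,
      (1 / (s - ((n : ℝ) + 1)) + 1 / (s + ((n : ℝ) + 1)))) atTop
      (𝓝 (Real.pi * Real.cot (Real.pi * s) - 1 / s)) := by
    have := (Complex.continuous_re.tendsto _).comp (tendsto_logDeriv_euler_cot_sub hmem)
    have e : (Real.pi * Real.cot (Real.pi * s) - 1 / s : ℝ)
        = ((Real.pi : ℂ) * Complex.cot (Real.pi * s) - 1 / s).re := by
      rw [← Complex.ofReal_re (Real.pi * Real.cot (Real.pi * s) - 1 / s)]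
      push_cast
      rfl
    rw [e]
    refine this.congr fun N => ?_
    simp only [Function.comp, cotTerm]
    rw [← Complex.ofReal_re (∑ n ∈ Finset.range N, _)]
    push_cast
    rfl
  have h2 : Tendsto (fun N : ℕ => 1 / ((N : ℝ) + s)) atTop (𝓝 0) := by
    simp only [one_div]
    exact tendsto_inv_atTop_zero.comp
      (tendsto_atTop_add_const_right _ s tendsto_natCast_atTop_atTop)
  have h3 := (h1.add_const (1 / s)).sub h2
  rw [sub_add_cancel, sub_zero] at h3
  refine h3.congr fun N => ?_
  induction N with
  | zero => simp
  | succ N ih =>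
    rw [Finset.sum_range_succ, Finset.sum_range_succ, ← ih]
    have : 1 / (s - ((N : ℝ) + 1)) = - (1 / ((N : ℝ) + 1 - s)) := by
      rw [← neg_sub, one_div, one_div, inv_neg]
    rw [this, add_comm s]
    push_cast
    ring

/-- The integrand on `(0, 1)` obtained by folding `(1, ∞)` onto `(0, 1)` through `u ↦ 1 / u`. -/
noncomputable def foldedKernel (α w : ℝ) : ℝ := α * (1 - w ^ (α - 2)) / (1 - w ^ α)

lemma integrableOn_rpow_sub_two {α b : ℝ} (hα : 1 < α) :
    IntegrableOn (fun w : ℝ => w ^ (α - 2)) (Ioo 0 b) := by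
  rcases le_total 0 b with hb | hb
  · have := (intervalIntegral.intervalIntegrable_rpow' (a := 0) (b := b)
      (show -1 < α - 2 by linarith)).1
    exact this.mono_set Ioo_subset_Ioc_self
  · simp [Ioo_eq_empty_of_le hb]

lemma integrableOn_foldedKernel {α : ℝ} (hα : α ∈ Ioc (1 : ℝ) 2) :
    IntegrableOn (foldedKernel α) (Ioo 0 1) := by
  obtain ⟨h1, h2⟩ := hα
  refine Integrable.mono' ((integrableOn_rpow_sub_two h1).const_mul α)
    (Measurable.aestronglyMeasurable (by unfold foldedKernel; fun_prop)) ?_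
  refine (ae_restrict_iff' measurableSet_Ioo).2 (.of_forall fun w hw => ?_)
  have ha : w ^ α < 1 := Real.rpow_lt_one hw.1.le hw.2 (by linarith)
  have hb : 1 ≤ w ^ (α - 2) :=
    Real.one_le_rpow_of_pos_of_le_one_of_nonpos hw.1 hw.2.le (by linarith)
  have hc : w ^ (α - 2) * w ^ α ≤ 1 := by
    rw [← Real.rpow_add hw.1]
    exact Real.rpow_le_one hw.1.le hw.2.le (by linarith)
  rw [foldedKernel, Real.norm_eq_abs, abs_div, abs_mul, abs_of_pos (by linarith : 0 < α),
    abs_of_pos (by linarith : 0 < 1 - w ^ α), abs_of_nonpos (by linarith), div_le_iff₀ (by linarith),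
    mul_assoc]
  gcongr
  linarith

lemma integral_rpow_Ioo_zero_one {r : ℝ} (hr : -1 < r) :
    ∫ w in Ioo (0 : ℝ) 1, w ^ r = 1 / (r + 1) := by
  rw [← integral_Ioc_eq_integral_Ioo, ← intervalIntegral.integral_of_le zero_le_one,
    integral_rpow (Or.inl hr), Real.one_rpow, Real.zero_rpow (by linarith), sub_zero]

lemma integrableOn_rpow_Ioo_zero_one {r : ℝ} (hr : -1 < r) :
    IntegrableOn (fun w : ℝ => w ^ r) (Ioo 0 1) :=
  (intervalIntegral.intervalIntegrable_rpow' (a := 0) (b := 1) hr).1.mono_set Ioo_subset_Ioc_self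

lemma integral_foldedKernel {α : ℝ} (hα : α ∈ Ioc (1 : ℝ) 2) :
    ∫ w in Ioo 0 1, foldedKernel α w = Real.pi * Real.cot (Real.pi / α) := by
  obtain ⟨h1, h2⟩ := hα
  have h0 : 0 < α := by linarith
  let F : ℕ → ℝ → ℝ := fun n w => α * (w ^ (α * n) - w ^ (α * n + (α - 2)))
  have hp (n : ℕ) : 0 ≤ α * (n : ℝ) := by positivity
  have hI (n : ℕ) : IntegrableOn (F n) (Ioo 0 1) :=
    ((integrableOn_rpow_Ioo_zero_one (by linarith [hp n])).sub
      (integrableOn_rpow_Ioo_zero_one (by linarith [hp n]))).const_mul α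
  have h_integral (n : ℕ) : ∫ w in Ioo 0 1, F n w
      = 1 / ((n : ℝ) + 1 / α) - 1 / ((n : ℝ) + 1 - 1 / α) := by
    have e1 : (n : ℝ) + 1 / α = (α * n + 1) / α := by field_simp
    have e2 : (n : ℝ) + 1 - 1 / α = (α * n + (α - 2) + 1) / α := by field_simp; ring
    simp only [F]
    rw [integral_const_mul, integral_sub (integrableOn_rpow_Ioo_zero_one (by linarith [hp n]))
      (integrableOn_rpow_Ioo_zero_one (by linarith [hp n])),
      integral_rpow_Ioo_zero_one (by linarith [hp n]),
      integral_rpow_Ioo_zero_one (by linarith [hp n]), e1, e2, one_div_div, one_div_div]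
    ring
  have hnp (n : ℕ) (w : ℝ) (hw : w ∈ Ioo (0 : ℝ) 1) : F n w ≤ 0 := by
    have := Real.rpow_le_rpow_of_exponent_ge hw.1 hw.2.le
      (show α * n + (α - 2) ≤ α * n by linarith)
    exact mul_nonpos_of_nonneg_of_nonpos h0.le (by linarith)
  have hnorm (n : ℕ) : ∫ w in Ioo 0 1, ‖F n w‖ = -∫ w in Ioo 0 1, F n w := by
    rw [← integral_neg]
    exact setIntegral_congr_fun measurableSet_Ioo fun w hw => by
      simp only [Real.norm_eq_abs, abs_of_nonpos (hnp n w hw)]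
  have hlim := tendsto_sum_one_div_sub_cot (s := 1 / α)
    ⟨by positivity, by rw [div_lt_one h0]; exact h1⟩
  simp_rw [← h_integral] at hlim
  rw [mul_one_div] at hlim
  have hsum : Summable fun n => ∫ w in Ioo 0 1, ‖F n w‖ := by
    refine ((hasSum_iff_tendsto_nat_of_nonneg
      (fun n => integral_nonneg fun w => norm_nonneg _)
      (-(Real.pi * Real.cot (Real.pi / α)))).2 ?_).summable
    simp_rw [hnorm, Finset.sum_neg_distrib]
    exact hlim.neg
  have hS := hasSum_integral_of_summable_integral_norm hI hsum
  rw [← tendsto_nhds_unique hS.tendsto_sum_nat hlim]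
  refine setIntegral_congr_fun measurableSet_Ioo fun w hw => ?_
  have ha : w ^ α < 1 := Real.rpow_lt_one hw.1.le hw.2 h0
  have hg := (hasSum_geometric_of_lt_one (Real.rpow_nonneg hw.1.le α) ha).mul_left
    (α * (1 - w ^ (α - 2)))
  simp only [foldedKernel]
  rw [div_eq_mul_inv, ← hg.tsum_eq]
  refine tsum_congr fun n => ?_
  simp only [F]
  rw [Real.rpow_add hw.1, Real.rpow_mul hw.1.le, Real.rpow_natCast]
  ring

lemma rpow_le_self_of_mem {α w : ℝ} (hα : 1 < α) (hw : w ∈ Ioo (0 : ℝ) 1) : w ^ α ≤ w := by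
  simpa using Real.rpow_le_rpow_of_exponent_ge hw.1 hw.2.le hα.le

lemma integrableOn_mul_inv_one_sub_rpow {α b : ℝ} (hα : 1 < α) (hb : b < 1) {f : ℝ → ℝ}
    (hf : IntegrableOn f (Ioo 0 b)) :
    IntegrableOn (fun w => f w / (1 - w ^ α)) (Ioo 0 b) := by
  simp only [div_eq_mul_inv]
  refine Integrable.mul_bdd (c := (1 - b)⁻¹) hf
    (Measurable.aestronglyMeasurable (by fun_prop)) ?_
  refine (ae_restrict_iff' measurableSet_Ioo).2 (.of_forall fun w hw => ?_)
  have := rpow_le_self_of_mem hα ⟨hw.1, hw.2.trans hb⟩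
  have h := hw.2
  rw [norm_inv, Real.norm_eq_abs, abs_of_pos (by linarith)]
  exact inv_anti₀ (by linarith) (by linarith)

lemma tendsto_integral_sub_integral {α : ℝ} (hα : α ∈ Ioc (1 : ℝ) 2) :
    Tendsto (fun δ : ℝ => (∫ w in Ioo 0 (1 - δ), α / (1 - w ^ α)) -
        ∫ w in Ioo 0 (1 / (1 + δ)), α * w ^ (α - 2) / (1 - w ^ α))
      (𝓝[>] 0) (𝓝 (Real.pi * Real.cot (Real.pi / α))) := by
  have h1 : Tendsto (fun δ : ℝ => ∫ w in Ioo 0 (1 - δ), foldedKernel α w) (𝓝[>] 0)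
      (𝓝 (Real.pi * Real.cot (Real.pi / α))) := by
    rw [← integral_foldedKernel hα]
    have hc : AECover (volume.restrict (Ioo (0 : ℝ) 1)) (𝓝[>] (0 : ℝ))
        (fun δ => Ioo 0 (1 - δ)) := by
      refine aecover_Ioo_of_Ioo tendsto_const_nhds ?_
      have : Tendsto (fun δ : ℝ => 1 - δ) (𝓝 0) (𝓝 (1 - 0)) := by
        exact (continuous_const.sub continuous_id).tendsto 0
      rw [sub_zero] at this
      exact this.mono_left nhdsWithin_le_nhds
    refine (hc.integral_tendsto_of_countably_generated (integrableOn_foldedKernel hα)).congr' ?_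
    filter_upwards [self_mem_nhdsWithin] with δ hδ
    rw [Measure.restrict_restrict measurableSet_Ioo, Ioo_inter_Ioo, max_self,
      min_eq_left (by linarith [mem_Ioi.1 hδ])]
  have h2 : Tendsto (fun δ : ℝ => ∫ w in Ico (1 - δ) (1 / (1 + δ)),
      α * w ^ (α - 2) / (1 - w ^ α)) (𝓝[>] 0) (𝓝 0) := by
    have hb : Tendsto (fun δ : ℝ => 2 * α * δ) (𝓝[>] 0) (𝓝 0) := by
      have : Tendsto (fun δ : ℝ => 2 * α * δ) (𝓝 0) (𝓝 (2 * α * 0)) :=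
        (continuous_const.mul continuous_id).tendsto 0
      rw [mul_zero] at this
      exact this.mono_left nhdsWithin_le_nhds
    refine squeeze_zero_norm' ?_ hb
    filter_upwards [Ioo_mem_nhdsGT (show (0 : ℝ) < 1 / 2 by norm_num)] with δ ⟨hδ0, hδ1⟩
    have hlt : 1 / (1 + δ) < 1 := by rw [div_lt_one (by linarith)]; linarith
    have hle : 1 - δ ≤ 1 / (1 + δ) := by
      rw [le_div_iff₀ (by linarith)]; nlinarith
    have hd : 1 - 1 / (1 + δ) = δ / (1 + δ) := by field_simp; ring
    refine (norm_setIntegral_le_of_norm_le_const (C := 2 * α * (1 + δ) / δ) (by simp) ?_).trans ?_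
    · intro w ⟨hw1, hw2⟩
      have hw0 : 0 < w := by linarith
      have hr := rpow_le_self_of_mem hα.1 ⟨hw0, hw2.trans hlt⟩
      have hq : δ / (1 + δ) ≤ 1 - w ^ α := by linarith
      have hp : 0 < δ / (1 + δ) := by positivity
      have hk : w ^ (α - 2) ≤ 2 := by
        calc w ^ (α - 2) ≤ w ^ (-1 : ℝ) :=
              Real.rpow_le_rpow_of_exponent_ge hw0 (by linarith) (by linarith [hα.1])
          _ = w⁻¹ := Real.rpow_neg_one w
          _ ≤ (1 / 2)⁻¹ := inv_anti₀ (by norm_num) (by linarith)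
          _ = 2 := by norm_num
      have ha : 0 < α := by linarith [hα.1]
      have hk0 := Real.rpow_pos_of_pos hw0 (α - 2)
      rw [Real.norm_eq_abs, abs_of_pos (div_pos (by positivity) (by linarith))]
      calc α * w ^ (α - 2) / (1 - w ^ α) ≤ α * 2 / (δ / (1 + δ)) := by gcongr
        _ = 2 * α * (1 + δ) / δ := by field_simp
    · rw [Real.volume_real_Ico_of_le hle]
      apply le_of_eq
      field_simp
      ring
  have h3 := h1.sub h2
  rw [sub_zero] at h3
  refine h3.congr' ?_
  filter_upwards [Ioo_mem_nhdsGT (show (0 : ℝ) < 1 by norm_num)] with δ ⟨hδ0, hδ1⟩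
  have hlt : 1 / (1 + δ) < 1 := by rw [div_lt_one (by linarith)]; linarith
  have hle : 1 - δ ≤ 1 / (1 + δ) := by
    rw [le_div_iff₀ (by linarith)]; nlinarith
  have hB : IntegrableOn (fun w => α * w ^ (α - 2) / (1 - w ^ α)) (Ioo 0 (1 / (1 + δ))) :=
    integrableOn_mul_inv_one_sub_rpow hα.1 hlt ((integrableOn_rpow_sub_two hα.1).const_mul α)
  have hA : IntegrableOn (fun w => α / (1 - w ^ α)) (Ioo 0 (1 - δ)) :=
    integrableOn_mul_inv_one_sub_rpow (f := fun _ => α) hα.1 (by linarith)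
      (integrableOn_const (by simp))
  have hu : Ioo 0 (1 / (1 + δ)) = Ioo 0 (1 - δ) ∪ Ico (1 - δ) (1 / (1 + δ)) :=
    (Ioo_union_Ico_eq_Ioo (by linarith) hle).symm
  have hdis : Disjoint (Ioo 0 (1 - δ)) (Ico (1 - δ) (1 / (1 + δ))) :=
    disjoint_left.2 fun x hx hy => absurd hx.2 (not_lt.2 hy.1)
  rw [hu] at hB ⊢
  rw [setIntegral_union hdis measurableSet_Ico hB.left_of_union hB.right_of_union, ← sub_sub,
    ← integral_sub hA hB.left_of_union]
  congr 1
  refine integral_congr_ae (.of_forall fun w => ?_)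
  simp only [foldedKernel]
  ring

lemma setIntegral_diff_Icc_eq {α lam ε : ℝ} (hα : 1 < α) (hlam : 0 < lam) (hε : ε ∈ Ioo 0 lam) :
    ∫ u in Ioi (0 : ℝ) \ Icc (lam - ε) (lam + ε), α * lam ^ (α - 1) / (lam ^ α - u ^ α) =
      (∫ w in Ioo 0 (1 - ε / lam), α / (1 - w ^ α)) -
        ∫ w in Ioo 0 (1 / (1 + ε / lam)), α * w ^ (α - 2) / (1 - w ^ α) := by
  obtain ⟨h0, h1⟩ := hε
  have hd0 : 0 < ε / lam := by positivity
  have hlt : 1 / (1 + ε / lam) < 1 := by rw [div_lt_one (by linarith)]; linarith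
  have hlp := Real.rpow_pos_of_pos hlam α
  have hl : lam ^ (α - 1) = lam ^ α / lam := by rw [Real.rpow_sub_one hlam.ne']
  have hset : Ioi (0 : ℝ) \ Icc (lam - ε) (lam + ε) = Ioo 0 (lam - ε) ∪ Ioi (lam + ε) := by
    ext u
    simp only [Set.mem_sdiff, mem_Ioi, mem_Icc, mem_union, mem_Ioo, not_and_or, not_le]
    constructor
    · rintro ⟨hu, h | h⟩
      exacts [Or.inl ⟨hu, h⟩, Or.inr h]
    · rintro (⟨hu, h⟩ | h)
      exacts [⟨hu, Or.inl h⟩, ⟨by linarith, Or.inr h⟩]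
  have hdis : Disjoint (Ioo 0 (lam - ε)) (Ioi (lam + ε)) :=
    disjoint_left.2 fun x hx hy => by linarith [hx.2, mem_Ioi.1 hy]
  have him1 : (fun w => lam * w) '' Ioo 0 (1 - ε / lam) = Ioo 0 (lam - ε) := by
    rw [image_mul_left_Ioo hlam, mul_zero, mul_sub, mul_div_cancel₀ _ hlam.ne', mul_one]
  have him2 : (fun w => lam / w) '' Ioo 0 (1 / (1 + ε / lam)) = Ioi (lam + ε) := by
    ext u
    simp only [mem_image, mem_Ioo, mem_Ioi]
    constructor
    · rintro ⟨w, ⟨hw0, hw⟩, rfl⟩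
      rw [lt_div_iff₀ (by linarith)] at hw
      rw [lt_div_iff₀ hw0]
      have : lam * (w * (1 + ε / lam)) < lam * 1 := by gcongr
      have e : lam * (w * (1 + ε / lam)) = (lam + ε) * w := by field_simp
      linarith
    · intro hu
      have hu0 : 0 < u := by linarith
      refine ⟨lam / u, ⟨by positivity, ?_⟩, by field_simp⟩
      have e : 1 / (1 + ε / lam) = lam / (lam + ε) := by field_simp
      rw [e]
      gcongr
  have hd1 : ∀ w ∈ Ioo 0 (1 - ε / lam),
      HasDerivWithinAt (fun w => lam * w) lam (Ioo 0 (1 - ε / lam)) w := fun w _ => by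
    simpa using ((hasDerivAt_id w).const_mul lam).hasDerivWithinAt
  have hd2 : ∀ w ∈ Ioo 0 (1 / (1 + ε / lam)),
      HasDerivWithinAt (fun w => lam / w) (-(lam / w ^ 2)) (Ioo 0 (1 / (1 + ε / lam))) w :=
    fun w hw => by
      simpa [div_eq_mul_inv] using ((hasDerivAt_inv hw.1.ne').const_mul lam).hasDerivWithinAt
  have hi1 : InjOn (fun w => lam * w) (Ioo 0 (1 - ε / lam)) :=
    (mul_right_injective₀ hlam.ne').injOn
  have hi2 : InjOn (fun w => lam / w) (Ioo 0 (1 / (1 + ε / lam))) := fun x hx y hy h => by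
    simpa [div_eq_mul_inv, hlam.ne'] using h
  have hc1 : EqOn (fun w => |lam| • (α * lam ^ (α - 1) / (lam ^ α - (lam * w) ^ α)))
      (fun w => α / (1 - w ^ α)) (Ioo 0 (1 - ε / lam)) := fun w hw => by
    have := rpow_le_self_of_mem hα ⟨hw.1, hw.2.trans (by linarith)⟩
    have h : 1 - w ^ α ≠ 0 := by linarith [hw.2]
    have e : lam ^ α - lam ^ α * w ^ α = lam ^ α * (1 - w ^ α) := by ring
    simp only [abs_of_pos hlam, smul_eq_mul]
    rw [Real.mul_rpow hlam.le hw.1.le, hl, e]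
    field_simp
  have hc2 : EqOn
      (fun w => |-(lam / w ^ 2)| • (α * lam ^ (α - 1) / (lam ^ α - (lam / w) ^ α)))
      (fun w => -(α * w ^ (α - 2) / (1 - w ^ α))) (Ioo 0 (1 / (1 + ε / lam))) := fun w hw => by
    have := rpow_le_self_of_mem hα ⟨hw.1, hw.2.trans hlt⟩
    have h : 1 - w ^ α ≠ 0 := by linarith [hw.2]
    have hw0 := hw.1
    have hwp := Real.rpow_pos_of_pos hw0 α
    have e : lam ^ α - lam ^ α / w ^ α = -(lam ^ α * (1 - w ^ α) / w ^ α) := by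
      field_simp
      ring
    simp only [abs_neg, abs_of_pos (show 0 < lam / w ^ 2 by positivity), smul_eq_mul]
    rw [Real.div_rpow hlam.le hw.1.le, hl, e, Real.rpow_sub hw0, Real.rpow_two]
    field_simp
  have hA : IntegrableOn (fun w => α / (1 - w ^ α)) (Ioo 0 (1 - ε / lam)) :=
    integrableOn_mul_inv_one_sub_rpow (f := fun _ => α) hα (by linarith)
      (integrableOn_const (by simp))
  have hB : IntegrableOn (fun w => -(α * w ^ (α - 2) / (1 - w ^ α))) (Ioo 0 (1 / (1 + ε / lam))) :=
    (integrableOn_mul_inv_one_sub_rpow hα hlt ((integrableOn_rpow_sub_two hα).const_mul α)).neg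
  rw [hset, ← him1, ← him2, setIntegral_union (by rwa [him1, him2])
    (by rw [him2]; exact measurableSet_Ioi)
    ((integrableOn_image_iff_integrableOn_abs_deriv_smul measurableSet_Ioo hd1 hi1 _).2
      ((integrableOn_congr_fun hc1 measurableSet_Ioo).2 hA))
    ((integrableOn_image_iff_integrableOn_abs_deriv_smul measurableSet_Ioo hd2 hi2 _).2
      ((integrableOn_congr_fun hc2 measurableSet_Ioo).2 hB)),
    integral_image_eq_integral_abs_deriv_smul measurableSet_Ioo hd1 hi1,
    integral_image_eq_integral_abs_deriv_smul measurableSet_Ioo hd2 hi2,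
    setIntegral_congr_fun measurableSet_Ioo hc1, setIntegral_congr_fun measurableSet_Ioo hc2,
    integral_neg, ← sub_eq_add_neg]

theorem pv_integral_stable_cot (α lam : ℝ) (hα : α ∈ Ioc (1:ℝ) 2) (hlam : 0 < lam) :
    Tendsto (fun ε : ℝ =>
        ∫ u in Ioi (0:ℝ) \ Icc (lam - ε) (lam + ε),
          α * lam ^ (α - 1) / (lam ^ α - u ^ α))
      (𝓝[>] 0) (𝓝 (Real.pi * Real.cot (Real.pi / α))) ∧
    Tendsto (fun ε : ℝ =>
        -(Real.pi)⁻¹ * ∫ u in Ioi (0:ℝ) \ Icc (lam - ε) (lam + ε),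
          α * lam ^ (α - 1) / (lam ^ α - u ^ α))
      (𝓝[>] 0) (𝓝 (-Real.cot (Real.pi / α))) ∧
    Real.arctan (-Real.cot (Real.pi / α)) = Real.pi / α - Real.pi / 2 := by
  have hpi := Real.pi_pos
  have hpv : Tendsto (fun ε : ℝ =>
        ∫ u in Ioi (0:ℝ) \ Icc (lam - ε) (lam + ε),
          α * lam ^ (α - 1) / (lam ^ α - u ^ α))
      (𝓝[>] 0) (𝓝 (Real.pi * Real.cot (Real.pi / α))) := by
    have hs : Tendsto (fun ε : ℝ => ε / lam) (𝓝[>] 0) (𝓝[>] 0) := by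
      refine tendsto_nhdsWithin_iff.2 ⟨?_, ?_⟩
      · have : Tendsto (fun ε : ℝ => ε / lam) (𝓝 0) (𝓝 (0 / lam)) :=
          (continuous_id.div_const lam).tendsto 0
        rw [zero_div] at this
        exact this.mono_left nhdsWithin_le_nhds
      · filter_upwards [self_mem_nhdsWithin] with ε hε
        exact div_pos hε hlam
    refine ((tendsto_integral_sub_integral hα).comp hs).congr' ?_
    filter_upwards [Ioo_mem_nhdsGT hlam] with ε hε
    exact (setIntegral_diff_Icc_eq hα.1 hlam hε).symm
  refine ⟨hpv, ?_, ?_⟩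
  · have h := hpv.const_mul (-(Real.pi)⁻¹)
    rwa [← mul_assoc, neg_mul, inv_mul_cancel₀ hpi.ne', neg_one_mul] at h
  · have h0 : 0 < α := by linarith [hα.1]
    have h1 : Real.pi / α < Real.pi := div_lt_self hpi hα.1
    have h2 : 0 < Real.pi / α := by positivity
    have e : -Real.cot (Real.pi / α) = Real.tan (Real.pi / α - Real.pi / 2) := by
      rw [Real.tan_eq_sin_div_cos, Real.sin_sub_pi_div_two, Real.cos_sub_pi_div_two,
        Real.cot_eq_cos_div_sin, neg_div]
    rw [e, Real.arctan_tan (by linarith) (by linarith)]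
end

section
/- Let ψ : (0,∞) → (0,∞) be differentiable, strictly increasing and concave, and set Ψ(ξ) = ψ(ξ²) for ξ > 0. Then for all λ, ξ > 0 with ξ ≠ λ: 2λ/(λ² − ξ²) − Ψ'(λ)/(Ψ(λ) − Ψ(ξ)) ≥ 0, where Ψ'(λ) = 2λ·ψ'(λ²). -/
open Set

theorem fourierG_nonneg (ψ ψ' : ℝ → ℝ)
    (hpos : ∀ u ∈ Ioi (0:ℝ), 0 < ψ u)
    (hd : ∀ u ∈ Ioi (0:ℝ), HasDerivAt ψ (ψ' u) u)
    (hmono : StrictMonoOn ψ (Ioi 0))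
    (hconc : ConcaveOn ℝ (Ioi 0) ψ)
    (lam ξ : ℝ) (hlam : 0 < lam) (hξ : 0 < ξ) (hne : ξ ≠ lam) :
    0 ≤ 2 * lam / (lam^2 - ξ^2) - (2 * lam * ψ' (lam^2)) / (ψ (lam^2) - ψ (ξ^2)) := by
  have ha : lam ^ 2 ∈ Ioi (0:ℝ) := pow_pos hlam 2
  have hb : ξ ^ 2 ∈ Ioi (0:ℝ) := pow_pos hξ 2
  rcases lt_or_gt_of_ne hne with h | h
  · have hlt : ξ ^ 2 < lam ^ 2 := pow_lt_pow_left₀ h hξ.le two_ne_zero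
    have hψ := hmono hb ha hlt
    have hs := hconc.le_slope_of_hasDerivAt hb ha hlt (hd _ ha)
    rw [slope_def_field, le_div_iff₀ (sub_pos.2 hlt)] at hs
    rw [sub_nonneg, div_le_div_iff₀ (sub_pos.2 hψ) (sub_pos.2 hlt), mul_assoc (2 * lam) (ψ' _)]
    exact mul_le_mul_of_nonneg_left hs (by positivity)
  · have hlt : lam ^ 2 < ξ ^ 2 := pow_lt_pow_left₀ h hlam.le two_ne_zero
    have hψ := hmono ha hb hlt
    have hs := hconc.slope_le_of_hasDerivAt ha hb hlt (hd _ ha)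
    rw [slope_def_field, div_le_iff₀ (sub_pos.2 hlt)] at hs
    rw [sub_nonneg, ← neg_sub (ψ (ξ ^ 2)), ← neg_sub (ξ ^ 2), div_neg, div_neg, neg_le_neg_iff,
      div_le_div_iff₀ (sub_pos.2 hlt) (sub_pos.2 hψ), mul_assoc (2 * lam) (ψ' _)]
    exact mul_le_mul_of_nonneg_left hs (by positivity)
end

section
/- Assume Ψ : (0,∞) → [0,∞) is strictly increasing, twice continuously differentiable with Ψ'(ζ) > 0 and 2ζ·Ψ''(ζ) ≤ Ψ'(ζ) for all ζ > 0, and ∫₀^∞ 1/(1+Ψ(ζ)) dζ < ∞. Then for every λ > 0, K_λ ≥ 0; consequently ϑ_λ := arctan K_λ ∈ [0, π/2). -/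
open MeasureTheory Filter Topology Set

/-- If `2 ζ Ψ'' ≤ Ψ'` and `Ψ' > 0` on `(0, ∞)`, then `ζ ↦ Ψ' ζ / ζ` is antitone there. -/
lemma antitoneOn_deriv_div_id {Ψ' Ψ'' : ℝ → ℝ}
    (hΨd2 : ∀ ζ ∈ Ioi (0 : ℝ), HasDerivAt Ψ' (Ψ'' ζ) ζ)
    (hΨ'pos : ∀ ζ ∈ Ioi (0 : ℝ), 0 < Ψ' ζ)
    (hconc : ∀ ζ ∈ Ioi (0 : ℝ), 2 * ζ * Ψ'' ζ ≤ Ψ' ζ) :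
    AntitoneOn (fun ζ => Ψ' ζ / ζ) (Ioi 0) := by
  have hd : ∀ ζ ∈ Ioi (0 : ℝ),
      HasDerivAt (fun ζ => Ψ' ζ / ζ) ((Ψ'' ζ * ζ - Ψ' ζ * 1) / ζ ^ 2) ζ :=
    fun ζ hζ => (hΨd2 ζ hζ).div (hasDerivAt_id ζ) (ne_of_gt hζ)
  refine antitoneOn_of_hasDerivWithinAt_nonpos (convex_Ioi 0)
    (fun ζ hζ => (hd ζ hζ).continuousAt.continuousWithinAt)
    (fun ζ hζ => (hd ζ (interior_subset hζ)).hasDerivWithinAt) fun ζ hζ => ?_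
  have hζ := interior_subset hζ
  refine div_nonpos_of_nonpos_of_nonneg ?_ (sq_nonneg ζ)
  nlinarith [hΨ'pos ζ hζ, hconc ζ hζ]

/-- If `ζ ↦ Ψ' ζ / ζ` is antitone, then `Ψ` lies below its tangent in the variable `ζ ^ 2`. -/
lemma sub_le_tangent_sq {Ψ Ψ' : ℝ → ℝ}
    (hΨd1 : ∀ ζ ∈ Ioi (0 : ℝ), HasDerivAt Ψ (Ψ' ζ) ζ)
    (hanti : AntitoneOn (fun ζ => Ψ' ζ / ζ) (Ioi 0))
    {lam ζ : ℝ} (hlam : 0 < lam) (hζ : 0 < ζ) :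
    Ψ ζ - Ψ lam ≤ Ψ' lam / (2 * lam) * (ζ ^ 2 - lam ^ 2) := by
  set G : ℝ → ℝ := fun x => Ψ' lam / (2 * lam) * x ^ 2 - Ψ x with hG
  have hd : ∀ x ∈ Ioi (0 : ℝ), HasDerivAt G (x * (Ψ' lam / lam - Ψ' x / x)) x := by
    intro x hx
    have hx0 : x ≠ 0 := ne_of_gt hx
    refine (((hasDerivAt_pow 2 x).const_mul (Ψ' lam / (2 * lam))).sub (hΨd1 x hx)).congr_deriv ?_
    push_cast
    field_simp
  suffices G lam ≤ G ζ by simp only [hG] at this; linarith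
  rcases le_total lam ζ with h | h
  · have hsub : Icc lam ζ ⊆ Ioi 0 := fun x hx => hlam.trans_le hx.1
    refine monotoneOn_of_hasDerivWithinAt_nonneg (convex_Icc lam ζ)
      (fun x hx => (hd x (hsub hx)).continuousAt.continuousWithinAt)
      (fun x hx => (hd x (hsub (interior_subset hx))).hasDerivWithinAt) (fun x hx => ?_)
      (left_mem_Icc.2 h) (right_mem_Icc.2 h) h
    have hx := interior_subset hx
    exact mul_nonneg (hsub hx).le (sub_nonneg.2 (hanti hlam (hsub hx) hx.1))
  · have hsub : Icc ζ lam ⊆ Ioi 0 := fun x hx => hζ.trans_le hx.1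
    refine antitoneOn_of_hasDerivWithinAt_nonpos (convex_Icc ζ lam)
      (fun x hx => (hd x (hsub hx)).continuousAt.continuousWithinAt)
      (fun x hx => (hd x (hsub (interior_subset hx))).hasDerivWithinAt) (fun x hx => ?_)
      (left_mem_Icc.2 h) (right_mem_Icc.2 h) h
    have hx := interior_subset hx
    exact mul_nonpos_of_nonneg_of_nonpos (hsub hx).le
      (sub_nonpos.2 (hanti (hsub hx) hlam hx.2))

/-- The tangent bound for `Ψ` in the variable `ζ ^ 2` compares the two singular kernels. -/
lemma div_sub_le_kernel {Ψ Ψ' : ℝ → ℝ}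
    (hmono : StrictMonoOn Ψ (Ioi 0))
    {lam ζ : ℝ} (hlam : 0 < lam) (hζ : 0 < ζ) (hne : ζ ≠ lam)
    (htan : Ψ ζ - Ψ lam ≤ Ψ' lam / (2 * lam) * (ζ ^ 2 - lam ^ 2)) :
    Ψ' lam / (Ψ lam - Ψ ζ) ≤ 2 * lam / (lam ^ 2 - ζ ^ 2) := by
  rw [div_mul_eq_mul_div, le_div_iff₀ (by positivity)] at htan
  rcases lt_or_gt_of_ne hne with h | h
  · have h1 := sub_pos.2 (hmono hζ hlam h)
    have h2 : 0 < lam ^ 2 - ζ ^ 2 := by nlinarith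
    rw [div_le_div_iff₀ h1 h2]
    linarith
  · have h1 := sub_pos.2 (hmono hlam hζ h)
    have h2 : 0 < ζ ^ 2 - lam ^ 2 := by nlinarith
    rw [← neg_le_neg_iff, ← div_neg, ← div_neg, neg_sub, neg_sub, div_le_div_iff₀ h2 h1]
    linarith

lemma hasDerivAt_log_add_sub_log_sub {lam x : ℝ} (h1 : lam + x ≠ 0) (h2 : x - lam ≠ 0) :
    HasDerivAt (fun x => Real.log (lam + x) - Real.log (x - lam))
      (2 * lam / (lam ^ 2 - x ^ 2)) x := by
  refine ((((hasDerivAt_id' x).const_add lam).log h1).sub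
    (((hasDerivAt_id' x).sub_const lam).log h2)).congr_deriv ?_
  have h3 : lam ^ 2 - x ^ 2 ≠ 0 := by
    rw [show lam ^ 2 - x ^ 2 = -((lam + x) * (x - lam)) by ring]
    exact neg_ne_zero.2 (mul_ne_zero h1 h2)
  field_simp
  ring

lemma tendsto_log_add_sub_log_sub (lam : ℝ) :
    Tendsto (fun x => Real.log (lam + x) - Real.log (x - lam)) atTop (𝓝 0) := by
  have h := (Real.tendsto_log_comp_add_sub_log lam).sub
    (Real.tendsto_log_comp_add_sub_log (-lam))
  rw [sub_zero] at h
  refine h.congr fun x => ?_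
  rw [add_comm lam, sub_eq_add_neg x lam]
  ring

lemma Ioi_diff_Icc_eq_union {a b c : ℝ} (hac : a ≤ c) :
    Ioi a \ Icc b c = Ioo a b ∪ Ioi c := by
  ext x
  simp only [Set.mem_sdiff, mem_Ioi, mem_Icc, mem_union, mem_Ioo, not_and_or, not_le]
  constructor
  · rintro ⟨h, h' | h'⟩
    exacts [Or.inl ⟨h, h'⟩, Or.inr h']
  · rintro (⟨h, h'⟩ | h)
    exacts [⟨h, Or.inl h'⟩, ⟨hac.trans_lt h, Or.inr h⟩]

/-- The truncated integral of `2 lam / (lam ^ 2 - ζ ^ 2)` around its pole. -/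
lemma integral_kernel {lam ε : ℝ} (hε : 0 < ε) (hε' : ε < lam) :
    IntegrableOn (fun ζ => 2 * lam / (lam ^ 2 - ζ ^ 2))
        (Ioi 0 \ Icc (lam - ε) (lam + ε)) ∧
      ∫ ζ in Ioi (0 : ℝ) \ Icc (lam - ε) (lam + ε), 2 * lam / (lam ^ 2 - ζ ^ 2) =
        Real.log (2 * lam - ε) - Real.log (2 * lam + ε) := by
  have hlam : 0 < lam := hε.trans hε'
  have hleft : ∀ x ∈ uIcc 0 (lam - ε), HasDerivAt
      (fun x => Real.log (lam + x) - Real.log (x - lam)) (2 * lam / (lam ^ 2 - x ^ 2)) x := by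
    intro x hx
    rw [uIcc_of_le (by linarith)] at hx
    exact hasDerivAt_log_add_sub_log_sub (by linarith [hx.1]) (by linarith [hx.2])
  have hright : ∀ x ∈ Ici (lam + ε), HasDerivAt
      (fun x => Real.log (lam + x) - Real.log (x - lam)) (2 * lam / (lam ^ 2 - x ^ 2)) x := by
    intro x hx
    have hx : lam + ε ≤ x := hx
    exact hasDerivAt_log_add_sub_log_sub (by linarith) (by linarith)
  have hnonpos : ∀ x ∈ Ioi (lam + ε), 2 * lam / (lam ^ 2 - x ^ 2) ≤ 0 := by
    intro x hx
    have hx : lam + ε < x := hx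
    exact div_nonpos_of_nonneg_of_nonpos (by linarith) (by nlinarith)
  have hint : IntervalIntegrable (fun ζ => 2 * lam / (lam ^ 2 - ζ ^ 2)) volume 0 (lam - ε) := by
    refine ContinuousOn.intervalIntegrable fun x hx => ContinuousAt.continuousWithinAt ?_
    rw [uIcc_of_le (by linarith)] at hx
    have : lam ^ 2 - x ^ 2 ≠ 0 := by nlinarith [hx.1, hx.2]
    fun_prop (disch := assumption)
  have hintL : IntegrableOn (fun ζ => 2 * lam / (lam ^ 2 - ζ ^ 2)) (Ioo 0 (lam - ε)) :=
    ((intervalIntegrable_iff_integrableOn_Ioo_of_le (by linarith)).1 hint)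
  have hintR := integrableOn_Ioi_deriv_of_nonpos' hright hnonpos (tendsto_log_add_sub_log_sub lam)
  rw [Ioi_diff_Icc_eq_union (by linarith)]
  refine ⟨hintL.union hintR, ?_⟩
  rw [setIntegral_union (disjoint_left.2 fun x hx hx' => ?_) measurableSet_Ioi hintL hintR,
    ← integral_Ioc_eq_integral_Ioo, ← intervalIntegral.integral_of_le (by linarith),
    intervalIntegral.integral_eq_sub_of_hasDerivAt hleft hint,
    integral_Ioi_of_hasDerivAt_of_nonpos' hright hnonpos (tendsto_log_add_sub_log_sub lam)]
  · rw [show lam - ε - lam = -ε by ring, show lam + ε - lam = ε by ring, zero_sub, add_zero,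
      Real.log_neg_eq_log, Real.log_neg_eq_log, show lam + (lam - ε) = 2 * lam - ε by ring,
      show lam + (lam + ε) = 2 * lam + ε by ring]
    ring
  · have h1 : x < lam - ε := hx.2
    have h2 : lam + ε < x := hx'
    linarith

theorem K_lambda_nonneg (Ψ Ψ' Ψ'' : ℝ → ℝ)
    (hmono : StrictMonoOn Ψ (Ioi 0))
    (hnonneg : ∀ ζ ∈ Ioi (0:ℝ), 0 ≤ Ψ ζ)
    (hΨd1 : ∀ ζ ∈ Ioi (0:ℝ), HasDerivAt Ψ (Ψ' ζ) ζ)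
    (hΨd2 : ∀ ζ ∈ Ioi (0:ℝ), HasDerivAt Ψ' (Ψ'' ζ) ζ)
    (hΨ''cont : ContinuousOn Ψ'' (Ioi 0))
    (hΨ'pos : ∀ ζ ∈ Ioi (0:ℝ), 0 < Ψ' ζ)
    (hconc : ∀ ζ ∈ Ioi (0:ℝ), 2 * ζ * Ψ'' ζ ≤ Ψ' ζ)
    (hint : IntegrableOn (fun ζ => 1 / (1 + Ψ ζ)) (Ioi 0))
    (lam : ℝ) (hlam : 0 < lam)
    (Kl : ℝ)
    (hKl : Tendsto (fun ε : ℝ =>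
        -(Real.pi)⁻¹ * ∫ ζ in Ioi (0:ℝ) \ Icc (lam - ε) (lam + ε),
          Ψ' lam / (Ψ lam - Ψ ζ))
      (𝓝[>] 0) (𝓝 Kl)) :
    0 ≤ Kl ∧ Real.arctan Kl ∈ Ico 0 (Real.pi / 2) := by
  suffices h : 0 ≤ Kl from
    ⟨h, Real.arctan_nonneg.2 h, Real.arctan_lt_pi_div_two Kl⟩
  refine ge_of_tendsto hKl ?_
  filter_upwards [Ioo_mem_nhdsGT hlam] with ε ⟨hε, hε'⟩
  refine mul_nonneg_of_nonpos_of_nonpos (by simp [Real.pi_pos.le]) ?_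
  by_cases hf : IntegrableOn (fun ζ => Ψ' lam / (Ψ lam - Ψ ζ)) (Ioi 0 \ Icc (lam - ε) (lam + ε))
  · obtain ⟨hk, hkval⟩ := integral_kernel hε hε'
    calc ∫ ζ in Ioi (0 : ℝ) \ Icc (lam - ε) (lam + ε), Ψ' lam / (Ψ lam - Ψ ζ)
        ≤ ∫ ζ in Ioi (0 : ℝ) \ Icc (lam - ε) (lam + ε), 2 * lam / (lam ^ 2 - ζ ^ 2) := by
          refine setIntegral_mono_on hf hk (measurableSet_Ioi.diff measurableSet_Icc) ?_
          rintro ζ ⟨hζ, hζ'⟩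
          refine div_sub_le_kernel hmono hlam hζ ?_
            (sub_le_tangent_sq hΨd1 (antitoneOn_deriv_div_id hΨd2 hΨ'pos hconc) hlam hζ)
          rintro rfl
          exact hζ' ⟨by linarith, by linarith⟩
      _ = Real.log (2 * lam - ε) - Real.log (2 * lam + ε) := hkval
      _ ≤ 0 := sub_nonpos.2 (Real.log_le_log (by linarith) (by linarith))
  · exact (integral_undef hf).le
end
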